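/- Let (R,M,k) be a regular local ring which is a G-ring. Then any quotient of R, any localization R_P of R at a prime P ∈ Spec R, and any localization of the polynomial ring R[T] at a maximal ideal is again a G-ring. -/

import Mathlib

/-!
Characteristic polyhedra of singularities without completion
(V. Cossart, O. Piltant), formalized statements.
-/

noncomputable section

open IsLocalRing TensorProduct

namespace CharPolyhedra

universe u v

/-! ### Polyhedral notions -/

/-- The nonnegative orthant in `ℝ^d`. -/
def orthant (d : ℕ) : Set (Fin d → ℝ) := {x | ∀ i, 0 ≤ x i}

/-- An `F`-subset of `ℝ_{≥0}^d`: a closed convex subset stable under translation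
by the nonnegative orthant. -/
def IsFSubset {d : ℕ} (Δ : Set (Fin d → ℝ)) : Prop :=
  Δ ⊆ orthant d ∧ IsClosed Δ ∧ Convex ℝ Δ ∧ ∀ v ∈ Δ, ∀ w ∈ orthant d, v + w ∈ Δ

/-- The smallest `F`-subset containing a given set of points. -/
def smallestFSubset {d : ℕ} (X : Set (Fin d → ℝ)) : Set (Fin d → ℝ) :=
  ⋂₀ {Δ | IsFSubset Δ ∧ X ⊆ Δ}

/-- A vertex of an `F`-subset: a point cut out by a positive linear form. -/
def IsVertex {d : ℕ} (Δ : Set (Fin d → ℝ)) (v : Fin d → ℝ) : Prop :=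
  ∃ L : Fin d → ℝ, (∀ i, 0 < L i) ∧ Δ ∩ {x | ∑ i, L i * x i = 1} = {v}

/-- A rational polyhedron: an `F`-subset cut out by finitely many nonnegative
rational linear forms. -/
def IsRationalPolyhedron {d : ℕ} (Δ : Set (Fin d → ℝ)) : Prop :=
  ∃ (n : ℕ) (L : Fin n → Fin d → ℚ), (∀ j i, 0 ≤ L j i) ∧
    Δ = {x | x ∈ orthant d ∧ ∀ j, 1 ≤ ∑ i, (L j i : ℝ) * x i}

/-- `min {L(a) : a ∈ Δ}` for a linear form with rational coefficients `L`. -/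
def ellOf {d : ℕ} (L : Fin d → ℚ) (Δ : Set (Fin d → ℝ)) : ℝ :=
  sInf ((fun x => ∑ i, (L i : ℝ) * x i) '' Δ)

/-! ### Regular local rings, systems of parameters -/

/-- A family `s` of `n` elements is a regular system of parameters of the local
ring `R`: it generates the maximal ideal and `n` equals the Krull dimension. -/
def IsSysOfParams (R : Type u) [CommRing R] [IsLocalRing R] {n : ℕ} (s : Fin n → R) : Prop :=
  Ideal.span (Set.range s) = maximalIdeal R ∧ ringKrullDim R = n

/-- `(y, u 0, ..., u (d-1))` is a regular system of parameters of `R`. -/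
def IsRSP (R : Type u) [CommRing R] [IsLocalRing R] {d : ℕ} (y : R) (u : Fin d → R) : Prop :=
  IsSysOfParams R (Fin.cons y u)

/-- A regular local ring: a Noetherian local ring whose maximal ideal is
generated by a regular system of parameters. -/
def IsRegularLocalRing (R : Type u) [CommRing R] [IsLocalRing R] : Prop :=
  IsNoetherianRing R ∧ ∃ (n : ℕ) (s : Fin n → R), IsSysOfParams R s

/-- A regular ring: a Noetherian ring all of whose localizations at primes are
regular local rings. -/
def IsRegularRing (A : Type u) [CommRing A] : Prop :=
  IsNoetherianRing A ∧ ∀ (P : Ideal A) [P.IsPrime],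
    IsRegularLocalRing (Localization.AtPrime P)

/-! ### Monomial expansions and polyhedra -/

variable {R : Type u} [CommRing R]

/-- The monomial `y^b u^a`, where `ab = (a, b)`. -/
def monomial {d : ℕ} (y : R) (u : Fin d → R) (ab : (Fin d → ℕ) × ℕ) : R :=
  y ^ ab.2 * ∏ i, u i ^ ab.1 i

/-- A finite expansion `f = Σ_{(a,b)} C_{a,b} y^b u^a` with all coefficients units. -/
def IsUnitExpansion {d : ℕ} (f y : R) (u : Fin d → R)
    (c : ((Fin d → ℕ) × ℕ) →₀ R) : Prop :=
  (∀ ab ∈ c.support, IsUnit (c ab)) ∧ f = c.sum fun ab r => r * monomial y u ab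

/-- The projection `(a, b) ↦ a / (m - b)` from the point `(0, m)`. -/
def projPoint {d : ℕ} (m : ℕ) (ab : (Fin d → ℕ) × ℕ) : Fin d → ℝ :=
  fun i => (ab.1 i : ℝ) / ((m : ℝ) - (ab.2 : ℝ))

/-- The projected points attached to (the support of) an expansion. -/
def expPoints {d : ℕ} (m : ℕ) (s : Finset ((Fin d → ℕ) × ℕ)) : Set (Fin d → ℝ) :=
  {x | ∃ ab ∈ s, ab.2 < m ∧ x = projPoint m ab}

/-- The polyhedron `Δ(f; u; y)` computed with prescribed order `m`: the smallest
`F`-subset containing the projected supports of all finite unit-coefficient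
expansions of `f` in the parameters `(y, u)`. -/
def DeltaOf {d : ℕ} (f y : R) (u : Fin d → R) (m : ℕ) : Set (Fin d → ℝ) :=
  smallestFSubset (⋃ c ∈ {c | IsUnitExpansion f y u c}, expPoints m c.support)

/-- The order of the image of `f` in `R/(u_1, ..., u_d)`, i.e. the largest `n`
with `f ∈ M^n + (u_1, ..., u_d)`. -/
def ordRes {d : ℕ} [IsLocalRing R] (f : R) (u : Fin d → R) : ℕ :=
  sSup {n : ℕ | f ∈ (maximalIdeal R) ^ n ⊔ Ideal.span (Set.range u)}

/-- Hironaka's polyhedron `Δ(f; u_1, ..., u_d; y)`. -/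
def Delta {d : ℕ} [IsLocalRing R] (f y : R) (u : Fin d → R) : Set (Fin d → ℝ) :=
  DeltaOf f y u (ordRes f u)

/-! ### Completion and the characteristic polyhedron -/

/-- The `M`-adic completion `R̂` of a local ring `R`. -/
abbrev Completion (R : Type u) [CommRing R] [IsLocalRing R] : Type u :=
  AdicCompletion (maximalIdeal R) R

/-- The canonical map `R → R̂`. -/
def cmpl {R : Type u} [CommRing R] [IsLocalRing R] : R →+* Completion R :=
  algebraMap R (Completion R)

/-- `(ŷ, u_1, ..., u_d)` is a regular system of parameters of the completion
`R̂`: it generates the maximal ideal `M·R̂` of `R̂`. -/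
def IsRSPhat (R : Type u) [CommRing R] [IsLocalRing R] {d : ℕ}
    (yh : Completion R) (u : Fin d → R) : Prop :=
  Ideal.span (insert yh (Set.range fun i => cmpl (u i)))
    = (maximalIdeal R).map (cmpl (R := R))

/-- Hironaka's characteristic polyhedron `Δ(f; u_1, ..., u_d)`: the intersection
of the `Δ(f; u; ŷ)` over all regular systems of parameters `(ŷ, u_1, ..., u_d)`
of the completion `R̂`. -/
def CharPolyhedron {d : ℕ} [IsLocalRing R] (f : R) (u : Fin d → R) : Set (Fin d → ℝ) :=
  ⋂ yh ∈ {yh : Completion R | IsRSPhat R yh u},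
    DeltaOf (cmpl f) yh (fun i => cmpl (u i)) (ordRes f u)

/-! ### G-rings, excellence -/

/-- A `κ`-algebra `A` is geometrically regular if `κ' ⊗[κ] A` is a regular ring
for every finite field extension `κ'/κ`. -/
def IsGeometricallyRegularAlgebra (κ : Type u) [Field κ] (A : Type v) [CommRing A]
    [Algebra κ A] : Prop :=
  ∀ (κ' : Type u) [Field κ'] [Algebra κ κ'] [Module.Finite κ κ'],
    IsRegularRing (κ' ⊗[κ] A)

/-- A local ring has geometrically regular formal fibers if, for every prime
`P ⊂ R`, the formal fiber `κ(P) ⊗_R R̂` is a geometrically regular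
`κ(P)`-algebra. -/
def HasGeomRegularFormalFibers (R : Type u) [CommRing R] [IsLocalRing R] : Prop :=
  ∀ (P : Ideal R) [P.IsPrime],
    IsGeometricallyRegularAlgebra (ResidueField (Localization.AtPrime P))
      (ResidueField (Localization.AtPrime P) ⊗[R] Completion R)

/-- A G-ring: a Noetherian ring all of whose localizations at primes have
geometrically regular formal fibers. -/
def IsGRing (A : Type u) [CommRing A] : Prop :=
  IsNoetherianRing A ∧ ∀ (P : Ideal A) [P.IsPrime],
    HasGeomRegularFormalFibers (Localization.AtPrime P)

/-- A saturated chain of primes: each step is a covering relation. -/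
def IsSaturatedChain {A : Type u} [CommRing A] (c : LTSeries (PrimeSpectrum A)) : Prop :=
  ∀ i : Fin c.length, c.toFun i.castSucc ⋖ c.toFun i.succ

/-- A catenary ring: any two saturated chains of primes with the same endpoints
have the same length. -/
def IsCatenary (A : Type u) [CommRing A] : Prop :=
  ∀ (c₁ c₂ : LTSeries (PrimeSpectrum A)), c₁.head = c₂.head → c₁.last = c₂.last →
    IsSaturatedChain c₁ → IsSaturatedChain c₂ → c₁.length = c₂.length

/-- Universally catenary: all polynomial rings over `A` are catenary. -/
def IsUniversallyCatenary (A : Type u) [CommRing A] : Prop :=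
  ∀ n : ℕ, IsCatenary (MvPolynomial (Fin n) A)

/-- The regular locus of any domain finite over `A` is open. -/
def HasOpenRegularLocus (A : Type u) [CommRing A] : Prop :=
  ∀ (B : Type u) [CommRing B] [IsDomain B] [Algebra A B] [Module.Finite A B],
    IsOpen {P : PrimeSpectrum B | IsRegularLocalRing (Localization.AtPrime P.asIdeal)}

/-- Quasi-excellent: a G-ring with open regular loci for finite domains over it. -/
def IsQuasiExcellent (A : Type u) [CommRing A] : Prop :=
  IsGRing A ∧ HasOpenRegularLocus A

/-- Excellent: universally catenary and quasi-excellent. -/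
def IsExcellent (A : Type u) [CommRing A] : Prop :=
  IsUniversallyCatenary A ∧ IsQuasiExcellent A

/-! ### Monomial valuations and associated graded rings -/

/-- The weight `l·b + L(a)` of the monomial `y^b u^a`. -/
def weight {d : ℕ} (l : ℝ) (L : Fin d → ℝ) (ab : (Fin d → ℕ) × ℕ) : ℝ :=
  l * (ab.2 : ℝ) + ∑ i, L i * (ab.1 i : ℝ)

/-- The ideal `I_λ` generated by the monomials `y^b u^a` with `l·b + L(a) ≥ λ`. -/
def monIdeal {d : ℕ} (y : R) (u : Fin d → R) (l : ℝ) (L : Fin d → ℝ) (lam : ℝ) :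
    Ideal R :=
  Ideal.span {g | ∃ ab : (Fin d → ℕ) × ℕ, g = monomial y u ab ∧ lam ≤ weight l L ab}

/-- The monomial valuation `v(g) := max {λ : g ∈ I_λ}`. -/
def vval {d : ℕ} (y : R) (u : Fin d → R) (l : ℝ) (L : Fin d → ℝ) (g : R) : ℝ :=
  sSup {lam : ℝ | g ∈ monIdeal y u l L lam}

/-- The Rees algebra `⊕_λ I_λ` of the filtration `(I_λ)`, realized inside the
monoid algebra `R[ℝ]`. -/
def ReesAlgebra {d : ℕ} (y : R) (u : Fin d → R) (l : ℝ) (L : Fin d → ℝ) :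
    Subalgebra R (AddMonoidAlgebra R ℝ) :=
  Algebra.adjoin R {p | ∃ (lam : ℝ) (x : R), x ∈ monIdeal y u l L lam ∧
    p = AddMonoidAlgebra.single lam x}

/-- The ideal `⊕_λ I_{λ⁺}` of the Rees algebra. -/
def grIdeal {d : ℕ} (y : R) (u : Fin d → R) (l : ℝ) (L : Fin d → ℝ) :
    Ideal (ReesAlgebra y u l L) :=
  Ideal.span {p | ∃ (lam : ℝ) (x : R), (∃ lam' > lam, x ∈ monIdeal y u l L lam') ∧
    (p : AddMonoidAlgebra R ℝ) = AddMonoidAlgebra.single lam x}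

/-- The associated graded ring `gr_v(R) = ⊕_λ I_λ / I_{λ⁺}` of `R` with respect
to the monomial valuation `v`, realized as `(⊕_λ I_λ) / (⊕_λ I_{λ⁺})`. -/
abbrev GrRing {d : ℕ} (y : R) (u : Fin d → R) (l : ℝ) (L : Fin d → ℝ) : Type u :=
  ReesAlgebra y u l L ⧸ grIdeal y u l L

/-- `x ∈ gr_v(R)` is the initial form of `g ∈ R`: the class of `g` placed in
degree `v(g)`. -/
def IsInitialForm {d : ℕ} (y : R) (u : Fin d → R) (l : ℝ) (L : Fin d → ℝ) (g : R)
    (x : GrRing y u l L) : Prop :=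
  ∃ h : AddMonoidAlgebra.single (vval y u l L g) g ∈ ReesAlgebra y u l L,
    x = Ideal.Quotient.mk (grIdeal y u l L)
      ⟨AddMonoidAlgebra.single (vval y u l L g) g, h⟩

end CharPolyhedra

universe u v

namespace GR


section Basics
variable {A : Type u} [CommRing A]

lemma reg_of_span [IsLocalRing A] [IsNoetherianRing A] (s : Finset A)
    (hs : Ideal.span (s : Set A) = maximalIdeal A) (h : (s.card : WithBot ℕ∞) ≤ ringKrullDim A) :
    IsRegularLocalRing A := by
  apply IsRegularLocalRing.of_spanFinrank_maximalIdeal_le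
  refine le_trans ?_ h
  rw [← hs]
  have := Submodule.spanFinrank_span_le_ncard_of_finite (R := A) s.finite_toSet
  rw [Set.ncard_coe_finset] at this
  exact_mod_cast this

lemma reg_span [IsRegularLocalRing A] : ∃ s : Finset A,
    Ideal.span (s : Set A) = maximalIdeal A ∧ (s.card : WithBot ℕ∞) = ringKrullDim A := by
  obtain ⟨s, h1, h2⟩ := Submodule.FG.exists_span_finset_card_eq_spanFinrank
    (maximalIdeal A).fg_of_isNoetherianRing
  exact ⟨s, h2, by rw [h1]; exact IsRegularLocalRing.spanFinrank_maximalIdeal⟩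

lemma span_drop [IsLocalRing A] [IsNoetherianRing A] {x : A} (hx : x ∈ maximalIdeal A)
    (hx2 : x ∉ maximalIdeal A ^ 2) : ∃ s : Finset A, s.card + 1 = (maximalIdeal A).spanFinrank ∧
      Ideal.span (insert x (s : Set A)) = maximalIdeal A := by
  classical
  set v : CotangentSpace A := (maximalIdeal A).toCotangent ⟨x, hx⟩ with hv
  have hv0 : v ≠ 0 := by
    intro h
    rw [hv, Ideal.toCotangent_eq_zero] at h
    exact hx2 h
  have hli : LinearIndepOn (ResidueField A) id ({v} : Set (CotangentSpace A)) :=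
    LinearIndepOn.singleton (v := id) hv0
  obtain ⟨S, hvS, b, hb⟩ : ∃ S : Set (CotangentSpace A), v ∈ S ∧
      ∃ b : Module.Basis S (ResidueField A) (CotangentSpace A), ∀ i, b i = i :=
    ⟨_, hli.subset_extend (Set.subset_univ _) rfl, Module.Basis.extend hli,
      fun i => Module.Basis.extend_apply_self hli i⟩
  have hfin : Finite S := Module.Finite.finite_basis b
  have hcard : Nat.card S = (maximalIdeal A).spanFinrank := by
    rw [spanFinrank_maximalIdeal_eq_finrank_cotangentSpace, Module.finrank_eq_nat_card_basis b]
  have hsurj : Function.Surjective (maximalIdeal A).toCotangent :=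
    (maximalIdeal A).toCotangent_surjective
  choose g hg using hsurj
  let g' : CotangentSpace A → maximalIdeal A := fun w => if w = v then ⟨x, hx⟩ else g w
  have hg' : ∀ w, (maximalIdeal A).toCotangent (g' w) = w := by
    intro w; by_cases h : w = v
    · simp [g', h, hv]
    · simp [g', h, hg]
  have hspan : Submodule.span A (g' '' S) = ⊤ := by
    rw [← CotangentSpace.span_image_eq_top_iff, Set.image_image]
    simp only [hg', Set.image_id']
    have h3 : Set.range b = S := by
      have : ⇑b = ((↑) : S → CotangentSpace A) := funext hb
      rw [this, Subtype.range_coe]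
    rw [← b.span_eq, h3]
  have hfin' : S.Finite := hfin
  let T : Finset (CotangentSpace A) := hfin'.toFinset.erase v
  have hinj : Function.Injective (fun w => ((g' w : maximalIdeal A) : A)) := by
    intro a b hab
    rw [← hg' a, ← hg' b]; congr 1; exact Subtype.ext hab
  refine ⟨T.image (fun w => ((g' w : maximalIdeal A) : A)), ?_, ?_⟩
  · rw [Finset.card_image_of_injective _ hinj, Finset.card_erase_of_mem (by simpa using hvS),
      ← hcard, Nat.card_eq_card_finite_toFinset hfin']
    have : 0 < hfin'.toFinset.card := Finset.card_pos.mpr ⟨v, by simpa using hvS⟩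
    omega
  · have h1 := congrArg (Submodule.map (maximalIdeal A).subtype) hspan
    rw [Submodule.map_span, Submodule.map_top, Submodule.range_subtype, Set.image_image] at h1
    refine Eq.trans ?_ h1
    change Ideal.span _ = Ideal.span _
    congr 1
    have h2 : S = insert v (T : Set (CotangentSpace A)) := by
      ext w; by_cases h : w = v <;> simp [T, h, hvS]
    conv_rhs => rw [h2, Set.image_insert_eq]
    simp [g']

lemma dim_ne_bot [IsLocalRing A] [IsNoetherianRing A] : ∃ n : ℕ, ringKrullDim A = n := by
  have h := ringKrullDim_le_spanFinrank_maximalIdeal A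
  have h0 : (0 : WithBot ℕ∞) ≤ ringKrullDim A := ringKrullDim_nonneg_of_nontrivial
  generalize ringKrullDim A = d at *
  induction d with
  | bot => simp at h0
  | coe d => induction d with
    | top => exact absurd h (by
        rw [not_le]; exact_mod_cast ENat.natCast_lt_top _)
    | coe n => exact ⟨n, rfl⟩

instance quot_local [IsLocalRing A] {x : A} [hx : Fact (x ∈ maximalIdeal A)] :
    IsLocalRing (A ⧸ Ideal.span {x}) := by
  have : Nontrivial (A ⧸ Ideal.span {x}) := Ideal.Quotient.nontrivial_iff.mpr (by
    intro h
    have : maximalIdeal A = ⊤ := top_le_iff.mp (h ▸ (Ideal.span_singleton_le_iff_mem _).mpr hx.out)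
    exact (maximalIdeal.isMaximal A).ne_top this)
  exact IsLocalRing.of_surjective' (Ideal.Quotient.mk _) Ideal.Quotient.mk_surjective

lemma max_quot [IsLocalRing A] (I : Ideal A) [IsLocalRing (A ⧸ I)] :
    maximalIdeal (A ⧸ I) = (maximalIdeal A).map (Ideal.Quotient.mk I) := by
  have : IsLocalHom (Ideal.Quotient.mk I) :=
    IsLocalHom.of_surjective _ Ideal.Quotient.mk_surjective
  have h : (maximalIdeal (A ⧸ I)).comap (Ideal.Quotient.mk I) = maximalIdeal A :=
    IsLocalRing.maximalIdeal_comap _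
  rw [← h, Ideal.map_comap_of_surjective _ Ideal.Quotient.mk_surjective]

lemma dim_quot_ge [IsLocalRing A] [IsNoetherianRing A] {x : A} (hx : x ∈ maximalIdeal A) :
    ringKrullDim A ≤ ringKrullDim (A ⧸ Ideal.span {x}) + 1 := by
  have h := ringKrullDim_le_ringKrullDim_quotient_add_card (R := A) {x}
    (by rw [IsLocalRing.ringJacobson_eq_maximalIdeal]; simpa using hx)
  rw [Finset.coe_singleton] at h
  simpa using h

lemma reg_quot [IsRegularLocalRing A] {x : A} [hx : Fact (x ∈ maximalIdeal A)]
    (hx2 : x ∉ maximalIdeal A ^ 2) : IsRegularLocalRing (A ⧸ Ideal.span {x}) := by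
  classical
  obtain ⟨s, h1, h2⟩ := span_drop hx.out hx2
  refine reg_of_span (s.image (Ideal.Quotient.mk _)) ?_ ?_
  · rw [max_quot, ← h2, Ideal.map_span, Set.image_insert_eq]
    have : (Ideal.Quotient.mk (Ideal.span {x})) x = 0 := by simp
    simp [this, Ideal.span_insert]
  · have h3 := dim_quot_ge hx.out
    obtain ⟨n, hn⟩ := dim_ne_bot (A := A ⧸ Ideal.span {x})
    have h4 := IsRegularLocalRing.spanFinrank_maximalIdeal (R := A)
    rw [← h4, ← h1, hn] at h3
    rw [hn]
    have h5 : s.card + 1 ≤ n + 1 := by exact_mod_cast h3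
    have := Finset.card_image_le (s := s) (f := Ideal.Quotient.mk (Ideal.span {x}))
    exact_mod_cast (by omega)

lemma reg_of_quot [IsLocalRing A] [IsNoetherianRing A] {x : A} (hx : x ∈ maximalIdeal A)
    (hr : IsRegularLocalRing (A ⧸ Ideal.span {x}))
    (hd : ringKrullDim (A ⧸ Ideal.span {x}) + 1 ≤ ringKrullDim A) : IsRegularLocalRing A := by
  classical
  obtain ⟨s, h1, h2⟩ := reg_span (A := A ⧸ Ideal.span {x})
  choose g hg using Ideal.Quotient.mk_surjective (I := Ideal.span {x})
  refine reg_of_span (insert x (s.image g)) ?_ ?_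
  · apply le_antisymm
    · rw [Ideal.span_le]
      intro y hy
      simp only [Finset.coe_insert, Finset.coe_image, Set.mem_insert_iff, Set.mem_image] at hy
      rcases hy with rfl | ⟨z, hz, rfl⟩
      · exact hx
      · by_contra hcon
        have hu : IsUnit (g z) := by simpa using hcon
        have := hu.map (Ideal.Quotient.mk (Ideal.span {x}))
        rw [hg] at this
        have hz' : z ∈ maximalIdeal (A ⧸ Ideal.span {x}) := h1 ▸ Ideal.subset_span hz
        exact hz' this
    · intro y hy
      have hy' : Ideal.Quotient.mk (Ideal.span {x}) y ∈ Ideal.span (s : Set (A ⧸ Ideal.span {x})) := by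
        rw [h1, max_quot]; exact Ideal.mem_map_of_mem _ hy
      have h3 : (s : Set (A ⧸ Ideal.span {x})) = Ideal.Quotient.mk (Ideal.span {x}) '' (g '' s) := by
        rw [Set.image_image]; simp [hg]
      rw [h3, ← Ideal.map_span, ← Ideal.mem_comap, Ideal.comap_map_of_surjective _
        Ideal.Quotient.mk_surjective, ← RingHom.ker_eq_comap_bot, Ideal.mk_ker] at hy'
      simpa [Ideal.span_insert, sup_comm] using hy'
  · refine le_trans ?_ hd
    rw [← h2]
    have := Finset.card_insert_le x (s.image g)
    have h3 := Finset.card_image_le (s := s) (f := g)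
    exact_mod_cast (by omega)

end Basics


section Avoid
variable {A : Type u} [CommRing A] [IsLocalRing A] [IsNoetherianRing A]

lemma max_sq_ne (h : ¬ IsField A) : ¬ maximalIdeal A ≤ maximalIdeal A ^ 2 := by
  intro hle
  apply h
  rw [IsLocalRing.isField_iff_maximalIdeal_eq]
  refine Submodule.eq_bot_of_le_smul_of_le_jacobson_bot (maximalIdeal A) _
    (maximalIdeal A).fg_of_isNoetherianRing ?_ (IsLocalRing.maximalIdeal_le_jacobson _)
  rwa [smul_eq_mul, ← sq]

lemma avoid (S : Set (Ideal A)) (hS : S.Finite) (hp : ∀ p ∈ S, p.IsPrime)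
    (hm : ∀ p ∈ S, p ≠ maximalIdeal A) (h : ¬ IsField A) :
    ∃ x ∈ maximalIdeal A, x ∉ maximalIdeal A ^ 2 ∧ ∀ p ∈ S, x ∉ p := by
  classical
  by_contra! hcon
  have hsub : ((maximalIdeal A : Ideal A) : Set A) ⊆
      ⋃ i ∈ ((insert (maximalIdeal A ^ 2) hS.toFinset : Finset (Ideal A)) : Set (Ideal A)),
        ((id i : Ideal A) : Set A) := by
    intro x hx
    by_cases h2 : x ∈ maximalIdeal A ^ 2
    · exact Set.mem_biUnion (by simp) h2
    · obtain ⟨p, hpS, hxp⟩ := hcon x hx h2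
      exact Set.mem_biUnion (x := p) (by simp [hpS]) hxp
  rw [Ideal.subset_union_prime (maximalIdeal A ^ 2) (maximalIdeal A ^ 2)] at hsub
  · obtain ⟨i, hi, hle⟩ := hsub
    simp only [Finset.mem_insert, Set.Finite.mem_toFinset, id] at hi hle
    rcases hi with rfl | hi
    · exact max_sq_ne h hle
    · exact hm i hi ((maximalIdeal.isMaximal A).eq_of_le (hp i hi).ne_top hle).symm
  · intro i hi h1 _
    simp only [Finset.mem_insert, Set.Finite.mem_toFinset, h1, false_or] at hi
    exact hp i hi

end Avoid

lemma reg_quot_dim {A : Type u} [CommRing A] [IsRegularLocalRing A] {x : A} (hx : x ∈ maximalIdeal A)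
    (hx2 : x ∉ maximalIdeal A ^ 2) : ringKrullDim (A ⧸ Ideal.span {x}) + 1 = ringKrullDim A := by
  classical
  have : Fact (x ∈ maximalIdeal A) := ⟨hx⟩
  refine le_antisymm ?_ (dim_quot_ge hx)
  obtain ⟨s, h1, h2⟩ := span_drop hx hx2
  rw [← IsRegularLocalRing.spanFinrank_maximalIdeal (R := A), ← h1]
  have h3 := ringKrullDim_le_spanFinrank_maximalIdeal (A ⧸ Ideal.span {x})
  have h4 : maximalIdeal (A ⧸ Ideal.span {x}) = Ideal.span (s.image (Ideal.Quotient.mk (Ideal.span {x})) : Set _) := by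
    rw [max_quot, ← h2, Ideal.map_span, Set.image_insert_eq]
    have : (Ideal.Quotient.mk (Ideal.span {x})) x = 0 := by simp
    simp [this, Ideal.span_insert]
  have h5 := Submodule.spanFinrank_span_le_ncard_of_finite (R := A ⧸ Ideal.span {x})
    (s.image (Ideal.Quotient.mk (Ideal.span {x}))).finite_toSet
  rw [Set.ncard_coe_finset] at h5
  rw [h4] at h3
  have h6 := (h5.trans Finset.card_image_le)
  push_cast
  gcongr
  exact h3.trans (by exact_mod_cast h6)

lemma reg_domain_aux (n : ℕ) : ∀ (A : Type u) [CommRing A] [IsRegularLocalRing A],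
    ringKrullDim A = n → IsDomain A := by
  induction n with
  | zero =>
    intro A _ _ h
    have h4 := IsRegularLocalRing.spanFinrank_maximalIdeal (R := A)
    rw [h] at h4
    have h5 : (maximalIdeal A).spanFinrank = 0 := by exact_mod_cast h4
    have h6 : maximalIdeal A = ⊥ := (Submodule.spanFinrank_eq_zero_iff_eq_bot
      (maximalIdeal A).fg_of_isNoetherianRing).mp h5
    exact (IsLocalRing.isField_iff_maximalIdeal_eq.mpr h6).isDomain
  | succ n ih =>
    intro A _ _ h
    by_cases hf : IsField A
    · exact hf.isDomain
    have hmin : ∀ p ∈ minimalPrimes A, p ≠ maximalIdeal A := by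
      rintro p hp rfl
      have h1 := maximalIdeal_height_eq_ringKrullDim (R := A)
      rw [Ideal.height_eq_zero_iff.mpr hp, h] at h1
      have : (0 : ℕ) = n + 1 := by exact_mod_cast h1
      omega
    obtain ⟨x, hx, hx2, hxp⟩ := avoid (minimalPrimes A)
      (minimalPrimes.finite_of_isNoetherianRing A) (fun p hp => Ideal.IsMinimalPrime.isPrime hp) hmin hf
    have : Fact (x ∈ maximalIdeal A) := ⟨hx⟩
    have := reg_quot hx2
    have hd := reg_quot_dim hx hx2
    obtain ⟨k, hk⟩ := dim_ne_bot (A := A ⧸ Ideal.span {x})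
    rw [h, hk] at hd
    have hkn : k + 1 = n + 1 := by exact_mod_cast hd
    obtain rfl : k = n := by omega
    have := ih _ hk
    have hprime : (Ideal.span {x}).IsPrime := (Ideal.Quotient.isDomain_iff_prime _).mp inferInstance
    obtain ⟨p, hp, hpx⟩ := Ideal.exists_minimalPrimes_le (I := ⊥) (J := Ideal.span {x}) bot_le
    have hpp : p.IsPrime := Ideal.IsMinimalPrime.isPrime hp
    have hbot : p = ⊥ := by
      refine Submodule.eq_bot_of_le_smul_of_le_jacobson_bot (maximalIdeal A) _
        p.fg_of_isNoetherianRing ?_ (IsLocalRing.maximalIdeal_le_jacobson _)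
      intro y hy
      obtain ⟨a, rfl⟩ := Ideal.mem_span_singleton'.mp (hpx hy)
      have ha := (hpp.mem_or_mem hy).resolve_right (hxp p hp)
      rw [smul_eq_mul, mul_comm a x]
      exact Ideal.mul_mem_mul hx ha
    rw [hbot] at hpp
    exact (IsDomain.of_bot_isPrime A)

lemma reg_domain (A : Type u) [CommRing A] [IsRegularLocalRing A] : IsDomain A := by
  obtain ⟨n, hn⟩ := dim_ne_bot (A := A)
  exact reg_domain_aux n A hn


section PD
open CategoryTheory Pointwise

def PD (A : Type u) [CommRing A] (M : Type u) [AddCommGroup M] [Module A M] (n : ℕ) : Prop :=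
  HasProjectiveDimensionLT (ModuleCat.of A M) n

variable {A : Type u} [CommRing A]

lemma PD.equiv {M N : Type u} [AddCommGroup M] [Module A M] [AddCommGroup N] [Module A N] {n : ℕ}
    (h : PD A M n) (e : M ≃ₗ[A] N) : PD A N n := by
  have : HasProjectiveDimensionLT (ModuleCat.of A M) n := h
  exact hasProjectiveDimensionLT_of_iso e.toModuleIso n

lemma PD.retract {M N : Type u} [AddCommGroup M] [Module A M] [AddCommGroup N] [Module A N] {n : ℕ}
    (h : PD A M n) (i : N →ₗ[A] M) (r : M →ₗ[A] N) (hr : r ∘ₗ i = LinearMap.id) : PD A N n := by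
  have : HasProjectiveDimensionLT (ModuleCat.of A M) n := h
  refine (Retract.mk (ModuleCat.ofHom i) (ModuleCat.ofHom r) ?_).hasProjectiveDimensionLT n
  rw [← ModuleCat.ofHom_comp, hr]; rfl

lemma PD.mono {M : Type u} [AddCommGroup M] [Module A M] {n m : ℕ}
    (h : PD A M n) (hnm : n ≤ m) : PD A M m :=
  have : HasProjectiveDimensionLT (ModuleCat.of A M) n := h
  hasProjectiveDimensionLT_of_ge _ n m hnm

lemma PD_one {M : Type u} [AddCommGroup M] [Module A M] : PD A M 1 ↔ Module.Projective A M := by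
  rw [IsProjective.iff_projective, projective_iff_hasProjectiveDimensionLT_one]; rfl

lemma PD_shift {N P M : Type u} [AddCommGroup M] [Module A M] [AddCommGroup N] [Module A N]
    [AddCommGroup P] [Module A P] [Module.Projective A P] (f : N →ₗ[A] P) (g : P →ₗ[A] M)
    (hf : Function.Injective f) (hfg : Function.Exact f g) (hg : Function.Surjective g) (n : ℕ) :
    PD A M (n + 2) ↔ PD A N (n + 1) := by
  have h1 := (LinearMap.shortExact_shortComplexKer hg).hasProjectiveDimensionLT_X₃_iff n
    ((IsProjective.iff_projective P).mp inferInstance)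
  let e : N ≃ₗ[A] LinearMap.ker g := (LinearEquiv.ofInjective f hf).trans
    (LinearEquiv.ofEq _ _ hfg.linearMap_ker_eq.symm)
  exact h1.trans ⟨fun h => PD.equiv (M := LinearMap.ker g) h e.symm, fun h => PD.equiv h e⟩

lemma reg_free {x : A} (hxr : IsSMulRegular A x) {P : Type*} [AddCommGroup P] [Module A P]
    [Module.Free A P] : IsSMulRegular P x := by
  intro a b hab
  apply (Module.Free.chooseBasis A P).repr.injective
  ext i
  apply hxr
  have := congrArg (fun c => (Module.Free.chooseBasis A P).repr c i) hab
  simpa using this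

lemma PD_quot [IsLocalRing A] [IsNoetherianRing A] {x : A} (hx : x ∈ maximalIdeal A)
    (hxr : IsSMulRegular A x) [Fact (x ∈ maximalIdeal A)] (n : ℕ) : ∀ (M : Type u) [AddCommGroup M]
    [Module A M] [Module.Finite A M], IsSMulRegular M x →
    (PD A M (n + 1) ↔ PD (A ⧸ Ideal.span {x}) (QuotSMulTop x M) (n + 1)) := by
  induction n with
  | zero =>
    intro M _ _ _ hM
    have : Module.FinitePresentation A M := Module.finitePresentation_of_finite A M
    have : Module.Finite (A ⧸ Ideal.span {x}) (QuotSMulTop x M) :=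
      Module.Finite.of_restrictScalars_finite A _ _
    have key := Module.free_quotSMulTop_iff_free A M
      (IsLocalRing.maximalIdeal_le_jacobson _ hx) hM
    rw [zero_add, PD_one, PD_one]
    constructor
    · intro h
      have : Module.Free A M := Module.free_of_flat_of_isLocalRing
      have := key.mpr this
      infer_instance
    · intro h
      have : Module.Free (A ⧸ Ideal.span {x}) (QuotSMulTop x M) := Module.free_of_flat_of_isLocalRing
      have := key.mp this
      infer_instance
  | succ n ih =>
    intro M _ _ _ hM
    obtain ⟨P, _, _, hfree, hfin, f, hf⟩ := Module.exists_finite_presentation A M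
    let N := LinearMap.ker f
    have hPr : IsSMulRegular P x := reg_free hxr
    have hNr : IsSMulRegular N x := fun a b hab => Subtype.ext (hPr (congrArg Subtype.val hab))
    rw [show n + 1 + 1 = n + 2 from rfl, PD_shift N.subtype f N.injective_subtype
      (LinearMap.exact_subtype_ker_map f) hf n, ih N hNr]
    have hs : Function.Surjective (algebraMap A (A ⧸ Ideal.span {x})) :=
      Ideal.Quotient.mk_surjective
    have : Module.Projective (A ⧸ Ideal.span {x}) (QuotSMulTop x P) := by infer_instance
    refine (PD_shift ((QuotSMulTop.map x N.subtype).extendScalarsOfSurjective hs)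
      ((QuotSMulTop.map x f).extendScalarsOfSurjective hs) ?_ ?_ ?_ n).symm
    · change Function.Injective (QuotSMulTop.map x N.subtype)
      rw [injective_iff_map_eq_zero]
      intro a ha
      obtain ⟨a, rfl⟩ := Submodule.mkQ_surjective _ a
      rw [Submodule.mkQ_apply, QuotSMulTop.map_apply_mk, Submodule.Quotient.mk_eq_zero,
        Submodule.mem_smul_pointwise_iff_exists] at ha
      obtain ⟨b, -, hb⟩ := ha
      rw [Submodule.mkQ_apply, Submodule.Quotient.mk_eq_zero,
        Submodule.mem_smul_pointwise_iff_exists]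
      have hb2 : f b = 0 := by
        apply hM
        change x • f b = x • 0
        rw [← map_smul, hb, smul_zero]; exact a.2
      exact ⟨⟨b, hb2⟩, trivial, Subtype.ext hb⟩
    · exact QuotSMulTop.map_exact x (LinearMap.exact_subtype_ker_map f) hf
    · exact QuotSMulTop.map_surjective x hf

lemma PD_all (n : ℕ) : ∀ (A : Type u) [CommRing A] [IsRegularLocalRing A],
    ringKrullDim A = n → ∀ (M : Type u) [AddCommGroup M] [Module A M] [Module.Finite A M],
    ∃ k, PD A M k := by
  induction n with
  | zero =>
    intro A _ _ h M _ _ _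
    have h4 := IsRegularLocalRing.spanFinrank_maximalIdeal (R := A)
    rw [h] at h4
    have h5 : (maximalIdeal A).spanFinrank = 0 := by exact_mod_cast h4
    have h6 : maximalIdeal A = ⊥ := (Submodule.spanFinrank_eq_zero_iff_eq_bot
      (maximalIdeal A).fg_of_isNoetherianRing).mp h5
    letI := (IsLocalRing.isField_iff_maximalIdeal_eq.mpr h6).toField
    exact ⟨1, PD_one.mpr (Module.Projective.of_free)⟩
  | succ n ih =>
    intro A _ _ h M _ _ _
    have hdom := reg_domain A
    by_cases hf : IsField A
    · letI := hf.toField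
      exact ⟨1, PD_one.mpr (Module.Projective.of_free)⟩
    obtain ⟨x, hx, hx2, -⟩ := avoid (A := A) ∅ Set.finite_empty (by simp) (by simp) hf
    have : Fact (x ∈ maximalIdeal A) := ⟨hx⟩
    have := reg_quot hx2
    have hd := reg_quot_dim hx hx2
    obtain ⟨k, hk⟩ := dim_ne_bot (A := A ⧸ Ideal.span {x})
    rw [h, hk] at hd
    have hkn : k + 1 = n + 1 := by exact_mod_cast hd
    obtain rfl : k = n := by omega
    have hx0 : x ≠ 0 := by rintro rfl; simp at hx2
    have hxr : IsSMulRegular A x := (isRegular_of_ne_zero hx0).left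
    obtain ⟨P, _, _, hfree, hfin, f, hf⟩ := Module.exists_finite_presentation A M
    let N := LinearMap.ker f
    have hPr : IsSMulRegular P x := reg_free hxr
    have hNr : IsSMulRegular N x := fun a b hab => Subtype.ext (hPr (congrArg Subtype.val hab))
    have : Module.Finite (A ⧸ Ideal.span {x}) (QuotSMulTop x N) :=
      Module.Finite.of_restrictScalars_finite A _ _
    obtain ⟨m, hm⟩ := ih (A ⧸ Ideal.span {x}) hk (QuotSMulTop x N)
    have := (PD_quot hx hxr m N hNr).mpr (hm.mono (Nat.le_succ m))
    exact ⟨m + 2, (PD_shift N.subtype f N.injective_subtype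
      (LinearMap.exact_subtype_ker_map f) hf m).mpr this⟩

lemma free_of_socle [IsLocalRing A] [IsNoetherianRing A] {z : A} (hz : z ≠ 0)
    (hzm : ∀ a ∈ maximalIdeal A, z * a = 0) (n : ℕ) : ∀ (M : Type u) [AddCommGroup M]
    [Module A M] [Module.Finite A M], PD A M (n + 1) → Module.Free A M := by
  induction n with
  | zero =>
    intro M _ _ _ h
    rw [zero_add, PD_one] at h
    exact Module.free_of_flat_of_isLocalRing
  | succ n ih =>
    intro M _ _ _ h
    obtain ⟨s, hs1, hs2⟩ := Submodule.FG.exists_span_finset_card_eq_spanFinrank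
      (Module.Finite.fg_top (R := A) (M := M))
    let f : (ULift.{u} s → A) →ₗ[A] M := Fintype.linearCombination A (fun i => (i.down : M))
    have hf : Function.Surjective f := by
      rw [← LinearMap.range_eq_top, Fintype.range_linearCombination, ← hs2]
      congr 1
      ext y; simp
    have hker : ∀ v ∈ LinearMap.ker f, ∀ i, v i ∈ maximalIdeal A := by
      classical
      intro v hv i
      by_contra hcon
      have hu : IsUnit (v i) := by simpa using hcon
      obtain ⟨u, hu⟩ := hu
      have hsum : ∑ j, v j • (j.down : M) = 0 := hv
      rw [← Finset.add_sum_erase _ _ (Finset.mem_univ i)] at hsum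
      have hi : (i.down : M) ∈ Submodule.span A ((s.erase i.down : Finset M) : Set M) := by
        have : (i.down : M) = -((u⁻¹ : Aˣ) : A) • ∑ j ∈ Finset.univ.erase i, v j • (j.down : M) := by
          rw [← hu] at hsum
          rw [eq_neg_of_add_eq_zero_right hsum, smul_neg, neg_smul, neg_neg, smul_smul]
          simp
        have hmem : -((u⁻¹ : Aˣ) : A) • ∑ j ∈ Finset.univ.erase i, v j • (j.down : M) ∈
            Submodule.span A ((s.erase i.down : Finset M) : Set M) := ?_
        · exact this ▸ hmem
        refine Submodule.smul_mem _ _ (Submodule.sum_mem _ fun j hj => Submodule.smul_mem _ _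
          (Submodule.subset_span ?_))
        simp only [Finset.mem_erase, Finset.mem_univ, and_true] at hj
        simp only [Finset.coe_erase, Set.mem_diff, Finset.mem_coe, Finset.coe_mem, true_and,
          Set.mem_singleton_iff]
        intro h; exact hj (ULift.ext _ _ (Subtype.ext h))
      have htop : Submodule.span A ((s.erase i.down : Finset M) : Set M) = ⊤ := by
        rw [eq_top_iff, ← hs2, Submodule.span_le]
        intro y hy
        by_cases hyi : y = i.down
        · rw [hyi]; exact hi
        · exact Submodule.subset_span (by simp [hyi]; exact hy)
      have := Submodule.spanFinrank_span_le_ncard_of_finite (R := A)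
        (s.erase (i.down : M)).finite_toSet
      rw [htop, Set.ncard_coe_finset, Finset.card_erase_of_mem i.down.2, ← hs1] at this
      have := Finset.card_pos.mpr ⟨_, i.down.2⟩
      omega
    have hN := ih (LinearMap.ker f) ((PD_shift _ f (LinearMap.ker f).injective_subtype
      (LinearMap.exact_subtype_ker_map f) hf n).mp h)
    have hN0 : Subsingleton (LinearMap.ker f) := by
      by_contra hns
      rw [not_subsingleton_iff_nontrivial] at hns
      have hz0 : z ∈ Module.annihilator A (LinearMap.ker f) := by
        rw [Module.mem_annihilator]
        intro w
        ext i
        exact hzm _ (hker w w.2 i)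
      rw [Module.annihilator_eq_bot.mpr inferInstance] at hz0
      exact hz hz0
    have hinj : Function.Injective f := by
      rw [← LinearMap.ker_eq_bot]; exact (Submodule.subsingleton_iff_eq_bot).mp hN0
    exact Module.Free.of_equiv (LinearEquiv.ofBijective f ⟨hinj, hf⟩)

end PD


section Serre
open CategoryTheory Pointwise

lemma reg_of_field (A : Type u) [CommRing A] (h : IsField A) : IsRegularLocalRing A := by
  letI := h.toField
  infer_instance

lemma retract_gen {A : Type u} [CommRing A] [IsLocalRing A] [IsNoetherianRing A] {x : A}
    (hx : x ∈ maximalIdeal A) (hx2 : x ∉ maximalIdeal A ^ 2) (B : Type u) [CommRing B] [Algebra A B]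
    (J : Ideal B) (hs : Function.Surjective (algebraMap A B))
    (hJ : J = (maximalIdeal A).map (algebraMap A B))
    [Module B (QuotSMulTop x (maximalIdeal A))]
    [IsScalarTower A B (QuotSMulTop x (maximalIdeal A))] :
    ∃ (i : (B ⧸ J) →ₗ[B] QuotSMulTop x (maximalIdeal A))
      (r : QuotSMulTop x (maximalIdeal A) →ₗ[B] (B ⧸ J)), r ∘ₗ i = LinearMap.id := by
  let x' : QuotSMulTop x (maximalIdeal A) := Submodule.Quotient.mk ⟨x, hx⟩
  have hv0 : ((maximalIdeal A).toCotangent ⟨x, hx⟩ : CotangentSpace A) ≠ 0 := by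
    intro h
    rw [Ideal.toCotangent_eq_zero] at h
    exact hx2 h
  obtain ⟨φ, hφ⟩ := Module.Projective.exists_dual_ne_zero (ResidueField A) hv0
  obtain ⟨ψ, hψ⟩ : ∃ ψ : maximalIdeal A →ₗ[A] ResidueField A, ψ ⟨x, hx⟩ = 1 := by
    refine ⟨(((φ ((maximalIdeal A).toCotangent ⟨x, hx⟩))⁻¹ • φ).restrictScalars A) ∘ₗ
      (maximalIdeal A).toCotangent, ?_⟩
    change (φ ((maximalIdeal A).toCotangent ⟨x, hx⟩))⁻¹ •
      (φ ((maximalIdeal A).toCotangent ⟨x, hx⟩)) = 1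
    rw [smul_eq_mul, inv_mul_cancel₀ hφ]
  have hres : ∀ a ∈ maximalIdeal A, algebraMap A (B ⧸ J) a = 0 := by
    intro a ha
    rw [IsScalarTower.algebraMap_apply A B (B ⧸ J)]
    change Ideal.Quotient.mk J (algebraMap A B a) = 0
    rw [Ideal.Quotient.eq_zero_iff_mem, hJ]
    exact Ideal.mem_map_of_mem _ ha
  obtain ⟨q, hq⟩ : ∃ q : ResidueField A →ₗ[A] (B ⧸ J), q 1 = 1 :=
    ⟨(Ideal.Quotient.liftₐ (maximalIdeal A) (Algebra.ofId A (B ⧸ J)) hres).toLinearMap,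
      map_one (Ideal.Quotient.liftₐ (maximalIdeal A) (Algebra.ofId A (B ⧸ J)) hres)⟩
  obtain ⟨r, hr⟩ : ∃ r : QuotSMulTop x (maximalIdeal A) →ₗ[A] (B ⧸ J), r x' = 1 := by
    refine ⟨Submodule.liftQ _ (q ∘ₗ ψ) ?_, ?_⟩
    · intro y hy
      rw [Submodule.mem_smul_pointwise_iff_exists] at hy
      obtain ⟨z, -, rfl⟩ := hy
      rw [LinearMap.mem_ker, map_smul, Algebra.smul_def, hres x hx, zero_mul]
    · change q (ψ ⟨x, hx⟩) = 1
      rw [hψ, hq]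
  have hi : J ≤ LinearMap.ker (LinearMap.toSpanSingleton B _ x') := by
    rw [hJ, Ideal.map_le_iff_le_comap]
    intro a ha
    rw [Ideal.mem_comap, LinearMap.mem_ker, LinearMap.toSpanSingleton_apply, algebraMap_smul]
    change Submodule.Quotient.mk (a • (⟨x, hx⟩ : maximalIdeal A)) = _
    rw [Submodule.Quotient.mk_eq_zero, Submodule.mem_smul_pointwise_iff_exists]
    exact ⟨⟨a, ha⟩, trivial, Subtype.ext (mul_comm x a)⟩
  refine ⟨Submodule.liftQ J _ hi, r.extendScalarsOfSurjective hs, ?_⟩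
  apply Submodule.linearMap_qext
  ext
  change r ((1 : B) • x') = 1
  rw [one_smul, hr]

lemma retract_res {A : Type u} [CommRing A] [IsLocalRing A] [IsNoetherianRing A] {x : A}
    (hx : x ∈ maximalIdeal A) (hx2 : x ∉ maximalIdeal A ^ 2) [Fact (x ∈ maximalIdeal A)] :
    ∃ (i : ((A ⧸ Ideal.span {x}) ⧸ maximalIdeal (A ⧸ Ideal.span {x})) →ₗ[A ⧸ Ideal.span {x}]
        QuotSMulTop x (maximalIdeal A))
      (r : QuotSMulTop x (maximalIdeal A) →ₗ[A ⧸ Ideal.span {x}]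
        ((A ⧸ Ideal.span {x}) ⧸ maximalIdeal (A ⧸ Ideal.span {x}))), r ∘ₗ i = LinearMap.id :=
  retract_gen hx hx2 _ _ Ideal.Quotient.mk_surjective (max_quot _)

lemma reg_of_PD_aux (d : ℕ) : ∀ (A : Type u) [CommRing A] [IsLocalRing A] [IsNoetherianRing A],
    ringKrullDim A = d → ∀ n, PD A (A ⧸ maximalIdeal A) n → IsRegularLocalRing A := by
  induction d using Nat.strong_induction_on with
  | _ d ih =>
    intro A _ _ _ hd n hn
    by_cases hf : IsField A
    · exact reg_of_field A hf
    by_cases hass : maximalIdeal A ∈ associatedPrimes A A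
    · exfalso
      obtain ⟨hp, z, hz⟩ := Submodule.isAssociatedPrime_iff.mp hass
      have hzm : ∀ a ∈ maximalIdeal A, z * a = 0 := by
        intro a ha
        rw [hz, Submodule.mem_colon_singleton] at ha
        simpa [mul_comm] using ha
      have hz0 : z ≠ 0 := by
        rintro rfl
        apply hp.ne_top
        rw [hz, eq_top_iff]
        intro a _
        rw [Submodule.mem_colon_singleton]; simp
      have hfree := free_of_socle hz0 hzm n _ (hn.mono (Nat.le_succ n))
      apply hf
      rw [IsLocalRing.isField_iff_maximalIdeal_eq]
      have h1 : Module.annihilator A (A ⧸ maximalIdeal A) = ⊥ :=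
        Module.annihilator_eq_bot.mpr inferInstance
      rwa [Ideal.annihilator_quotient] at h1
    · obtain ⟨x, hx, hx2, hxp⟩ := avoid (associatedPrimes A A) (associatedPrimes.finite A A)
        (fun p hp => hp.1) (fun p hp h => hass (h ▸ hp)) hf
      have hxr : IsSMulRegular A x := by
        have h1 : x ∈ nonZeroDivisors A := by
          by_contra hcon
          have h2 : x ∈ ((nonZeroDivisors A : Set A))ᶜ := hcon
          rw [← biUnion_associatedPrimes_eq_compl_nonZeroDivisors] at h2
          obtain ⟨p, hp, hxp'⟩ := Set.mem_iUnion₂.mp h2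
          exact hxp p hp hxp'
        exact (isRegular_iff_mem_nonZeroDivisors.mpr h1).left
      have : Fact (x ∈ maximalIdeal A) := ⟨hx⟩
      have hmr : IsSMulRegular (maximalIdeal A) x :=
        fun a b hab => Subtype.ext (hxr (congrArg Subtype.val hab))
      have h1 : PD A (maximalIdeal A) (n + 1) :=
        (PD_shift (maximalIdeal A).subtype (maximalIdeal A).mkQ (Submodule.injective_subtype _)
          (LinearMap.exact_subtype_mkQ _) (Submodule.mkQ_surjective _) n).mp
          (hn.mono (by omega))
      rw [PD_quot hx hxr n _ hmr] at h1
      obtain ⟨i, r, hir⟩ := retract_res hx hx2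
      have h2 := h1.retract i r hir
      have hdim := ringKrullDim_quotient_span_singleton_succ_eq_ringKrullDim hxr hx
      obtain ⟨k, hk⟩ := dim_ne_bot (A := A ⧸ Ideal.span {x})
      have hkd : k < d := by
        rw [hk, hd] at hdim
        have : k + 1 = d := by exact_mod_cast hdim
        omega
      exact reg_of_quot hx (ih k hkd _ hk _ h2) hdim.le

lemma reg_of_PD (A : Type u) [CommRing A] [IsLocalRing A] [IsNoetherianRing A] (n : ℕ)
    (h : PD A (A ⧸ maximalIdeal A) n) : IsRegularLocalRing A := by
  obtain ⟨d, hd⟩ := dim_ne_bot (A := A)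
  exact reg_of_PD_aux d A hd n h


lemma PD_shift_bc {A : Type u} [CommRing A] {B : Type u} [CommRing B] [Algebra A B]
    [Module.Flat A B] {N P M : Type u} [AddCommGroup M] [Module A M] [AddCommGroup N] [Module A N]
    [AddCommGroup P] [Module A P] [Module.Projective A P] (f : N →ₗ[A] P) (g : P →ₗ[A] M)
    (hf : Function.Injective f) (hfg : Function.Exact f g) (hg : Function.Surjective g) (n : ℕ) :
    PD B (B ⊗[A] M) (n + 2) ↔ PD B (B ⊗[A] N) (n + 1) := by
  have h1 : Function.Exact (f.baseChange B) (g.baseChange B) := by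
    have := lTensor_exact B hfg hg
    exact this
  exact PD_shift (f.baseChange B) (g.baseChange B)
    (Module.Flat.lTensor_preserves_injective_linearMap _ hf) h1 (LinearMap.lTensor_surjective B hg) n

lemma PD_bc {A : Type u} [CommRing A] {B : Type u} [CommRing B] [Algebra A B] [Module.Flat A B]
    (n : ℕ) : ∀ (M : Type u) [AddCommGroup M] [Module A M], PD A M (n + 1) →
    PD B (B ⊗[A] M) (n + 1) := by
  induction n with
  | zero =>
    intro M _ _ h
    rw [PD_one] at h ⊢
    infer_instance
  | succ n ih =>
    intro M _ _ h
    let g : (M →₀ A) →ₗ[A] M := Finsupp.linearCombination A id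
    have hg : Function.Surjective g := Finsupp.linearCombination_id_surjective A M
    have h1 := ih _ ((PD_shift (N := LinearMap.ker g) (LinearMap.ker g).subtype g
      (Submodule.injective_subtype _) (LinearMap.exact_subtype_ker_map g) hg n).mp h)
    exact (PD_shift_bc (N := LinearMap.ker g) (LinearMap.ker g).subtype g (Submodule.injective_subtype _)
      (LinearMap.exact_subtype_ker_map g) hg n).mpr h1

lemma PD_desc {A : Type u} [CommRing A] [IsNoetherianRing A] {B : Type u} [CommRing B] [Algebra A B]
    [Module.FaithfullyFlat A B]
    (n : ℕ) : ∀ (M : Type u) [AddCommGroup M] [Module A M] [Module.Finite A M],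
    PD B (B ⊗[A] M) (n + 1) → PD A M (n + 1) := by
  induction n with
  | zero =>
    intro M _ _ _ h
    rw [PD_one] at h ⊢
    have : Module.Flat A M := by
      have : Module.Flat B (B ⊗[A] M) := inferInstance
      exact Module.Flat.of_flat_tensorProduct A M B
    have : Module.FinitePresentation A M := Module.finitePresentation_of_finite A M
    exact Module.Flat.projective_of_finitePresentation
  | succ n ih =>
    intro M _ _ _ h
    obtain ⟨k, g, hg⟩ := Module.Finite.exists_fin' A M
    let g' : (ULift.{u} (Fin k) →₀ A) →ₗ[A] M := g ∘ₗ
      (Finsupp.linearEquivFunOnFinite A A (Fin k)).toLinearMap ∘ₗ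
      (Finsupp.domLCongr (R := A) (M := A) Equiv.ulift).toLinearMap
    have hg' : Function.Surjective g' := by
      apply hg.comp
      exact ((Finsupp.linearEquivFunOnFinite A A (Fin k)).surjective.comp
        (Finsupp.domLCongr (R := A) (M := A) Equiv.ulift).surjective)
    have h1 := (PD_shift_bc (B := B) (N := LinearMap.ker g') (LinearMap.ker g').subtype g'
      (Submodule.injective_subtype _) (LinearMap.exact_subtype_ker_map g') hg' n).mp h
    exact (PD_shift (N := LinearMap.ker g') (LinearMap.ker g').subtype g'
      (Submodule.injective_subtype _) (LinearMap.exact_subtype_ker_map g') hg' n).mpr (ih _ h1)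

theorem reg_desc {A B : Type u} [CommRing A] [IsLocalRing A] [IsNoetherianRing A] [CommRing B]
    [IsRegularLocalRing B] [Algebra A B] [Module.FaithfullyFlat A B] : IsRegularLocalRing A := by
  obtain ⟨d, hd⟩ := dim_ne_bot (A := B)
  obtain ⟨k, hk⟩ := PD_all d B hd (B ⊗[A] (A ⧸ maximalIdeal A))
  exact reg_of_PD A (k + 1) (PD_desc k _ (hk.mono (Nat.le_succ k)))

theorem serre (A : Type u) [CommRing A] [IsRegularLocalRing A] : IsRegularRing A := by
  rw [isRegularRing_iff]
  intro p hp
  obtain ⟨d, hd⟩ := dim_ne_bot (A := A)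
  obtain ⟨k, hk⟩ := PD_all d A hd (A ⧸ p)
  let B := Localization.AtPrime p
  have : Module.Flat A B := inferInstance
  have h3 : PD B (B ⊗[A] (A ⧸ p)) (k + 1) := PD_bc k _ (hk.mono (Nat.le_succ k))
  let e := (Algebra.TensorProduct.quotIdealMapEquivTensorQuot B p).symm.toLinearEquiv
  have h4 := h3.equiv e
  have h5 : p.map (algebraMap A B) = maximalIdeal B := Localization.AtPrime.map_eq_maximalIdeal
  rw [h5] at h4
  exact reg_of_PD B (k + 1) h4

end Serre


structure IsLoc {X Y : Type*} [CommRing X] [CommRing Y] (f : X →+* Y) : Prop where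
  surj : ∀ y, ∃ x s, IsUnit (f s) ∧ y * f s = f x
  inj : ∀ x, f x = 0 → ∃ s, IsUnit (f s) ∧ s * x = 0

lemma IsLoc.isLocalization {X Y : Type*} [CommRing X] [CommRing Y] {f : X →+* Y} (h : IsLoc f) :
    letI := f.toAlgebra
    IsLocalization ((IsUnit.submonoid Y).comap f) Y := by
  letI := f.toAlgebra
  refine ⟨fun y => y.2, fun y => ?_, fun {x y} hxy => ?_⟩
  · obtain ⟨x, s, hs, e⟩ := h.surj y
    exact ⟨(x, ⟨s, hs⟩), e⟩
  · obtain ⟨s, hs, e⟩ := h.inj (x - y) (by rw [map_sub, sub_eq_zero]; exact hxy)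
    exact ⟨⟨s, hs⟩, by simpa [mul_sub, sub_eq_zero] using e⟩

lemma IsLoc.of_isLocalization {X Y : Type*} [CommRing X] [CommRing Y] [Algebra X Y]
    (M : Submonoid X) [IsLocalization M Y] : IsLoc (algebraMap X Y) := by
  refine ⟨fun y => ?_, fun x hx => ?_⟩
  · obtain ⟨⟨x, s⟩, e⟩ := IsLocalization.surj M y
    exact ⟨x, s, IsLocalization.map_units Y s, e⟩
  · obtain ⟨s, hs⟩ := (IsLocalization.map_eq_zero_iff M Y x).mp hx
    exact ⟨s, IsLocalization.map_units Y s, hs⟩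

lemma IsLoc.comp {X Y Z : Type*} [CommRing X] [CommRing Y] [CommRing Z] {f : X →+* Y}
    {g : Y →+* Z} (hg : IsLoc g) (hf : IsLoc f) : IsLoc (g.comp f) := by
  refine ⟨fun z => ?_, fun x hx => ?_⟩
  · obtain ⟨y, t, ht, e⟩ := hg.surj z
    obtain ⟨x, s, hs, e1⟩ := hf.surj y
    obtain ⟨w, r, hr, e2⟩ := hf.surj t
    refine ⟨x * r, w * s, ?_, ?_⟩
    · rw [RingHom.comp_apply, map_mul, map_mul, ← e2, map_mul]
      exact (ht.mul (hr.map g)).mul (hs.map g)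
    · simp only [RingHom.comp_apply, map_mul, ← e2, ← e1]
      linear_combination (g (f r) * g (f s)) * e
  · obtain ⟨t, ht, e⟩ := hg.inj (f x) hx
    obtain ⟨w, r, hr, e2⟩ := hf.surj t
    obtain ⟨s, hs, e3⟩ := hf.inj (w * x) (by
      rw [map_mul, ← e2]; linear_combination f r * e)
    refine ⟨s * w, ?_, by rw [mul_assoc, e3]⟩
    rw [RingHom.comp_apply, map_mul, ← e2, map_mul, map_mul]
    exact (hs.map g).mul (ht.mul (hr.map g))

lemma IsLoc.atPrime {X Y : Type*} [CommRing X] [CommRing Y] [IsLocalRing Y] {f : X →+* Y}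
    (h : IsLoc f) (q : Ideal X) [q.IsPrime] (hq : (maximalIdeal Y).comap f = q) :
    Nonempty (Localization.AtPrime q ≃+* Y) := by
  letI := f.toAlgebra
  have h1 := h.isLocalization
  have h2 : (IsUnit.submonoid Y).comap f = q.primeCompl := by
    ext x
    rw [Ideal.mem_primeCompl_iff, ← hq, Ideal.mem_comap, mem_maximalIdeal, mem_nonunits_iff, not_not]
    rfl
  rw [h2] at h1
  exact ⟨(IsLocalization.algEquiv q.primeCompl (Localization.AtPrime q) Y).toRingEquiv⟩

lemma IsLoc.reg_at {X Y : Type*} [CommRing X] [CommRing Y] [IsRegularLocalRing Y] {f : X →+* Y}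
    (h : IsLoc f) (q : Ideal X) [q.IsPrime] (hq : (maximalIdeal Y).comap f = q) :
    IsRegularLocalRing (Localization.AtPrime q) := by
  obtain ⟨e⟩ := h.atPrime q hq
  exact IsRegularLocalRing.of_ringEquiv e.symm

lemma IsLoc.regLocal {X Y : Type*} [CommRing X] [CommRing Y] [IsRegularRing X] [IsLocalRing Y]
    {f : X →+* Y} (h : IsLoc f) : IsRegularLocalRing Y := by
  obtain ⟨e⟩ := h.atPrime ((maximalIdeal Y).comap f) rfl
  exact IsRegularLocalRing.of_ringEquiv e

lemma IsLoc.noeth {X Y : Type*} [CommRing X] [CommRing Y] [IsNoetherianRing X]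
    {f : X →+* Y} (h : IsLoc f) : IsNoetherianRing Y := by
  letI := f.toAlgebra
  have := h.isLocalization
  exact IsLocalization.isNoetherianRing ((IsUnit.submonoid Y).comap f) Y inferInstance

lemma IsLoc.regular {X Y : Type*} [CommRing X] [CommRing Y] [IsRegularRing X]
    {f : X →+* Y} (h : IsLoc f) : IsRegularRing Y := by
  have := h.noeth
  rw [isRegularRing_iff]
  intro p _
  exact (IsLoc.comp (IsLoc.of_isLocalization p.primeCompl) h).regLocal

lemma IsLoc.of_equiv {X Y : Type*} [CommRing X] [CommRing Y] (e : X ≃+* Y) :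
    IsLoc (e : X →+* Y) :=
  ⟨fun y => ⟨e.symm y, 1, by simp, by simp⟩, fun x hx => ⟨1, by simp, by simpa using hx⟩⟩

theorem regular_hyp {X : Type u} [CommRing X] [IsRegularRing X] (f : X)
    (hD : ∀ q : Ideal X, q.IsPrime → f ∈ q → ∃ D : Derivation ℤ X X, D f ∉ q) :
    IsRegularRing (X ⧸ Ideal.span {f}) := by
  rw [isRegularRing_iff]
  intro p hp
  let q : Ideal X := p.comap (Ideal.Quotient.mk (Ideal.span {f}))
  have hqp : q.IsPrime := Ideal.comap_isPrime _ _
  have hfq : f ∈ q := by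
    have : (Ideal.Quotient.mk (Ideal.span {f})) f = 0 :=
      Ideal.Quotient.eq_zero_iff_mem.mpr (Ideal.mem_span_singleton_self f)
    rw [Ideal.mem_comap, this]; exact zero_mem _
  obtain ⟨D, hDf⟩ := hD q hqp hfq
  let B := Localization.AtPrime q
  let x : B := algebraMap X B f
  have hx : x ∈ maximalIdeal B := by
    rw [← Localization.AtPrime.map_eq_maximalIdeal]; exact Ideal.mem_map_of_mem _ hfq
  have hx2 : x ∉ maximalIdeal B ^ 2 := by
    rw [← Localization.AtPrime.map_eq_maximalIdeal, ← Ideal.map_pow,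
      IsLocalization.algebraMap_mem_map_algebraMap_iff q.primeCompl]
    rintro ⟨s, hs, h⟩
    have key : ∀ y ∈ q ^ 2, D y ∈ q := by
      intro y hy
      rw [pow_two] at hy
      induction hy using Submodule.mul_induction_on' with
      | mem_mul_mem a ha b hb =>
        rw [D.leibniz, smul_eq_mul, smul_eq_mul]
        exact add_mem (Ideal.mul_mem_right _ _ ha) (Ideal.mul_mem_right _ _ hb)
      | add a _ b _ ha hb => rw [map_add]; exact add_mem ha hb
    have h1 := key _ h
    rw [D.leibniz, smul_eq_mul, smul_eq_mul] at h1
    have h2 : s * D f ∈ q := (Ideal.add_mem_iff_left q (Ideal.mul_mem_right _ _ hfq)).mp h1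
    rcases hqp.mem_or_mem h2 with h3 | h3
    · exact hs h3
    · exact hDf h3
  have : Fact (x ∈ maximalIdeal B) := ⟨hx⟩
  have hreg : IsRegularLocalRing (B ⧸ Ideal.span {x}) := reg_quot hx2
  let g : (X ⧸ Ideal.span {f}) →+* (B ⧸ Ideal.span {x}) :=
    Ideal.quotientMap (Ideal.span {x}) (algebraMap X B) (by
      rw [Ideal.span_singleton_le_iff_mem, Ideal.mem_comap]
      exact Ideal.mem_span_singleton_self x)
  have hgm : ∀ y, g (Ideal.Quotient.mk _ y) = Ideal.Quotient.mk _ (algebraMap X B y) :=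
    fun y => Ideal.quotientMap_mk
  have hu : ∀ s ∉ q, IsUnit (g (Ideal.Quotient.mk _ s)) := by
    intro s hs
    rw [hgm]
    exact (IsLocalization.map_units B (⟨s, hs⟩ : q.primeCompl)).map _
  refine IsLoc.reg_at (f := g) ⟨?_, ?_⟩ p ?_
  · intro y
    obtain ⟨y, rfl⟩ := Ideal.Quotient.mk_surjective y
    obtain ⟨⟨a, s⟩, e⟩ := IsLocalization.surj q.primeCompl y
    refine ⟨Ideal.Quotient.mk _ a, Ideal.Quotient.mk _ s, hu s s.2, ?_⟩
    rw [hgm, hgm, ← map_mul, e]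
  · intro y hy
    obtain ⟨y, rfl⟩ := Ideal.Quotient.mk_surjective y
    rw [hgm, Ideal.Quotient.eq_zero_iff_mem] at hy
    have h1 : algebraMap X B y ∈ (Ideal.span {f}).map (algebraMap X B) := by
      rw [Ideal.map_span, Set.image_singleton]; exact hy
    rw [IsLocalization.algebraMap_mem_map_algebraMap_iff q.primeCompl] at h1
    obtain ⟨s, hs, h⟩ := h1
    refine ⟨Ideal.Quotient.mk _ s, hu s hs, ?_⟩
    rw [← map_mul, Ideal.Quotient.eq_zero_iff_mem]; exact h
  · ext y
    obtain ⟨y, rfl⟩ := Ideal.Quotient.mk_surjective y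
    have : (Ideal.Quotient.mk (Ideal.span {f}) y) ∈ p ↔ y ∈ q := Iff.rfl
    rw [this, Ideal.mem_comap, hgm, max_quot, ← Ideal.mem_comap,
      Ideal.comap_map_of_surjective' _ Ideal.Quotient.mk_surjective, Ideal.mk_ker,
      sup_eq_left.mpr ((Ideal.span_singleton_le_iff_mem _).mpr hx)]
    exact IsLocalization.AtPrime.to_map_mem_maximal_iff B q y

theorem reg_asc {A B : Type u} [CommRing A] [IsRegularLocalRing A] [CommRing B] [IsLocalRing B]
    [IsNoetherianRing B] [Algebra A B] [IsLocalHom (algebraMap A B)] [Module.Flat A B]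
    (hF : IsRegularLocalRing (B ⧸ (maximalIdeal A).map (algebraMap A B))) :
    IsRegularLocalRing B := by
  classical
  let I := (maximalIdeal A).map (algebraMap A B)
  obtain ⟨s, hs1, hs2⟩ := reg_span (A := A)
  obtain ⟨t, ht1, ht2⟩ := reg_span (A := B ⧸ I)
  choose g hg using Ideal.Quotient.mk_surjective (I := I)
  refine reg_of_span (s.image (algebraMap A B) ∪ t.image g) ?_ ?_
  · rw [Finset.coe_union, Finset.coe_image, Finset.coe_image, Ideal.span_union, ← Ideal.map_span,
      hs1]
    have h1 : Ideal.map (Ideal.Quotient.mk I) (Ideal.span (g '' (t : Set _))) =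
        maximalIdeal (B ⧸ I) := by
      rw [Ideal.map_span, Set.image_image, ← ht1]
      simp [hg]
    rw [max_quot] at h1
    have hI : I ≤ maximalIdeal B := by
      rw [Ideal.map_le_iff_le_comap, IsLocalRing.maximalIdeal_comap]
    have h2 := congrArg (Ideal.comap (Ideal.Quotient.mk I)) h1
    rw [Ideal.comap_map_of_surjective' _ Ideal.Quotient.mk_surjective,
      Ideal.comap_map_of_surjective' _ Ideal.Quotient.mk_surjective, Ideal.mk_ker,
      sup_eq_left.mpr hI, sup_comm] at h2
    exact h2
  · have hlo : (maximalIdeal B).LiesOver (maximalIdeal A) :=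
      ⟨(IsLocalRing.maximalIdeal_comap (algebraMap A B)).symm⟩
    have h := Ideal.height_eq_height_add_of_liesOver_of_hasGoingDown (maximalIdeal A)
      (maximalIdeal B)
    rw [← max_quot] at h
    have h' := congrArg (fun x : ℕ∞ => (x : WithBot ℕ∞)) h
    simp only [WithBot.coe_add, IsLocalRing.maximalIdeal_height_eq_ringKrullDim] at h'
    rw [h', ← hs2, ← ht2]
    norm_cast
    exact (Finset.card_union_le _ _).trans (add_le_add Finset.card_image_le Finset.card_image_le)


theorem reg_fib {A B : Type u} [CommRing A] [IsRegularRing A] [CommRing B] [IsNoetherianRing B]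
    [Algebra A B] [Module.Flat A B]
    (hF : ∀ (p : Ideal A) [p.IsPrime], IsRegularRing (p.ResidueField ⊗[A] B)) :
    IsRegularRing B := by
  rw [isRegularRing_iff]
  intro q hq
  let p := q.under A
  let Ap := Localization.AtPrime p
  let Bq := Localization.AtPrime q
  letI : Algebra Ap Bq := Localization.AtPrime.algebraOfLiesOver p q
  have : IsScalarTower A Ap Bq := inferInstance
  have : IsLocalHom (algebraMap Ap Bq) := inferInstance
  have : Module.Flat Ap Bq := inferInstance
  let I := (maximalIdeal Ap).map (algebraMap Ap Bq)
  have hI : I = p.map (algebraMap A Bq) := by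
    change Ideal.map _ _ = _
    rw [← Localization.AtPrime.map_eq_maximalIdeal, Ideal.map_map,
      ← IsScalarTower.algebraMap_eq A Ap Bq]
  have hIm : I ≤ maximalIdeal Bq := by
    rw [Ideal.map_le_iff_le_comap, IsLocalRing.maximalIdeal_comap]
  let Y := Bq ⧸ I
  have hpu : ∀ a ∉ p, IsUnit (algebraMap A Y a) := by
    intro a ha
    rw [IsScalarTower.algebraMap_apply A B Y, IsScalarTower.algebraMap_apply B Bq Y]
    exact (IsLocalization.map_units Bq (⟨algebraMap A B a, ha⟩ : q.primeCompl)).map _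
  let f1 : p.ResidueField →ₐ[A] Y := Ideal.ResidueField.liftₐ p (Algebra.ofId A Y) (by
      intro a ha
      change algebraMap A Y a = 0
      rw [IsScalarTower.algebraMap_apply A Bq Y]
      change Ideal.Quotient.mk I _ = 0
      rw [Ideal.Quotient.eq_zero_iff_mem, hI]
      exact Ideal.mem_map_of_mem _ ha) hpu
  let f2 : B →ₐ[A] Y := IsScalarTower.toAlgHom A B Y
  let f : (p.ResidueField ⊗[A] B) →ₐ[A] Y := Algebra.TensorProduct.productMap f1 f2
  have hft : ∀ b, f (1 ⊗ₜ b) = algebraMap B Y b := by intro b; simp [f, f2]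
  have hsu : ∀ b ∉ q, IsUnit (f (1 ⊗ₜ b)) := by
    intro b hb
    rw [hft, IsScalarTower.algebraMap_apply B Bq Y]
    exact (IsLocalization.map_units Bq (⟨b, hb⟩ : q.primeCompl)).map _
  have hloc : IsLoc (f : (p.ResidueField ⊗[A] B) →+* Y) := by
    refine ⟨fun y => ?_, fun x hx => ?_⟩
    · obtain ⟨y, rfl⟩ := Ideal.Quotient.mk_surjective y
      obtain ⟨⟨b, s⟩, e⟩ := IsLocalization.surj q.primeCompl y
      refine ⟨1 ⊗ₜ b, 1 ⊗ₜ s, hsu s s.2, ?_⟩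
      rw [RingHom.coe_coe, hft, hft, IsScalarTower.algebraMap_apply B Bq Y,
        IsScalarTower.algebraMap_apply B Bq Y]
      change _ * Ideal.Quotient.mk I _ = Ideal.Quotient.mk I _
      rw [← map_mul, e]
    · obtain ⟨r, hr, b, e⟩ := Ideal.Fiber.exists_smul_eq_one_tmul p x
      have h1 : f (1 ⊗ₜ b) = 0 := by
        rw [← e, map_smul]
        rw [RingHom.coe_coe] at hx
        rw [hx, smul_zero]
      rw [hft, IsScalarTower.algebraMap_apply B Bq Y] at h1
      change Ideal.Quotient.mk I _ = 0 at h1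
      rw [Ideal.Quotient.eq_zero_iff_mem, hI, IsScalarTower.algebraMap_eq A B Bq,
        ← Ideal.map_map, IsLocalization.algebraMap_mem_map_algebraMap_iff q.primeCompl] at h1
      obtain ⟨s, hs, h⟩ := h1
      have h2 : (1 : p.ResidueField) ⊗ₜ[A] (s * b) = 0 := by
        have h3 : ∀ y ∈ p.map (algebraMap A B), (1 : p.ResidueField) ⊗ₜ[A] y = 0 := by
          intro y hy
          have : p.map (algebraMap A B) ≤ RingHom.ker
              (Algebra.TensorProduct.includeRight : B →ₐ[A] p.ResidueField ⊗[A] B) := by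
            rw [Ideal.map_le_iff_le_comap]
            intro a ha
            rw [Ideal.mem_comap, RingHom.mem_ker, AlgHom.commutes,
              IsScalarTower.algebraMap_apply A p.ResidueField,
              Ideal.algebraMap_residueField_eq_zero.mpr ha, map_zero]
          exact this hy
        exact h3 _ h
      refine ⟨algebraMap A _ r * (1 ⊗ₜ s), ?_, ?_⟩
      · rw [map_mul]
        refine IsUnit.mul ?_ (hsu s hs)
        rw [RingHom.coe_coe, AlgHom.commutes]
        exact hpu r hr
      · rw [mul_right_comm, ← Algebra.smul_def, e, Algebra.TensorProduct.tmul_mul_tmul, one_mul,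
          mul_comm b s, h2]
  have : Nontrivial Y := Ideal.Quotient.nontrivial_iff.mpr (fun h => by
    rw [h, top_le_iff] at hIm
    exact (maximalIdeal.isMaximal Bq).ne_top hIm)
  have : IsLocalRing Y := IsLocalRing.of_surjective' (Ideal.Quotient.mk I) Ideal.Quotient.mk_surjective
  have := hF p
  exact reg_asc (A := Ap) hloc.regLocal

theorem reg_ffdesc {A B : Type u} [CommRing A] [IsNoetherianRing A] [CommRing B] [IsRegularRing B]
    [Algebra A B] [Module.FaithfullyFlat A B] : IsRegularRing A := by
  rw [isRegularRing_iff]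
  intro p hp
  obtain ⟨⟨q, hq⟩, h⟩ := PrimeSpectrum.comap_surjective_of_faithfullyFlat (A := A) (B := B) ⟨p, hp⟩
  have hlo : q.LiesOver p := ⟨(congrArg PrimeSpectrum.asIdeal h).symm⟩
  let Ap := Localization.AtPrime p
  let Bq := Localization.AtPrime q
  letI : Algebra Ap Bq := Localization.AtPrime.algebraOfLiesOver p q
  have : Module.Flat Ap Bq := inferInstance
  have : Module.FaithfullyFlat Ap Bq := Module.FaithfullyFlat.of_flat_of_isLocalHom
  exact reg_desc (B := Bq)


structure IsDense {P : Type*} {W : Type*} [CommRing P] [CommRing W] (φ : P →+* W) (I : Ideal P) : Prop where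
  surj : ∀ n w, ∃ a, w - φ a ∈ (I.map φ)^n
  inj : ∀ n a, φ a ∈ (I.map φ)^n → a ∈ I^n

structure IsComp {P : Type*} {W : Type*} [CommRing P] [CommRing W] (φ : P →+* W) (I : Ideal P) : Prop
    extends IsDense φ I where
  complete : IsAdicComplete (I.map φ) W

theorem IsDense.comp {A B C : Type*} [CommRing A] [CommRing B] [CommRing C] {f : A →+* B}
    {g : B →+* C} {I : Ideal A} (hf : IsDense f I) (hg : IsDense g (I.map f)) :
    IsDense (g.comp f) I := by
  constructor
  · intro n c
    obtain ⟨b, hb⟩ := hg.surj n c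
    obtain ⟨a, ha⟩ := hf.surj n b
    refine ⟨a, ?_⟩
    have : g (b - f a) ∈ (I.map (g.comp f))^n := by
      rw [← Ideal.map_map, ← Ideal.map_pow]
      exact Ideal.mem_map_of_mem g ha
    rw [← Ideal.map_map] at this ⊢
    have h2 := add_mem hb this
    simpa using h2
  · intro n a ha
    rw [← Ideal.map_map] at ha
    exact hf.inj n a (hg.inj n _ ha)

theorem IsComp.comp {A B C : Type*} [CommRing A] [CommRing B] [CommRing C] {f : A →+* B}
    {g : B →+* C} {I : Ideal A} (hf : IsDense f I) (hg : IsComp g (I.map f)) :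
    IsComp (g.comp f) I :=
  { hf.comp hg.toIsDense with complete := by rw [← Ideal.map_map]; exact hg.complete }

theorem IsDense.of_equiv {A B : Type*} [CommRing A] [CommRing B] (e : A ≃+* B) (I : Ideal A) :
    IsDense (e : A →+* B) I := by
  constructor
  · intro n w; exact ⟨e.symm w, by simp⟩
  · intro n a ha
    rw [← Ideal.map_pow] at ha
    have := Ideal.mem_map_of_equiv (I := I^n) e (e a)
    obtain ⟨x, hx, hxe⟩ := this.1 ha
    rwa [← e.injective hxe]

theorem IsComp.adic {P : Type*} [CommRing P] (I : Ideal P) (hI : I.FG) :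
    IsComp (algebraMap P (AdicCompletion I P)) I := by
  have key : ∀ n, (I.map (algebraMap P (AdicCompletion I P)))^n =
      RingHom.ker (AdicCompletion.evalₐ I n) := by
    intro n
    have h := AdicCompletion.pow_smul_top_eq_ker_eval (I := I) (M := P) (n := n) hI
    ext x
    rw [← Ideal.map_pow]
    have h2 : x ∈ (I^n • ⊤ : Submodule P (AdicCompletion I P)) ↔ x ∈ (I ^ n).map (algebraMap P (AdicCompletion I P)) := by
      rw [Ideal.smul_top_eq_map]; rfl
    rw [← h2, h, RingHom.mem_ker, LinearMap.mem_ker]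
    constructor
    · intro hx
      rw [← AdicCompletion.factor_eval_eq_evalₐ I x (n := n) (by simp), hx, map_zero]
    · intro hx
      rw [← AdicCompletion.factor_evalₐ_eq_eval I x (n := n) (by simp)]
      have hx' : AdicCompletion.evalₐ I n x = 0 := hx
      rw [hx', map_zero]
  refine ⟨⟨?_, ?_⟩, AdicCompletion.isAdicComplete_self I hI⟩
  · intro n w
    obtain ⟨a, ha⟩ := Ideal.Quotient.mk_surjective (AdicCompletion.evalₐ I n w)
    refine ⟨a, ?_⟩
    rw [key, RingHom.mem_ker, map_sub, ← ha, sub_eq_zero]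
    simp
  · intro n a ha
    rw [key, RingHom.mem_ker] at ha
    rw [← Ideal.Quotient.eq_zero_iff_mem]
    simpa using ha

theorem IsDense.proj {P W : Type*} [CommRing P] [CommRing W] {φ : P →+* W} {I : Ideal P}
    (h : IsDense φ I) (n : ℕ) : ∃ π : W →+* P ⧸ I^n, (∀ w a, π w = Ideal.Quotient.mk _ a ↔ w - φ a ∈ (I.map φ)^n) ∧
      (∀ a, π (φ a) = Ideal.Quotient.mk _ a) ∧ RingHom.ker π = (I.map φ)^n := by
  have hle : I^n ≤ ((I.map φ)^n).comap φ := by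
    rw [← Ideal.map_le_iff_le_comap, Ideal.map_pow]
  let g : P ⧸ I^n →+* W ⧸ (I.map φ)^n := Ideal.quotientMap _ φ hle
  have gb : Function.Bijective g := by
    constructor
    · refine Ideal.quotientMap_injective' (fun a ha => h.inj n a ha)
    · intro y
      obtain ⟨w, rfl⟩ := Ideal.Quotient.mk_surjective y
      obtain ⟨a, ha⟩ := h.surj n w
      exact ⟨Ideal.Quotient.mk _ a, by simpa [g] using (Ideal.Quotient.eq.2 ha).symm⟩
  let e := RingEquiv.ofBijective g gb
  have he : ∀ a, e (Ideal.Quotient.mk _ a) = Ideal.Quotient.mk _ (φ a) := fun a => by simp [e, g]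
  have h1 : ∀ w a, (e.symm : W ⧸ (I.map φ)^n →+* P ⧸ I^n).comp (Ideal.Quotient.mk _) w = Ideal.Quotient.mk _ a ↔ w - φ a ∈ (I.map φ)^n := by
    intro w a
    rw [RingHom.comp_apply, RingHom.coe_coe, RingEquiv.symm_apply_eq, he, Ideal.Quotient.eq]
  refine ⟨(e.symm : W ⧸ (I.map φ)^n →+* P ⧸ I^n).comp (Ideal.Quotient.mk _), h1, ?_, ?_⟩
  · intro a; rw [h1]; simp
  · ext w
    rw [RingHom.mem_ker]
    simpa using h1 w 0

theorem lift_exists {P W D : Type*} [CommRing P] [CommRing W] [CommRing D] {φ : P →+* W} {I : Ideal P}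
    (h : IsDense φ I) (J : Ideal D) [IsAdicComplete J D] (ψ : P →+* D) (hψ : I.map ψ ≤ J) :
    ∃ f : W →+* D, f.comp φ = ψ := by
  choose π hπ1 hπ2 hπ3 using fun n => h.proj n
  have hle : ∀ n, I^n ≤ (J^n).comap ψ := fun n => by
    rw [← Ideal.map_le_iff_le_comap, Ideal.map_pow]; exact Ideal.pow_right_mono hψ n
  let f : (n : ℕ) → W →+* D ⧸ J^n := fun n => (Ideal.quotientMap (J^n) ψ (hle n)).comp (π n)
  have hfe : ∀ n w a, w - φ a ∈ (I.map φ)^n → f n w = Ideal.Quotient.mk _ (ψ a) := by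
    intro n w a hwa
    simp only [f, RingHom.comp_apply, (hπ1 n w a).2 hwa, Ideal.quotientMap_mk]
  have hf : ∀ {m n : ℕ} (hle : m ≤ n), (Ideal.Quotient.factorPow J hle).comp (f n) = f m := by
    intro m n hmn
    ext w
    obtain ⟨a, ha⟩ := h.surj n w
    rw [RingHom.comp_apply, hfe n w a ha, hfe m w a (Ideal.pow_le_pow_right hmn ha)]
    simp
  refine ⟨IsAdicComplete.liftRingHom J f hf, ?_⟩
  apply RingHom.ext
  intro a
  rw [IsHausdorff.eq_iff_smodEq (I := J)]
  intro n
  rw [SModEq.sub_mem, smul_eq_mul, Ideal.mul_top, ← Ideal.Quotient.eq]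
  rw [RingHom.comp_apply, IsAdicComplete.mk_liftRingHom, hfe n (φ a) a (by simp)]

theorem lift_unique {P W D : Type*} [CommRing P] [CommRing W] [CommRing D] {φ : P →+* W} {I : Ideal P}
    (h : IsDense φ I) (J : Ideal D) [IsHausdorff J D] (f g : W →+* D)
    (hfg : f.comp φ = g.comp φ) (hψ : I.map (f.comp φ) ≤ J) : f = g := by
  ext w
  rw [IsHausdorff.eq_iff_smodEq (I := J)]
  intro n
  obtain ⟨a, ha⟩ := h.surj n w
  have h1 : ∀ f : W →+* D, I.map (f.comp φ) ≤ J → f w - f (φ a) ∈ J^n := by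
    intro f hf
    rw [← map_sub]
    have := Ideal.mem_map_of_mem f ha
    rw [Ideal.map_pow, Ideal.map_map] at this
    exact Ideal.pow_right_mono hf n this
  rw [SModEq.sub_mem, smul_eq_mul, Ideal.mul_top]
  have e : f (φ a) = g (φ a) := RingHom.congr_fun hfg a
  have := sub_mem (h1 f hψ) (h1 g (hfg ▸ hψ))
  simpa [e] using this

theorem IsComp.equiv {P W V : Type*} [CommRing P] [CommRing W] [CommRing V] {φ : P →+* W} {ψ : P →+* V}
    {I : Ideal P} (h : IsComp φ I) (h' : IsComp ψ I) : ∃ e : W ≃+* V, ∀ a, e (φ a) = ψ a := by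
  have := h.complete
  have := h'.complete
  obtain ⟨f, hf⟩ := lift_exists h.toIsDense (I.map ψ) ψ le_rfl
  obtain ⟨g, hg⟩ := lift_exists h'.toIsDense (I.map φ) φ le_rfl
  have e1 : g.comp f = RingHom.id W := by
    apply lift_unique h.toIsDense (I.map φ)
    · rw [RingHom.comp_assoc, hf, hg]; rfl
    · rw [RingHom.comp_assoc, hf, hg]
  have e2 : f.comp g = RingHom.id V := by
    apply lift_unique h'.toIsDense (I.map ψ)
    · rw [RingHom.comp_assoc, hg, hf]; rfl
    · rw [RingHom.comp_assoc, hg, hf]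
  exact ⟨RingEquiv.ofRingHom f g e2 e1, fun a => RingHom.congr_fun hf a⟩

theorem IsComp.of_equiv {P W V : Type*} [CommRing P] [CommRing W] [CommRing V] {φ : P →+* W}
    {I : Ideal P} (h : IsComp φ I) (e : W ≃+* V) : IsComp ((e : W →+* V).comp φ) I := by
  refine { h.toIsDense.comp (IsDense.of_equiv e _) with complete := ?_ }
  have := h.complete
  rw [← Ideal.map_map]
  exact (IsAdicComplete.congr_ringEquiv (I.map φ) e).2 this

theorem adic_cofinal {W : Type*} [CommRing W] (I I' : Ideal W) (r : ℕ) (h1 : I'^r ≤ I) (h2 : I ≤ I')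
    (hr : r ≠ 0) (h : IsAdicComplete I W) : IsAdicComplete I' W := by
  have hp : ∀ n, I'^(r*n) ≤ I^n := fun n => by rw [pow_mul]; exact Ideal.pow_right_mono h1 n
  have hp2 : ∀ n, I^n ≤ I'^n := fun n => Ideal.pow_right_mono h2 n
  refine { haus' := ?_, prec' := ?_ }
  · intro x hx
    refine IsHausdorff.haus h.toIsHausdorff x fun n => ?_
    have := hx (r*n)
    rw [SModEq.sub_mem, smul_eq_mul, Ideal.mul_top] at this ⊢
    exact hp n this
  · intro f hf
    simp only [SModEq.sub_mem, smul_eq_mul, Ideal.mul_top] at hf ⊢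
    obtain ⟨L, hL⟩ := IsPrecomplete.prec h.toIsPrecomplete (f := fun n => f (r*n)) (by
      intro m n hmn
      rw [SModEq.sub_mem, smul_eq_mul, Ideal.mul_top]
      exact hp m (hf (Nat.mul_le_mul_left r hmn)))
    refine ⟨L, fun n => ?_⟩
    have := hL n
    rw [SModEq.sub_mem, smul_eq_mul, Ideal.mul_top] at this
    have h3 := hf (Nat.le_mul_of_pos_left n (Nat.pos_of_ne_zero hr))
    have := add_mem h3 (hp2 n this)
    simpa using this

theorem IsComp.cofinal {P W : Type*} [CommRing P] [CommRing W] {φ : P →+* W}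
    {I : Ideal P} (h : IsComp φ I) (I' : Ideal P) (r : ℕ) (h1 : I'^r ≤ I) (h2 : I ≤ I')
    (hr : r ≠ 0) : IsComp φ I' := by
  have hm1 : (I'.map φ)^r ≤ I.map φ := by rw [← Ideal.map_pow]; exact Ideal.map_mono h1
  have hm2 : I.map φ ≤ I'.map φ := Ideal.map_mono h2
  refine ⟨⟨?_, ?_⟩, adic_cofinal _ _ r hm1 hm2 hr h.complete⟩
  · intro n w
    obtain ⟨a, ha⟩ := h.surj n w
    exact ⟨a, Ideal.pow_right_mono hm2 n ha⟩
  · intro n a ha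
    obtain ⟨π, h1', h2', h3'⟩ := h.proj n
    have : (I'.map φ)^n ≤ ((I'^n).map (Ideal.Quotient.mk (I^n))).comap π := by
      rw [← Ideal.map_pow, Ideal.map_le_iff_le_comap]
      intro x hx
      simp only [Ideal.mem_comap]
      rw [h2']
      exact Ideal.mem_map_of_mem _ hx
    have h4 := this ha
    rw [Ideal.mem_comap, h2', Ideal.mem_map_iff_of_surjective _ Ideal.Quotient.mk_surjective] at h4
    obtain ⟨b, hb, hab⟩ := h4
    rw [Ideal.Quotient.eq] at hab
    have := sub_mem hb (Ideal.pow_right_mono h2 n hab)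
    simpa using this

theorem complete_finite {W : Type u} [CommRing W] [IsNoetherianRing W] (J : Ideal W) (h : IsAdicComplete J W)
    (M : Type u) [AddCommGroup M] [Module W M] [Module.Finite W M] : IsAdicComplete J M := by
  have hH : IsHausdorff J M := IsHausdorff.of_le_jacobson J M (IsAdicComplete.le_jacobson_bot J)
  rw [isAdicComplete_iff]
  refine ⟨hH, ?_⟩
  rw [← AdicCompletion.of_surjective_iff]
  intro y
  obtain ⟨t, rfl⟩ := AdicCompletion.ofTensorProduct_surjective_of_finite J M y
  induction t using TensorProduct.induction_on with
  | zero => exact ⟨0, by simp⟩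
  | tmul r x =>
    obtain ⟨w, rfl⟩ := AdicCompletion.of_surjective J W r
    refine ⟨w • x, ?_⟩
    rw [AdicCompletion.ofTensorProduct_tmul, map_smul]
    ext n
    rw [AdicCompletion.val_smul_apply]
    simp
    rfl
  | add a b ha hb =>
    obtain ⟨a', ha⟩ := ha
    obtain ⟨b', hb⟩ := hb
    exact ⟨a' + b', by rw [map_add, map_add, ha, hb]⟩


theorem IsComp.mvps (σ R : Type*) [Finite σ] [CommRing R] :
    IsComp (algebraMap (MvPolynomial σ R) (MvPowerSeries σ R)) (MvPolynomial.idealOfVars σ R) := by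
  have h := (IsComp.adic (MvPolynomial.idealOfVars σ R) (MvPolynomial.idealOfVars_fg σ R)).of_equiv
    (MvPowerSeries.toAdicCompletionAlgEquiv σ R).symm.toRingEquiv
  convert h
  ext a
  all_goals simp

theorem mvps_eval {σ R D : Type*} [Finite σ] [CommRing R] [CommRing D] (J : Ideal D) [IsAdicComplete J D]
    (g : R →+* D) (y : σ → D) (hy : ∀ i, y i ∈ J) :
    ∃ f : MvPowerSeries σ R →+* D, (∀ r, f (MvPowerSeries.C r) = g r) ∧ ∀ i, f (MvPowerSeries.X i) = y i := by
  obtain ⟨f, hf⟩ := lift_exists (IsComp.mvps σ R).toIsDense J (MvPolynomial.eval₂Hom g y) (by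
    rw [MvPolynomial.idealOfVars, Ideal.map_span, Ideal.span_le]
    rintro _ ⟨_, ⟨i, rfl⟩, rfl⟩
    simpa using hy i)
  refine ⟨f, fun r => ?_, fun i => ?_⟩
  · have := RingHom.congr_fun hf (MvPolynomial.C r)
    simpa [MvPowerSeries.algebraMap_apply'] using this
  · have := RingHom.congr_fun hf (MvPolynomial.X i)
    simpa [MvPowerSeries.algebraMap_apply'] using this

theorem IsComp.noeth {P W : Type*} [CommRing P] [CommRing W] [IsNoetherianRing P] {φ : P →+* W} {I : Ideal P}
    (h : IsComp φ I) : IsNoetherianRing W := by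
  obtain ⟨s, hs⟩ := (isNoetherianRing_iff_ideal_fg P).1 inferInstance I
  have := h.complete
  obtain ⟨f, hf1, hf2⟩ := mvps_eval (I.map φ) φ (fun i : s => φ i) (fun i => Ideal.mem_map_of_mem φ (hs ▸ Ideal.subset_span i.2))
  have hK : (Ideal.span (Set.range (MvPowerSeries.X : s → MvPowerSeries s P))).map f = I.map φ := by
    rw [Ideal.map_span, ← hs, Ideal.map_span, ← Set.range_comp]
    congr 1
    ext x
    simp [hf2]
  have hsurj : Function.Surjective f := by
    have : IsHausdorff ((Ideal.span (Set.range (MvPowerSeries.X : s → MvPowerSeries s P))).map f) W := by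
      rw [hK]; exact h.complete.toIsHausdorff
    refine surjective_of_mk_map_comp_surjective (I := Ideal.span (Set.range (MvPowerSeries.X : s → MvPowerSeries s P))) f ?_
    intro y
    obtain ⟨w, rfl⟩ := Ideal.Quotient.mk_surjective y
    obtain ⟨a, ha⟩ := h.surj 1 w
    refine ⟨MvPowerSeries.C a, ?_⟩
    rw [RingHom.comp_apply, hf1, eq_comm, Ideal.Quotient.eq, hK]
    simpa using ha
  exact isNoetherianRing_of_surjective _ _ f hsurj

theorem IsComp.finite {P W A' : Type u} [CommRing P] [IsNoetherianRing P] [CommRing W] [Algebra P W] {I : Ideal P}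
    (h : IsComp (algebraMap P W) I) [CommRing A'] [Algebra P A'] [Module.Finite P A'] :
    IsComp (algebraMap A' (A' ⊗[P] W)) (I.map (algebraMap P A')) := by
  have hN := h.noeth
  have hc : algebraMap P (A' ⊗[P] W) = (algebraMap A' (A' ⊗[P] W)).comp (algebraMap P A') := by
    rw [← IsScalarTower.algebraMap_eq]
  have hc2 : algebraMap P (A' ⊗[P] W) = (Algebra.TensorProduct.includeRight : W →ₐ[P] A' ⊗[P] W).toRingHom.comp (algebraMap P W) := by
    ext a; simp
  refine ⟨⟨?_, ?_⟩, ?_⟩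
  · intro n x
    rw [Ideal.map_map, ← hc]
    induction x using TensorProduct.induction_on with
    | zero => exact ⟨0, by simp⟩
    | tmul a w =>
      obtain ⟨b, hb⟩ := h.surj n w
      refine ⟨a * algebraMap P A' b, ?_⟩
      have h1 : a ⊗ₜ[P] w - algebraMap A' (A' ⊗[P] W) (a * algebraMap P A' b) =
        (a ⊗ₜ 1) * (1 ⊗ₜ (w - algebraMap P W b)) := by
        rw [Algebra.algebraMap_eq_smul_one b, mul_smul_comm, mul_one, Algebra.algebraMap_eq_smul_one]
        rw [Algebra.algebraMap_eq_smul_one, TensorProduct.tmul_sub, mul_sub, TensorProduct.tmul_smul, mul_smul_comm]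
        simp only [Algebra.TensorProduct.tmul_mul_tmul, one_mul, mul_one, Algebra.TensorProduct.one_def, TensorProduct.smul_tmul', smul_eq_mul]
      rw [h1]
      apply Ideal.mul_mem_left
      have := Ideal.mem_map_of_mem (Algebra.TensorProduct.includeRight : W →ₐ[P] A' ⊗[P] W).toRingHom hb
      rw [Ideal.map_pow, Ideal.map_map, ← hc2] at this
      exact this
    | add x y hx hy =>
      obtain ⟨a, ha⟩ := hx
      obtain ⟨b, hb⟩ := hy
      refine ⟨a + b, ?_⟩
      have := add_mem ha hb
      rw [map_add]
      convert this using 1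
      ring
  · intro n a ha
    rw [Ideal.map_map, ← hc] at ha
    obtain ⟨π, h1, h2, h3⟩ := h.proj n
    let g0 : P ⧸ I^n →+* A' ⧸ (I.map (algebraMap P A'))^n :=
      Ideal.quotientMap _ (algebraMap P A') (by rw [← Ideal.map_le_iff_le_comap, Ideal.map_pow])
    let g1 : W →ₐ[P] A' ⧸ (I.map (algebraMap P A'))^n :=
      { g0.comp π with
        commutes' := fun r => by
          change g0 (π (algebraMap P W r)) = _
          rw [h2, Ideal.quotientMap_mk]; rfl }
    let g : A' ⊗[P] W →ₐ[A'] A' ⧸ (I.map (algebraMap P A'))^n :=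
      Algebra.TensorProduct.lift (Algebra.ofId _ _) g1 (fun _ _ => Commute.all _ _)
    have hg : (I.map (algebraMap P (A' ⊗[P] W)))^n ≤ RingHom.ker g := by
      rw [← Ideal.map_pow, Ideal.map_le_iff_le_comap]
      intro x hx
      rw [Ideal.mem_comap, RingHom.mem_ker, hc, RingHom.comp_apply, AlgHom.commutes, Ideal.Quotient.algebraMap_eq, Ideal.Quotient.eq_zero_iff_mem, ← Ideal.map_pow]
      exact Ideal.mem_map_of_mem _ hx
    have := hg ha
    rw [RingHom.mem_ker, AlgHom.commutes, Ideal.Quotient.algebraMap_eq, Ideal.Quotient.eq_zero_iff_mem] at this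
    exact this
  · rw [Ideal.map_map, ← hc, hc2, ← Ideal.map_map]
    let e : W ⊗[P] A' ≃ₐ[P] A' ⊗[P] W := Algebra.TensorProduct.comm P W A'
    have hfin : IsAdicComplete (I.map (algebraMap P W)) (W ⊗[P] A') := complete_finite _ h.complete _
    have h4 := (IsAdicComplete.map_algebraMap_iff (S := W ⊗[P] A') _ _).2 hfin
    have h5 := (IsAdicComplete.congr_ringEquiv _ e.toRingEquiv).2 h4
    convert h5 using 1
    rw [Ideal.map_map (algebraMap P W), Ideal.map_map (algebraMap P W)]
    change _ = Ideal.map (e : (W ⊗[P] A') →+* (A' ⊗[P] W)) _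
    rw [Ideal.map_map]
    congr 1

theorem IsComp.deriv {P W : Type u} [CommRing P] [CommRing W] [IsNoetherianRing P] {φ : P →+* W} {I : Ideal P}
    (h : IsComp φ I) (D : Derivation ℤ P P) : ∃ D' : Derivation ℤ W W, ∀ a, D' (φ a) = φ (D a) := by
  have hN := h.noeth
  have hcomp := h.complete
  let J : Ideal (TrivSqZeroExt W W) := (I.map φ).comap (TrivSqZeroExt.fstHom W W W).toRingHom
  let K : Ideal (TrivSqZeroExt W W) := (I.map φ).map (algebraMap W (TrivSqZeroExt W W))
  have hfin : Module.Finite W (TrivSqZeroExt W W) := inferInstanceAs (Module.Finite W (W × W))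
  have hK : IsAdicComplete K (TrivSqZeroExt W W) :=
    (IsAdicComplete.map_algebraMap_iff (S := (TrivSqZeroExt W W)) _ _).2 (complete_finite _ h.complete _)
  have hmem : ∀ w ∈ I.map φ, ∀ e : (TrivSqZeroExt W W), (TrivSqZeroExt.inl w : (TrivSqZeroExt W W)) * e ∈ K := by
    intro w hw e
    exact Ideal.mul_mem_right _ _ (Ideal.mem_map_of_mem (algebraMap W (TrivSqZeroExt W W)) hw)
  have hJ : IsAdicComplete J (TrivSqZeroExt W W) := by
    refine adic_cofinal K J 2 ?_ ?_ two_ne_zero hK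
    · rw [pow_two, Ideal.mul_le]
      intro a ha b hb
      have ha : a.fst ∈ I.map φ := ha
      have hb : b.fst ∈ I.map φ := hb
      have : a * b = (TrivSqZeroExt.inl a.fst : (TrivSqZeroExt W W)) * b + (TrivSqZeroExt.inl b.fst : (TrivSqZeroExt W W)) * (TrivSqZeroExt.inr a.snd) := by
        ext <;> simp
      rw [this]
      exact add_mem (hmem _ ha _) (hmem _ hb _)
    · rw [Ideal.map_le_iff_le_comap]
      intro w hw
      exact hw
  let ψ : P →+* (TrivSqZeroExt W W) :=
    { toFun := fun a => TrivSqZeroExt.inl (φ a) + TrivSqZeroExt.inr (φ (D a))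
      map_one' := by ext <;> simp
      map_zero' := by ext <;> simp
      map_mul' := fun a b => by
        ext
        · simp
        · simp [mul_comm]
      map_add' := fun a b => by ext <;> simp }
  obtain ⟨f, hf⟩ := lift_exists h.toIsDense J ψ (by
    rw [Ideal.map_le_iff_le_comap]
    intro a ha
    have : φ a ∈ I.map φ := Ideal.mem_map_of_mem φ ha
    simpa [J, ψ] using this)
  have hid : (TrivSqZeroExt.fstHom W W W).toRingHom.comp f = RingHom.id W := by
    apply lift_unique h.toIsDense (I.map φ)
    · rw [RingHom.comp_assoc, hf]
      ext a
      simp [ψ]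
    · rw [RingHom.comp_assoc, hf]
      apply le_of_eq
      congr 1
      ext a
      simp [ψ]
  have hfst : ∀ w, (f w).fst = w := fun w => RingHom.congr_fun hid w
  let D' : Derivation ℤ W W := Derivation.mk'
    ((AddMonoidHom.mk' (fun w => (f w).snd) (fun a b => by simp)).toIntLinearMap) (by
      intro a b
      simp [hfst, mul_comm])
  refine ⟨D', fun a => ?_⟩
  have := RingHom.congr_fun hf a
  change (f (φ a)).snd = _
  rw [RingHom.comp_apply] at this
  rw [this]
  simp [ψ]


theorem IsComp.isLocal {P W : Type*} [CommRing P] [CommRing W] [IsLocalRing P] {φ : P →+* W}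
    (h : IsComp φ (maximalIdeal P)) : IsLocalRing W ∧ ((maximalIdeal P).map φ).IsMaximal := by
  have hm : ((maximalIdeal P).map φ).IsMaximal := by
    obtain ⟨π, h1, h2, h3⟩ := h.proj 1
    rw [← pow_one ((maximalIdeal P).map φ), ← h3]
    have hs : Function.Surjective π := fun y => by
      obtain ⟨a, rfl⟩ := Ideal.Quotient.mk_surjective y
      exact ⟨_, h2 a⟩
    have : (maximalIdeal P ^ 1).IsMaximal := by rw [pow_one]; infer_instance
    letI := Ideal.Quotient.field (maximalIdeal P ^ 1)
    exact RingHom.ker_isMaximal_of_surjective π hs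
  have := h.complete
  exact ⟨isLocalRing_of_isAdicComplete_maximal ((maximalIdeal P).map φ), hm⟩

theorem IsComp.max_eq {P W : Type*} [CommRing P] [CommRing W] [IsLocalRing P] [IsLocalRing W] {φ : P →+* W}
    (h : IsComp φ (maximalIdeal P)) : (maximalIdeal P).map φ = maximalIdeal W :=
  IsLocalRing.eq_maximalIdeal h.isLocal.2

theorem IsComp.isLocalHom {P W : Type*} [CommRing P] [CommRing W] [IsLocalRing P] [IsLocalRing W] {φ : P →+* W}
    (h : IsComp φ (maximalIdeal P)) : IsLocalHom φ := by
  rw [((local_hom_TFAE φ).out 0 2 :)]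
  exact h.max_eq.le

theorem IsComp.flat {P W : Type u} [CommRing P] [CommRing W] [IsNoetherianRing P] [Algebra P W] {I : Ideal P}
    (h : IsComp (algebraMap P W) I) : Module.Flat P W := by
  obtain ⟨e, he⟩ := h.equiv (IsComp.adic I (IsNoetherian.noetherian I))
  let e' : W ≃ₐ[P] AdicCompletion I P := AlgEquiv.ofRingEquiv (f := e) he
  have := AdicCompletion.flat_of_isNoetherian I
  exact Module.Flat.of_linearEquiv e'.toLinearEquiv

theorem IsComp.regular {P W : Type u} [CommRing P] [CommRing W] [_root_.IsRegularLocalRing P] [Algebra P W]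
    (h : IsComp (algebraMap P W) (maximalIdeal P)) : _root_.IsRegularLocalRing W := by
  have := h.flat
  have := h.isLocal.1
  have := h.isLocalHom
  have := h.noeth
  have := h.isLocal.2
  exact reg_asc (A := P) (reg_of_field _ (Ideal.Quotient.field _).toIsField)

theorem IsComp.finite_local {P W A' : Type u} [CommRing P] [IsNoetherianRing P] [IsLocalRing P] [CommRing W] [Algebra P W]
    (h : IsComp (algebraMap P W) (maximalIdeal P)) [CommRing A'] [IsLocalRing A'] [Algebra P A'] [Module.Finite P A'] :
    IsComp (algebraMap A' (A' ⊗[P] W)) (maximalIdeal A') := by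
  have h1 := h.finite (A' := A')
  have : IsNoetherianRing A' := IsNoetherianRing.of_finite P A'
  have hloc : IsLocalHom (algebraMap P A') := by
    rw [((local_hom_TFAE (algebraMap P A')).out 0 4 :)]
    have := Ideal.isMaximal_comap_of_isIntegral_of_isMaximal (R := P) (maximalIdeal A')
    exact IsLocalRing.eq_maximalIdeal this
  have hle : (maximalIdeal P).map (algebraMap P A') ≤ maximalIdeal A' :=
    ((local_hom_TFAE (algebraMap P A')).out 0 2 :).1 hloc
  obtain ⟨r, hr⟩ : ∃ r, (maximalIdeal A')^r ≤ (maximalIdeal P).map (algebraMap P A') := by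
    have hrad : maximalIdeal A' ≤ ((maximalIdeal P).map (algebraMap P A')).radical := by
      rw [Ideal.radical_eq_sInf]
      refine le_sInf fun q hq => ?_
      obtain ⟨hq1, hq2⟩ := hq
      have hqm : (q.comap (algebraMap P A')).IsMaximal := by
        have h3 : maximalIdeal P ≤ q.comap (algebraMap P A') := Ideal.map_le_iff_le_comap.1 hq1
        have h4 : q.comap (algebraMap P A') ≠ ⊤ := Ideal.comap_ne_top _ hq2.ne_top
        rw [← (IsLocalRing.maximalIdeal.isMaximal P).eq_of_le h4 h3]
        infer_instance
      have := Ideal.isMaximal_of_isIntegral_of_isMaximal_comap q hqm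
      exact (IsLocalRing.eq_maximalIdeal this).ge
    exact Ideal.exists_pow_le_of_le_radical_of_fg hrad (IsNoetherian.noetherian _)
  exact h1.cofinal _ (r+1) ((Ideal.pow_le_pow_right (by omega)).trans hr) hle (by omega)


theorem regLocal_iff (R : Type u) [CommRing R] [IsLocalRing R] :
    CharPolyhedra.IsRegularLocalRing R ↔ _root_.IsRegularLocalRing R := by
  classical
  constructor
  · rintro ⟨hN, n, s, hs, hd⟩
    refine reg_of_span (Finset.univ.image s) (by simpa using hs) ?_
    rw [hd]
    exact_mod_cast Finset.card_image_le.trans (by simp)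
  · intro h
    refine ⟨inferInstance, ?_⟩
    obtain ⟨s, hs, hd⟩ := reg_span (A := R)
    refine ⟨s.card, fun i => (s.equivFin.symm i : R), ?_, hd.symm⟩
    rw [← hs]
    congr 1
    ext x
    constructor
    · rintro ⟨i, rfl⟩; simp
    · intro hx; exact ⟨s.equivFin ⟨x, hx⟩, by simp⟩

theorem regular_iff (R : Type u) [CommRing R] :
    CharPolyhedra.IsRegularRing R ↔ _root_.IsRegularRing R := by
  constructor
  · rintro ⟨h1, h2⟩
    rw [_root_.isRegularRing_iff]
    exact fun p hp => (regLocal_iff _).1 (h2 p)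
  · intro h
    exact ⟨inferInstance, fun p hp => (regLocal_iff _).2 (_root_.isRegularRing_iff.1 h p)⟩

abbrev Kf (A L : Type*) [CommRing A] [Field L] [Algebra A L] : Subfield L :=
  Subfield.closure (Set.range (algebraMap A L))

theorem mem_Kf {A L : Type*} [CommRing A] [Field L] [Algebra A L] {x : L} :
    x ∈ Kf A L ↔ ∃ a b : A, algebraMap A L b ≠ 0 ∧ x = algebraMap A L a / algebraMap A L b := by
  have hc : Subring.closure (Set.range (algebraMap A L)) = (algebraMap A L).range := by
    rw [← RingHom.coe_range, Subring.closure_eq]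
  rw [Subfield.mem_closure_iff, hc]
  constructor
  · rintro ⟨_, ⟨a, rfl⟩, _, ⟨b, rfl⟩, rfl⟩
    by_cases hb : algebraMap A L b = 0
    · exact ⟨0, 1, by simp, by simp [hb]⟩
    · exact ⟨a, b, hb, rfl⟩
  · rintro ⟨a, b, hb, rfl⟩
    exact ⟨_, ⟨a, rfl⟩, _, ⟨b, rfl⟩, rfl⟩

def FinRes (A L : Type*) [CommRing A] [Field L] [Algebra A L] : Prop :=
  Module.Finite (Kf A L) L

theorem fin_of_range_le {F1 F2 L : Type*} [Field F1] [Field F2] [Field L] [Algebra F1 L] [Algebra F2 L]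
    (h : ∀ x : F1, ∃ y : F2, algebraMap F2 L y = algebraMap F1 L x) [hf : Module.Finite F1 L] :
    Module.Finite F2 L := by
  obtain ⟨s, hs⟩ := hf.fg_top
  refine ⟨s, ?_⟩
  rw [eq_top_iff]
  rintro x -
  have hx : x ∈ Submodule.span F1 (s : Set L) := hs ▸ Submodule.mem_top
  induction hx using Submodule.span_induction with
  | mem x hx => exact Submodule.subset_span hx
  | zero => exact zero_mem _
  | add x y _ _ hx hy => exact add_mem hx hy
  | smul a x _ hx =>
    obtain ⟨b, hb⟩ := h a
    rw [Algebra.smul_def, ← hb, ← Algebra.smul_def]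
    exact Submodule.smul_mem _ _ hx

theorem fin_of_gen {F L : Type*} [Field F] [Field L] [Algebra F L] (S : Subring L) (s : Finset L)
    (hS : ∀ x ∈ S, x ∈ Submodule.span F (s : Set L)) (hq : ∀ l : L, ∃ x ∈ S, ∃ y ∈ S, l = x / y) :
    Module.Finite F L := by
  let T := Algebra.adjoin F (S : Set L)
  have hT : Subalgebra.toSubmodule T ≤ Submodule.span F (s : Set L) := by
    rw [Algebra.adjoin_eq_span, Submodule.span_le]
    have : (Submonoid.closure (S : Set L) : Set L) = S := by
      have := Submonoid.closure_eq S.toSubmonoid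
      exact congrArg (fun m : Submonoid L => (m : Set L)) this
    rw [this]
    exact hS
  have hfd : FiniteDimensional F (Submodule.span F (s : Set L)) := FiniteDimensional.span_finset F s
  have hTf : FiniteDimensional F (Subalgebra.toSubmodule T) := Submodule.finiteDimensional_of_le hT
  have hTf' : FiniteDimensional F T := hTf
  have htop : T = ⊤ := by
    rw [eq_top_iff]
    rintro l -
    obtain ⟨x, hx, y, hy, rfl⟩ := hq l
    rw [div_eq_mul_inv]
    refine mul_mem (Algebra.subset_adjoin hx) ?_
    have hyT : y ∈ T := Algebra.subset_adjoin hy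
    exact T.inv_mem_of_algebraic (x := ⟨y, hyT⟩) ((Algebra.IsAlgebraic.isAlgebraic (R := F) (⟨y, hyT⟩ : T)).algHom T.val)
  have : FiniteDimensional F (⊤ : Subalgebra F L) := htop ▸ hTf'
  exact Module.Finite.equiv (Subalgebra.topEquiv (R := F) (A := L)).toLinearEquiv

theorem fin_aux {C0 C K0 K : Type*} [CommRing C0] [CommRing C] [Algebra C0 C] [hf : Module.Finite C0 C]
    [Field K0] [Field K] [Algebra K0 K] (g0 : C0 →+* K0) (g : C →+* K)
    (hg : ∀ a, g (algebraMap C0 C a) = algebraMap K0 K (g0 a)) (hq : ∀ l : K, ∃ a b, l = g a / g b) :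
    Module.Finite K0 K := by
  classical
  obtain ⟨t, ht⟩ := hf.fg_top
  refine fin_of_gen g.range (t.image g) ?_ ?_
  · rintro _ ⟨c, rfl⟩
    have hc : c ∈ Submodule.span C0 (t : Set C) := ht ▸ Submodule.mem_top
    induction hc using Submodule.span_induction with
    | mem x hx => exact Submodule.subset_span (by simpa using ⟨x, hx, rfl⟩)
    | zero => simp
    | add x y _ _ hx hy => rw [map_add]; exact add_mem hx hy
    | smul a x _ hx =>
      have : g (a • x) = g0 a • g x := by
        rw [Algebra.smul_def, Algebra.smul_def, map_mul, hg]
      rw [this]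
      exact Submodule.smul_mem _ _ hx
  · intro l
    obtain ⟨a, b, rfl⟩ := hq l
    exact ⟨g a, ⟨a, rfl⟩, g b, ⟨b, rfl⟩, rfl⟩

theorem fin_trans {K0 K L : Type*} [Field K0] [Field K] [Field L] [Algebra K0 L] [Algebra K L] (i : K0 →+* K)
    (hi : ∀ x, algebraMap K L (i x) = algebraMap K0 L x) (h1 : letI := i.toAlgebra; Module.Finite K0 K)
    (h2 : Module.Finite K L) : Module.Finite K0 L := by
  letI := i.toAlgebra
  haveI : IsScalarTower K0 K L := IsScalarTower.of_algebraMap_eq (fun x => (hi x).symm)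
  exact Module.Finite.trans K L

theorem fin_aux2 {C0 C K0 K L : Type*} [CommRing C0] [CommRing C] [Algebra C0 C] [hf : Module.Finite C0 C]
    [Field K0] [Field K] [Field L] [Algebra K0 L] [Algebra K L] (i : K0 →+* K)
    (hi : ∀ x, algebraMap K L (i x) = algebraMap K0 L x) (h2 : Module.Finite K L) (g0 : C0 →+* K0) (g : C →+* K)
    (hg : ∀ a, g (algebraMap C0 C a) = i (g0 a)) (hq : ∀ l : K, ∃ a b, l = g a / g b) :
    Module.Finite K0 L := by
  refine fin_trans i hi ?_ h2
  letI := i.toAlgebra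
  exact fin_aux g0 g hg hq

theorem fin_aux3 {C0 C L : Type*} [CommRing C0] [CommRing C] [Field L] [Algebra C0 C]
    [Algebra C L] [Algebra C0 L] [IsScalarTower C0 C L] [hf : Module.Finite C0 C] (K0 K : Subfield L)
    (hle : K0 ≤ K) (h0 : ∀ x, algebraMap C0 L x ∈ K0) (h1 : ∀ x, algebraMap C L x ∈ K)
    (hq : ∀ l : K, ∃ a b, (l : L) = algebraMap C L a / algebraMap C L b)
    (h : Module.Finite K L) : Module.Finite K0 L := by
  refine fin_aux2 (hf := hf) (Subfield.inclusion hle) (fun x => rfl) h ((algebraMap C0 L).codRestrict K0 h0)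
    ((algebraMap C L).codRestrict K h1) ?_ ?_
  · intro a
    apply Subtype.ext
    exact (IsScalarTower.algebraMap_apply C0 C L a).symm
  · intro l
    obtain ⟨a, b, hab⟩ := hq l
    exact ⟨a, b, Subtype.ext hab⟩

theorem FinRes.of_finite {C0 C L : Type*} [CommRing C0] [CommRing C] [Field L] [Algebra C0 C]
    [Algebra C L] [Algebra C0 L] [IsScalarTower C0 C L] [hf : Module.Finite C0 C] (h : FinRes C L) : FinRes C0 L := by
  have hle : Kf C0 L ≤ Kf C L := by
    refine Subfield.closure_mono ?_
    rintro _ ⟨x, rfl⟩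
    exact ⟨algebraMap C0 C x, (IsScalarTower.algebraMap_apply C0 C L x).symm⟩
  have h' : Module.Finite (Kf C L) L := h
  refine fin_aux3 (hf := hf) (Kf C0 L) (Kf C L) hle (fun x => Subfield.subset_closure ⟨x, rfl⟩) (fun x => Subfield.subset_closure ⟨x, rfl⟩) ?_ h'
  rintro ⟨l, hl⟩
  obtain ⟨a, b, hb, hab⟩ := mem_Kf.1 hl
  exact ⟨a, b, hab⟩

theorem hg_iff (A : Type u) [CommRing A] [IsLocalRing A] :
    CharPolyhedra.HasGeomRegularFormalFibers A ↔
      ∀ (L : Type u) [Field L] [Algebra A L], FinRes A L →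
        _root_.IsRegularRing (L ⊗[A] AdicCompletion (maximalIdeal A) A) := by
  constructor
  · intro h L _ _ hL
    let P := RingHom.ker (algebraMap A L)
    have hP : P.IsPrime := RingHom.ker_isPrime _
    let f : P.ResidueField →ₐ[A] L := Ideal.ResidueField.liftₐ P (Algebra.ofId A L) le_rfl (by
      intro x hx
      simpa [P, RingHom.mem_ker, IsUnit.mem_submonoid_iff] using hx)
    letI : Algebra P.ResidueField L := f.toRingHom.toAlgebra
    haveI : IsScalarTower A P.ResidueField L := IsScalarTower.of_algebraMap_eq (fun x => (f.commutes x).symm)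
    have : Module.Finite P.ResidueField L := by
      have : Module.Finite (Kf A L) L := hL
      refine fin_of_range_le (F1 := Kf A L) ?_
      rintro ⟨x, hx⟩
      obtain ⟨a, b, hb, rfl⟩ := mem_Kf.1 hx
      refine ⟨algebraMap A _ a / algebraMap A _ b, ?_⟩
      rw [map_div₀, ← IsScalarTower.algebraMap_apply, ← IsScalarTower.algebraMap_apply]; rfl
    have h1 := (regular_iff _).1 (h P L)
    exact _root_.IsRegularRing.of_ringEquiv (Algebra.TensorProduct.cancelBaseChange A P.ResidueField L L (AdicCompletion (maximalIdeal A) A)).toRingEquiv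
  · intro h P _ κ' _ _ _
    rw [regular_iff]
    letI : Algebra A κ' := ((algebraMap P.ResidueField κ').comp (algebraMap A P.ResidueField)).toAlgebra
    haveI : IsScalarTower A P.ResidueField κ' := IsScalarTower.of_algebraMap_eq (fun x => rfl)
    have h1 : FinRes A κ' := by
      refine fin_of_range_le (F1 := P.ResidueField) ?_
      intro x
      obtain ⟨a, b, -, rfl⟩ := IsFractionRing.div_surjective (A := A ⧸ P) x
      obtain ⟨a, rfl⟩ := Ideal.Quotient.mk_surjective a
      obtain ⟨b, rfl⟩ := Ideal.Quotient.mk_surjective b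
      refine ⟨⟨algebraMap A κ' a / algebraMap A κ' b, div_mem (Subfield.subset_closure ⟨a, rfl⟩) (Subfield.subset_closure ⟨b, rfl⟩)⟩, ?_⟩
      rw [map_div₀]
      rfl
    have h2 := h κ' h1
    exact _root_.IsRegularRing.of_ringEquiv (Algebra.TensorProduct.cancelBaseChange A P.ResidueField κ' κ' (AdicCompletion (maximalIdeal A) A)).toRingEquiv.symm


theorem reg_congr {X Y : Type u} [CommRing X] [CommRing Y] (e : X ≃+* Y) : IsRegularRing X ↔ IsRegularRing Y :=
  ⟨fun _ => IsRegularRing.of_ringEquiv e, fun _ => IsRegularRing.of_ringEquiv e.symm⟩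

theorem comp_reg {P W V : Type u} [CommRing P] [CommRing W] [CommRing V] [Algebra P W] [Algebra P V]
    {I : Ideal P} (h : IsComp (algebraMap P W) I) (h' : IsComp (algebraMap P V) I)
    (L : Type u) [CommRing L] [Algebra P L] : IsRegularRing (L ⊗[P] W) ↔ IsRegularRing (L ⊗[P] V) := by
  obtain ⟨e, he⟩ := h.equiv h'
  let e' : W ≃ₐ[P] V := AlgEquiv.ofRingEquiv (f := e) he
  exact reg_congr (Algebra.TensorProduct.congr (AlgEquiv.refl : L ≃ₐ[P] L) e').toRingEquiv

theorem fin_reg {P P' W W' : Type u} [CommRing P] [IsNoetherianRing P] [IsLocalRing P] [CommRing P'] [IsLocalRing P']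
    [CommRing W] [CommRing W'] [Algebra P W] [Algebra P P'] [Module.Finite P P'] [Algebra P' W']
    (h : IsComp (algebraMap P W) (maximalIdeal P)) (h' : IsComp (algebraMap P' W') (maximalIdeal P'))
    (L : Type u) [CommRing L] [Algebra P L] [Algebra P' L] [IsScalarTower P P' L] :
    IsRegularRing (L ⊗[P] W) ↔ IsRegularRing (L ⊗[P'] W') := by
  rw [← comp_reg (h.finite_local (A' := P')) h' L]
  exact reg_congr (Algebra.TensorProduct.cancelBaseChange P P' L L W).toRingEquiv.symm

def HG (A : Type u) [CommRing A] [IsLocalRing A] : Prop :=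
  ∀ (L : Type u) [Field L] [Algebra A L], FinRes A L →
        _root_.IsRegularRing (L ⊗[A] AdicCompletion (maximalIdeal A) A)

theorem max_fg (A : Type u) [CommRing A] [IsLocalRing A] [IsNoetherianRing A] : (maximalIdeal A).FG :=
  (isNoetherianRing_iff_ideal_fg A).1 inferInstance _

theorem HG.of_finite {A A' : Type u} [CommRing A] [IsLocalRing A] [IsNoetherianRing A] [CommRing A'] [IsLocalRing A'] [Algebra A A']
    [Module.Finite A A'] (h : HG A) : HG A' := by
  intro L _ _ hL
  letI : Algebra A L := ((algebraMap A' L).comp (algebraMap A A')).toAlgebra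
  haveI : IsScalarTower A A' L := IsScalarTower.of_algebraMap_eq (fun _ => rfl)
  haveI : IsNoetherianRing A' := IsNoetherianRing.of_finite A A'
  exact (fin_reg (IsComp.adic _ (max_fg A)) (IsComp.adic _ (max_fg A')) L).1 (h L (hL.of_finite))

theorem HG.of_surj {A A' : Type u} [CommRing A] [IsLocalRing A] [IsNoetherianRing A] [CommRing A'] [IsLocalRing A']
    (f : A →+* A') (hf : Function.Surjective f) (h : HG A) : HG A' := by
  letI := f.toAlgebra
  haveI : Module.Finite A A' := Module.Finite.of_surjective (Algebra.linearMap A A') hf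
  exact h.of_finite

theorem isG_iff (A : Type u) [CommRing A] : CharPolyhedra.IsGRing A ↔ IsNoetherianRing A ∧
    ∀ (P : Ideal A) [P.IsPrime], HG (Localization.AtPrime P) := by
  unfold CharPolyhedra.IsGRing
  exact and_congr Iff.rfl (forall_congr' fun P => forall_congr' fun _ => hg_iff _)


theorem HG.of_equiv {A A' : Type u} [CommRing A] [IsLocalRing A] [IsNoetherianRing A] [CommRing A'] [IsLocalRing A']
    (e : A ≃+* A') (h : HG A) : HG A' := h.of_surj e.toRingHom e.surjective

theorem HG.of_isLoc {A B : Type u} [CommRing A] [IsNoetherianRing A] [CommRing B] [IsLocalRing B]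
    (h : ∀ (P : Ideal A) [P.IsPrime], HG (Localization.AtPrime P)) {f : A →+* B} (hf : IsLoc f) : HG B := by
  obtain ⟨e⟩ := hf.atPrime ((maximalIdeal B).comap f) rfl
  exact (h _).of_equiv e

theorem IsLoc.of_comp {X Y Z : Type*} [CommRing X] [CommRing Y] [CommRing Z] {f : X →+* Y}
    {g : Y →+* Z} (hgf : IsLoc (g.comp f)) (hf : IsLoc f) : IsLoc g := by
  constructor
  · intro z
    obtain ⟨x, s, hs, e⟩ := hgf.surj z
    exact ⟨f x, f s, hs, e⟩
  · intro y hy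
    obtain ⟨x, s, hs, e⟩ := hf.surj y
    obtain ⟨t, ht, e2⟩ := hgf.inj x (by simp [← e, hy])
    refine ⟨f t, ht, ?_⟩
    have := congrArg f e2
    rw [map_mul, ← e, map_zero, ← mul_assoc] at this
    exact (hs.mul_left_eq_zero).1 this

theorem IsLoc.poly {X Y : Type*} [CommRing X] [CommRing Y] {f : X →+* Y} (hf : IsLoc f) :
    IsLoc (Polynomial.mapRingHom f) := by
  letI := f.toAlgebra
  have := hf.isLocalization
  letI : Algebra (Polynomial X) (Polynomial Y) := (Polynomial.mapRingHom f).toAlgebra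
  have := Polynomial.isLocalization ((IsUnit.submonoid Y).comap f) Y
  exact IsLoc.of_isLocalization (((IsUnit.submonoid Y).comap f).map Polynomial.C)

theorem reduction
   (main : ∀ (A B : Type u) [CommRing A] [IsNoetherianRing A] [IsLocalRing A] [CommRing B] [IsLocalRing B]
      (f : Polynomial A →+* B) (_ : IsLoc f) (_ : IsLocalHom (f.comp Polynomial.C)), HG A → HG B)
    (R : Type u) [CommRing R] (hG : CharPolyhedra.IsGRing R) :
    (∀ I : Ideal R, CharPolyhedra.IsGRing (R ⧸ I)) ∧
      (∀ (P : Ideal R) [P.IsPrime], CharPolyhedra.IsGRing (Localization.AtPrime P)) ∧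
      (∀ (Q : Ideal (Polynomial R)) [Q.IsMaximal], CharPolyhedra.IsGRing (Localization.AtPrime Q)) := by
  rw [isG_iff] at hG
  obtain ⟨hN, hG⟩ := hG
  refine ⟨fun I => ?_, fun P _ => ?_, fun Q _ => ?_⟩
  · rw [isG_iff]
    refine ⟨inferInstance, fun P _ => ?_⟩
    refine (hG (P.comap (Ideal.Quotient.mk I))).of_surj (Localization.localRingHom _ P (Ideal.Quotient.mk I) rfl) ?_
    exact RingHom.surjective_localRingHom_of_surjective (Ideal.Quotient.mk I) Ideal.Quotient.mk_surjective P
  · rw [isG_iff]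
    refine ⟨inferInstance, fun P' _ => ?_⟩
    exact HG.of_isLoc hG (IsLoc.comp (IsLoc.of_isLocalization P'.primeCompl) (IsLoc.of_isLocalization P.primeCompl))
  · rw [isG_iff]
    refine ⟨inferInstance, fun P' _ => ?_⟩
    refine HG.of_isLoc ?_ (IsLoc.comp (IsLoc.of_isLocalization P'.primeCompl) (IsLoc.of_isLocalization Q.primeCompl))
    intro Q' _
    let B := Localization.AtPrime Q'
    let P := Q'.comap Polynomial.C
    let A := Localization.AtPrime P
    have hP : P.IsPrime := inferInstance
    let g0 : A →+* B := IsLocalization.lift (M := P.primeCompl) (S := A) (g := (algebraMap (Polynomial R) B).comp Polynomial.C) (fun y => by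
        exact IsLocalization.map_units (M := Q'.primeCompl) B ⟨Polynomial.C y.1, y.2⟩)
    have hg0 : g0.comp (algebraMap R A) = (algebraMap (Polynomial R) B).comp Polynomial.C := IsLocalization.lift_comp _
    let f : Polynomial A →+* B := Polynomial.eval₂RingHom g0 (algebraMap (Polynomial R) B Polynomial.X)
    have hf : f.comp (Polynomial.mapRingHom (algebraMap R A)) = algebraMap (Polynomial R) B := by
      refine Polynomial.ringHom_ext ?_ ?_
      · intro a
        have := RingHom.congr_fun hg0 a
        simpa [f] using this
      · simp [f]
    have hf2 : f.comp Polynomial.C = g0 := by ext a; simp [f]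
    refine main A B f ?_ ?_ (hG P)
    · refine IsLoc.of_comp (f := Polynomial.mapRingHom (algebraMap R A)) ?_ (IsLoc.poly (IsLoc.of_isLocalization P.primeCompl))
      rw [hf]
      exact IsLoc.of_isLocalization Q'.primeCompl
    · rw [hf2]
      refine ⟨fun a ha => ?_⟩
      obtain ⟨x, s, rfl⟩ := IsLocalization.exists_mk'_eq P.primeCompl a
      rw [IsLocalization.lift_mk'] at ha
      have := isUnit_of_mul_isUnit_left ha
      rw [IsLocalization.AtPrime.isUnit_mk'_iff A P]
      exact (IsLocalization.AtPrime.isUnit_to_map_iff B Q' (Polynomial.C x)).1 this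

end GR

namespace GR
open Polynomial


theorem adj_tensor {E S : Type*} [CommRing E] [CommRing S] [Algebra E S] (f : E[X]) :
    ∃ e : AdjoinRoot f ⊗[E] S ≃+* AdjoinRoot (f.map (algebraMap E S)),
      (∀ x, e (x ⊗ₜ 1) = AdjoinRoot.map (algebraMap E S) f (f.map (algebraMap E S)) dvd_rfl x) ∧
      (∀ s, e (1 ⊗ₜ s) = AdjoinRoot.of _ s) := by
  let j := AdjoinRoot.map (algebraMap E S) f (f.map (algebraMap E S)) dvd_rfl
  have hj : ∀ r : E, j (algebraMap E _ r) = algebraMap E (AdjoinRoot (f.map (algebraMap E S))) r := by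
    intro r
    change AdjoinRoot.map (algebraMap E S) f (f.map (algebraMap E S)) dvd_rfl (AdjoinRoot.of f r) = _
    rw [AdjoinRoot.map_of]; rfl
  let j' : AdjoinRoot f →ₐ[E] AdjoinRoot (f.map (algebraMap E S)) := { j with commutes' := hj }
  let g : AdjoinRoot f ⊗[E] S →ₐ[E] AdjoinRoot (f.map (algebraMap E S)) :=
    Algebra.TensorProduct.lift j' (IsScalarTower.toAlgHom E S _) (fun _ _ => Commute.all _ _)
  have hg1 : ∀ x, g (x ⊗ₜ 1) = j x := fun x => by simp [g, j']
  have hg2 : ∀ s, g (1 ⊗ₜ s) = AdjoinRoot.of _ s := fun s => by simp [g, j']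
  let h : AdjoinRoot (f.map (algebraMap E S)) →+* AdjoinRoot f ⊗[E] S :=
    AdjoinRoot.lift (Algebra.TensorProduct.includeRight : S →ₐ[E] AdjoinRoot f ⊗[E] S).toRingHom
      (AdjoinRoot.root f ⊗ₜ 1) (by
        rw [eval₂_map]
        have : ((Algebra.TensorProduct.includeRight : S →ₐ[E] AdjoinRoot f ⊗[E] S).toRingHom.comp (algebraMap E S)) =
          (Algebra.TensorProduct.includeLeft : AdjoinRoot f →ₐ[E] AdjoinRoot f ⊗[E] S).toRingHom.comp (AdjoinRoot.of f) := by
          ext x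
          exact ((Algebra.TensorProduct.includeRight : S →ₐ[E] AdjoinRoot f ⊗[E] S).commutes x).trans
            ((Algebra.TensorProduct.includeLeft : AdjoinRoot f →ₐ[E] AdjoinRoot f ⊗[E] S).commutes x).symm
        rw [this]
        change eval₂ _ ((Algebra.TensorProduct.includeLeft : AdjoinRoot f →ₐ[E] AdjoinRoot f ⊗[E] S).toRingHom _) f = 0
        rw [← hom_eval₂, AdjoinRoot.eval₂_root, map_zero])
  have h1 : ∀ x, h (g x) = x := by
    have : (h.comp g.toRingHom) = RingHom.id _ := by
      apply Algebra.TensorProduct.ringHom_ext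
      · apply AdjoinRoot.ringHom_ext
        · ext x
          change h (g (AdjoinRoot.of f x ⊗ₜ 1)) = AdjoinRoot.of f x ⊗ₜ 1
          rw [hg1]
          simp [j, h]
        · change h (g (AdjoinRoot.root f ⊗ₜ 1)) = AdjoinRoot.root f ⊗ₜ 1
          rw [hg1]; simp [j, h]
      · ext s
        change h (g (1 ⊗ₜ s)) = 1 ⊗ₜ s
        rw [hg2]; simp [h]
    exact fun x => RingHom.congr_fun this x
  have h2 : ∀ x, g (h x) = x := by
    have : (g.toRingHom.comp h) = RingHom.id _ := by
      apply AdjoinRoot.ringHom_ext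
      · ext s
        simp [h, hg2]
      · simp [h, hg1, j]
    exact fun x => RingHom.congr_fun this x
  refine ⟨{ g with invFun := h, left_inv := h1, right_inv := h2 }, hg1, hg2⟩

theorem sep_reg_aux {S : Type u} [CommRing S] [IsRegularRing S] (f : S[X]) (hf : f.Separable) : IsRegularRing (AdjoinRoot f) := by
  refine regular_hyp f (fun q hq hfq => ⟨(Polynomial.derivative' (R := S)).restrictScalars ℤ, ?_⟩)
  intro h
  obtain ⟨a, b, hab⟩ := hf
  apply hq.ne_top
  rw [Ideal.eq_top_iff_one, ← hab]
  exact add_mem (q.mul_mem_left _ hfq) (q.mul_mem_left _ h)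

theorem sep_reg {E M S : Type u} [Field E] [Field M] [Algebra E M] [Module.Finite E M] [Algebra.IsSeparable E M]
    [CommRing S] [Algebra E S] [IsRegularRing S] : IsRegularRing (M ⊗[E] S) := by
  obtain ⟨α, hα⟩ := Field.exists_primitive_element E M
  have hs : (minpoly E α).Separable := Algebra.IsSeparable.isSeparable E α
  obtain ⟨e, -⟩ := adj_tensor (S := S) (minpoly E α)
  have := sep_reg_aux ((minpoly E α).map (algebraMap E S)) hs.map
  have e1 : AdjoinRoot (minpoly E α) ≃ₐ[E] M :=
    (IntermediateField.adjoinRootEquivAdjoin E (Algebra.IsIntegral.isIntegral α)).trans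
      ((IntermediateField.equivOfEq hα).trans IntermediateField.topEquiv)
  have : IsRegularRing (AdjoinRoot (minpoly E α) ⊗[E] S) := IsRegularRing.of_ringEquiv e.symm
  exact IsRegularRing.of_ringEquiv (Algebra.TensorProduct.congr e1 (AlgEquiv.refl : S ≃ₐ[E] S)).toRingEquiv

theorem field_aux {F Ω : Type*} [Field F] [Field Ω] [IsAlgClosed Ω] [Algebra F Ω] (q : ℕ) [ExpChar F q]
    (x : Ω) (hx : IsIntegral F x) : ∃ (n : ℕ) (c : Finset Ω), (∀ y ∈ c, ∃ a : F, algebraMap F Ω a = y ^ q ^ n) ∧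
      ∀ K : Subfield Ω, (c : Set Ω) ⊆ K → IsSeparable K x := by
  have hi := minpoly.irreducible hx
  obtain ⟨g, hg, n, hgn⟩ := hi.hasSeparableContraction q
  haveI : ExpChar Ω q := expChar_of_injective_algebraMap (algebraMap F Ω).injective q
  haveI : PerfectRing Ω q := PerfectField.toPerfectRing q
  let φ := iterateFrobeniusEquiv Ω q n
  have hφ : ∀ y, φ y = y ^ q ^ n := fun y => iterateFrobeniusEquiv_def Ω q n y
  let ψ : F →+* Ω := φ.symm.toRingHom.comp (algebraMap F Ω)
  have hψ : ∀ a, ψ a ^ q ^ n = algebraMap F Ω a := fun a => by rw [← hφ]; exact φ.apply_symm_apply _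
  classical
  refine ⟨n, (g.support.image (fun i => ψ (g.coeff i))), ?_, ?_⟩
  · intro y hy
    obtain ⟨i, -, rfl⟩ := Finset.mem_image.1 hy
    exact ⟨g.coeff i, (hψ _).symm⟩
  · intro K hK
    have h0 : eval x (g.map ψ) = 0 := by
      apply φ.injective
      rw [map_zero, eval_map]
      change (φ : Ω →+* Ω) _ = 0
      rw [hom_eval₂]
      have : ((φ : Ω →+* Ω).comp ψ) = algebraMap F Ω := by
        ext a; exact φ.apply_symm_apply _
      rw [this]
      have h2 := minpoly.aeval F x
      rw [← hgn, expand_aeval, aeval_def] at h2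
      rw [← h2]; congr 1
    have hl : g.map ψ ∈ Polynomial.lifts (algebraMap K Ω) := by
      rw [Polynomial.lifts_iff_coeff_lifts]
      intro i
      by_cases hi : g.coeff i = 0
      · exact ⟨0, by simp [hi]⟩
      · refine ⟨⟨ψ (g.coeff i), hK ?_⟩, by rw [coeff_map]; rfl⟩
        simp only [Finset.coe_image, Set.mem_image, Finset.mem_coe, mem_support_iff]
        exact ⟨i, hi, rfl⟩
    obtain ⟨h, hh⟩ := (Polynomial.mem_lifts _).1 hl
    have hsep : h.Separable := by
      rw [← Polynomial.separable_map (algebraMap K Ω), hh]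
      exact hg.map
    refine hsep.of_dvd (minpoly.dvd K x ?_)
    rw [aeval_def, ← eval_map, hh, h0]

theorem field_lem {F Ω : Type*} [Field F] [Field Ω] [IsAlgClosed Ω] [Algebra F Ω] (q : ℕ) [ExpChar F q]
    (s : Finset Ω) (hs : ∀ x ∈ s, IsIntegral F x) : ∃ (n : ℕ) (c : Finset Ω), (∀ y ∈ c, ∃ a : F, algebraMap F Ω a = y ^ q ^ n) ∧
      ∀ K : Subfield Ω, (c : Set Ω) ⊆ K → ∀ x ∈ s, IsSeparable K x := by
  classical
  induction s using Finset.induction_on with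
  | empty => exact ⟨0, ∅, by simp, by simp⟩
  | insert x s _ ih =>
    obtain ⟨n, c, h1, h2⟩ := ih (fun y hy => hs y (Finset.mem_insert_of_mem hy))
    obtain ⟨m, d, h3, h4⟩ := field_aux q x (hs x (Finset.mem_insert_self _ _))
    refine ⟨n + m, c ∪ d, ?_, ?_⟩
    · intro y hy
      rcases Finset.mem_union.1 hy with hy | hy
      · obtain ⟨a, ha⟩ := h1 y hy
        exact ⟨a ^ q ^ m, by rw [map_pow, ha, ← pow_mul, pow_add]⟩
      · obtain ⟨a, ha⟩ := h3 y hy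
        exact ⟨a ^ q ^ n, by rw [map_pow, ha, ← pow_mul, pow_add, mul_comm]⟩
    · intro K hK y hy
      rcases Finset.mem_insert.1 hy with rfl | hy
      · exact h4 K (fun z hz => hK (by simp at hz ⊢; exact Or.inr hz))
      · exact h2 K (fun z hz => hK (by simp at hz ⊢; exact Or.inl hz)) y hy


def cd {A : Type*} [CommRing A] (D : Derivation ℤ A A) : Derivation ℤ A[X] A[X] :=
  letI : Differential A := ⟨D⟩
  Differential.mapCoeffs

theorem cd_coeff {A : Type*} [CommRing A] (D : Derivation ℤ A A) (P : A[X]) (i : ℕ) : (cd D P).coeff i = D (P.coeff i) := by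
  letI : Differential A := ⟨D⟩
  exact Differential.coeff_mapCoeffs P i

theorem cd_C {A : Type*} [CommRing A] (D : Derivation ℤ A A) (a : A) : cd D (C a) = C (D a) := by
  letI : Differential A := ⟨D⟩
  exact Differential.mapCoeffs_C a

theorem cd_X {A : Type*} [CommRing A] (D : Derivation ℤ A A) : cd D X = 0 := by
  letI : Differential A := ⟨D⟩
  exact Differential.mapCoeffs_X

theorem cd_XC {A : Type*} [CommRing A] (D : Derivation ℤ A A) (a : A) (n : ℕ) : cd D (X ^ n - C a) = - C (D a) := by
  rw [map_sub, cd_C, Derivation.leibniz_pow, cd_X]; simp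

theorem cd_map {A B : Type*} [CommRing A] [CommRing B] (j : A →+* B) (D : Derivation ℤ A A) (D' : Derivation ℤ B B)
    (h : ∀ e, D' (j e) = j (D e)) (P : A[X]) : cd D' (P.map j) = (cd D P).map j := by
  ext i
  simp [cd_coeff, h]

theorem adj_der {A : Type*} [CommRing A] (f : A[X]) (d : Derivation ℤ A[X] A[X]) (h : d f = 0) :
    ∃ d' : Derivation ℤ (AdjoinRoot f) (AdjoinRoot f), ∀ P, d' (AdjoinRoot.mk f P) = AdjoinRoot.mk f (d P) := by
  have hs : Function.Surjective ((AdjoinRoot.mk f).toIntAlgHom) := AdjoinRoot.mk_surjective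
  have hd : ∀ x, (AdjoinRoot.mk f).toIntAlgHom x = 0 → (AdjoinRoot.mk f).toIntAlgHom (d x) = 0 := by
    intro x hx
    obtain ⟨y, rfl⟩ := AdjoinRoot.mk_eq_zero.1 hx
    refine AdjoinRoot.mk_eq_zero.2 ?_
    rw [d.leibniz, h]; simp
  exact ⟨Derivation.liftOfSurjective hs hd, fun P => Derivation.liftOfSurjective_apply hs hd P⟩

theorem der_iter {A : Type*} [CommRing A] (D : Derivation ℤ A A) (n : ℕ) (a b : A) :
    D^[n] (a * b) = ∑ ij ∈ Finset.HasAntidiagonal.antidiagonal n, n.choose ij.1 • (D^[ij.1] a * D^[ij.2] b) := by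
  induction n with
  | zero => simp
  | succ n ih =>
    rw [Finset.sum_antidiagonal_choose_succ_nsmul (M := A) (fun i j => D^[i] a * D^[j] b) n,
      Function.iterate_succ_apply', ih, map_sum, ← Finset.sum_add_distrib]
    refine Finset.sum_congr rfl fun ij hij => ?_
    rw [← n.choose_symm_of_eq_add (Finset.HasAntidiagonal.mem_antidiagonal.1 hij).symm, map_nsmul, D.leibniz, Function.iterate_succ_apply', Function.iterate_succ_apply']
    simp only [smul_eq_mul, nsmul_eq_mul]
    ring

theorem der_pow {A : Type*} [CommRing A] (D : Derivation ℤ A A) (p : ℕ) (hp : p.Prime) (h0 : (p : A) = 0) :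
    ∃ D' : Derivation ℤ A A, ∀ x, D' x = D^[p] x := by
  have hlin : ∀ x, ((D : A →ₗ[ℤ] A) ^ p) x = D^[p] x := fun x => by rw [Module.End.pow_apply]; rfl
  refine ⟨Derivation.mk' ((D : A →ₗ[ℤ] A) ^ p) ?_, fun x => hlin x⟩
  intro a b
  rw [hlin, hlin, hlin, der_iter]
  obtain ⟨n, rfl⟩ : ∃ n, p = n + 1 := ⟨p - 1, by have := hp.pos; omega⟩
  have hn : n ≠ 0 := by rintro rfl; exact hp.ne_one rfl
  rw [Finset.sum_eq_add_of_mem (0, n+1) (n+1, 0) (by simp) (by simp) (by simp)]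
  · simp [mul_comm]
  · rintro ⟨i, k⟩ h ⟨h1, h2⟩
    rw [Finset.HasAntidiagonal.mem_antidiagonal] at h
    have hi : i ≠ 0 := by rintro rfl; exact h1 (by simp at h ⊢; omega)
    have hi2 : i ≠ n + 1 := by rintro rfl; exact h2 (by simp at h ⊢; omega)
    obtain ⟨c, hc⟩ := hp.dvd_choose_self hi (by simp at h; omega)
    rw [hc, nsmul_eq_mul, Nat.cast_mul, h0]; simp

def Cp {E S : Type*} [CommRing E] [CommRing S] (j : E →+* S) (D : Derivation ℤ E E) : Prop :=
  ∃ D' : Derivation ℤ S S, ∀ e, D' (j e) = j (D e)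

def PP (q : ℕ) {E S : Type*} [CommRing E] [CommRing S] (j : E →+* S) : Prop :=
  ∀ a : E, (∀ b, b ^ q ≠ a) → ∃ D : Derivation ℤ E E, Cp j D ∧ D a ≠ 0

section
variable {E S : Type*} [CommRing E] [CommRing S] {j : E →+* S}

theorem Cp.smul {D : Derivation ℤ E E} (h : Cp j D) (c : E) : Cp j (c • D) := by
  obtain ⟨D', h⟩ := h
  exact ⟨j c • D', fun e => by simp [h]⟩

theorem Cp.sub {D D2 : Derivation ℤ E E} (h : Cp j D) (h2 : Cp j D2) : Cp j (D - D2) := by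
  obtain ⟨D', h⟩ := h
  obtain ⟨D2', h2⟩ := h2
  exact ⟨D' - D2', fun e => by simp [h, h2]⟩

theorem Cp.lie {D D2 : Derivation ℤ E E} (h : Cp j D) (h2 : Cp j D2) : Cp j ⁅D, D2⁆ := by
  obtain ⟨D', h⟩ := h
  obtain ⟨D2', h2⟩ := h2
  exact ⟨⁅D', D2'⁆, fun e => by simp [Derivation.commutator_apply, h, h2]⟩

theorem Cp.pow {D : Derivation ℤ E E} (h : Cp j D) (p : ℕ) (hp : p.Prime) (h0 : (p : E) = 0) :
    ∃ D2 : Derivation ℤ E E, Cp j D2 ∧ ∀ x, D2 x = D^[p] x := by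
  obtain ⟨D', h⟩ := h
  obtain ⟨D2, h2⟩ := der_pow D p hp h0
  obtain ⟨D2', h2'⟩ := der_pow D' p hp (by rw [← map_natCast j, h0, map_zero])
  refine ⟨D2, ⟨D2', fun e => ?_⟩, h2⟩
  rw [h2, h2']
  have : Function.Semiconj j D D' := fun x => (h x).symm
  exact ((this.iterate_right p) e).symm
end

theorem const_lemma {E S : Type*} [Field E] [CommRing S] {j : E →+* S} (p : ℕ) (hp : p.Prime) [CharP E p]
    (h : PP p j) (a : E) (ha : ∀ b, b ^ p ≠ a) (g : E) (hg : ∀ D, Cp j D → D a = 0 → D g = 0) :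
    ∃ c : ℕ → E, g = ∑ i ∈ Finset.range p, c i ^ p * a ^ i := by
  have hp0 : (p : E) = 0 := CharP.cast_eq_zero E p
  obtain ⟨D1, hD1, hD1a⟩ := h a ha
  obtain ⟨D0, hD0, hD0a⟩ : ∃ D0 : Derivation ℤ E E, Cp j D0 ∧ D0 a = 1 :=
    ⟨(D1 a)⁻¹ • D1, hD1.smul _, by simp [hD1a]⟩
  let K : E → Prop := fun g => ∀ D, Cp j D → D a = 0 → D g = 0
  have hKD : ∀ g, K g → K (D0 g) := by
    intro g hg D hD hDa
    have := hg _ (hD.lie hD0) (by rw [Derivation.commutator_apply, hD0a, hDa]; simp)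
    rwa [Derivation.commutator_apply, hg D hD hDa, map_zero, sub_zero] at this
  have hKit : ∀ n g, K g → K (D0^[n] g) := by
    intro n; induction n with
    | zero => intro g hg; exact hg
    | succ n ih => intro g hg; exact ih _ (hKD g hg)
  have hKp : ∀ g, K g → D0 g = 0 → ∃ c, c ^ p = g := by
    intro g hg hg0
    by_contra hne
    push Not at hne
    obtain ⟨D, hD, hDg⟩ := h g hne
    apply hDg
    have := hg _ (hD.sub (hD0.smul (D a))) (by simp [hD0a])
    simpa [hg0] using this
  have hDp : ∀ c : E, D0 (c ^ p) = 0 := fun c => by rw [Derivation.leibniz_pow, ← Nat.cast_smul_eq_nsmul E, hp0, zero_smul]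
  have hmul : ∀ c x : E, D0 (c ^ p * x) = c ^ p * D0 x := fun c x => by rw [D0.leibniz, hDp]; simp
  have key : ∀ n ≤ p, ∀ g, K g → D0^[n] g = 0 → ∃ c : ℕ → E, g = ∑ i ∈ Finset.range n, c i ^ p * a ^ i := by
    intro n
    induction n with
    | zero => intro _ g _ hg0; exact ⟨0, by simpa using hg0⟩
    | succ n ih =>
      intro hn g hg hg0
      rw [Function.iterate_succ_apply'] at hg0
      obtain ⟨c, hc⟩ := hKp _ (hKit n g hg) hg0
      have hfac : ((n.factorial : ℕ) : E) ≠ 0 := by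
        rw [Ne, CharP.cast_eq_zero_iff E p, hp.dvd_factorial]; omega
      have hit : ∀ m k : ℕ, ∀ c : E, D0^[m] (c ^ p * a ^ (m + k)) = c ^ p * ((m+k).descFactorial m : ℕ) * a ^ k := by
        intro m
        induction m with
        | zero => intro k c; simp
        | succ m ihm =>
          intro k c
          rw [Function.iterate_succ_apply', show m + 1 + k = m + (k + 1) by ring, ihm, mul_assoc, hmul, D0.leibniz, D0.leibniz_pow, hD0a,
            Derivation.map_natCast, Nat.descFactorial_succ, show m + (k+1) - m = k+1 by omega]
          simp; ring
      obtain ⟨b, hb⟩ : ∃ b : E, b ^ p * (n.factorial : ℕ) = 1 := by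
        haveI : Fact p.Prime := ⟨hp⟩
        refine ⟨((n.factorial : ℕ) : E)⁻¹, ?_⟩
        have : ((n.factorial : ℕ) : E) ^ p = (n.factorial : ℕ) := by
          rw [← frobenius_def, map_natCast]
        rw [inv_pow, this, inv_mul_cancel₀ hfac]
      have hK2 : K (g - (c * b) ^ p * a ^ n) := by
        intro D hD hDa
        rw [map_sub, hg D hD hDa, D.leibniz, D.leibniz_pow, D.leibniz_pow, hDa, ← Nat.cast_smul_eq_nsmul E p, hp0]
        simp
      obtain ⟨c', hc'⟩ := ih (by omega) _ hK2 (by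
        have hs : ∀ x y : E, D0^[n] (x - y) = D0^[n] x - D0^[n] y := fun x y => by
          exact iterate_map_sub D0 n x y
        have h3 := hit n 0 (c * b)
        rw [Nat.add_zero] at h3
        rw [hs, h3, ← hc, Nat.descFactorial_self, pow_zero, mul_pow]
        linear_combination (-c ^ p) * hb)
      refine ⟨fun i => if i = n then c * b else c' i, ?_⟩
      rw [Finset.sum_range_succ]
      beta_reduce
      rw [if_pos rfl, Finset.sum_congr rfl (g := fun i => c' i ^ p * a ^ i) (fun i hi => by
        rw [if_neg (Finset.mem_range.1 hi).ne]), ← hc']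
      ring
  refine key p le_rfl g hg ?_
  obtain ⟨D2, hD2, hD2e⟩ := hD0.pow p hp hp0
  rw [← hD2e]
  apply hg D2 hD2
  rw [hD2e]
  obtain ⟨m, rfl⟩ : ∃ m, p = m + 2 := ⟨p - 2, by have := hp.two_le; omega⟩
  rw [Function.iterate_succ_apply, Function.iterate_succ_apply, hD0a, D0.map_one_eq_zero]
  exact iterate_map_zero D0 m


theorem pp_reg {E S : Type u} [Field E] [CommRing S] [IsRegularRing S] {j : E →+* S} (p : ℕ)
    (h : PP p j) (a : E) (ha : ∀ b, b ^ p ≠ a) : IsRegularRing (AdjoinRoot ((X ^ p - C a : E[X]).map j)) := by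
  obtain ⟨D, ⟨D', hD⟩, hDa⟩ := h a ha
  refine regular_hyp _ (fun q hq _ => ⟨cd D', ?_⟩)
  intro hmem
  apply hq.ne_top
  have h1 : (X ^ p - C a : E[X]).map j = X ^ p - C (j a) := by simp
  have h2 : cd D' ((X ^ p - C a : E[X]).map j) = - C (j (D a)) := by rw [h1, cd_XC, hD]
  have h3 : IsUnit (cd D' ((X ^ p - C a : E[X]).map j)) := by
    rw [h2, IsUnit.neg_iff]
    exact ((IsUnit.mk0 _ hDa).map j).map C
  exact Ideal.eq_top_of_isUnit_mem _ hmem h3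

theorem pp_step {E S : Type*} [Field E] [CommRing S] {j : E →+* S} (p : ℕ) (hp : p.Prime) [CharP E p]
    (h : PP p j) (a : E) (ha : ∀ b, b ^ p ≠ a) :
    PP p (AdjoinRoot.map j (X ^ p - C a : E[X]) ((X ^ p - C a : E[X]).map j) dvd_rfl) := by
  haveI : Fact p.Prime := ⟨hp⟩
  have hp0 : (p : E) = 0 := CharP.cast_eq_zero E p
  have hpS : (p : S) = 0 := by rw [← map_natCast j, hp0, map_zero]
  have hirr : Irreducible (X ^ p - C a : E[X]) := X_pow_sub_C_irreducible_of_prime hp ha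
  haveI : Fact (Irreducible (X ^ p - C a : E[X])) := ⟨hirr⟩
  have hmon : (X ^ p - C a : E[X]).Monic := monic_X_pow_sub_C a hp.ne_zero
  have hm : (X ^ p - C a : E[X]).map j = X ^ p - C (j a) := by simp
  have gen : ∀ (d : Derivation ℤ E[X] E[X]) (d' : Derivation ℤ S[X] S[X]), (∀ P, d' (P.map j) = (d P).map j) →
      d (X ^ p - C a) = 0 → ∃ D : Derivation ℤ (AdjoinRoot (X ^ p - C a)) (AdjoinRoot (X ^ p - C a)),
        Cp (AdjoinRoot.map j (X ^ p - C a : E[X]) ((X ^ p - C a : E[X]).map j) dvd_rfl) D ∧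
        ∀ P, D (AdjoinRoot.mk _ P) = AdjoinRoot.mk _ (d P) := by
    intro d d' hdd hd
    obtain ⟨D, hD⟩ := adj_der _ d hd
    obtain ⟨D', hD'⟩ := adj_der ((X ^ p - C a : E[X]).map j) d' (by rw [hdd, hd, Polynomial.map_zero])
    refine ⟨D, ⟨D', ?_⟩, hD⟩
    have hmk : ∀ P, AdjoinRoot.map j (X ^ p - C a : E[X]) ((X ^ p - C a : E[X]).map j) dvd_rfl (AdjoinRoot.mk _ P) =
        AdjoinRoot.mk _ (P.map j) := by
      intro P
      induction P using Polynomial.induction_on' with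
      | add P Q hP hQ => simp only [map_add, hP, hQ, Polynomial.map_add]
      | monomial n c =>
        rw [← C_mul_X_pow_eq_monomial, Polynomial.map_mul, Polynomial.map_pow, Polynomial.map_C, Polynomial.map_X]
        simp only [map_mul, map_pow, AdjoinRoot.mk_C, AdjoinRoot.mk_X, AdjoinRoot.map_of, AdjoinRoot.map_root]
    intro e
    obtain ⟨P, rfl⟩ := AdjoinRoot.mk_surjective e
    have h1 : _ = _ := hD' (P.map j)
    have h2 : _ = _ := hD P
    rw [hdd, ← hmk, ← hmk, ← h2] at h1
    exact h1
  intro g hg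
  obtain ⟨P, rfl⟩ := AdjoinRoot.mk_surjective g
  obtain ⟨P, hdeg, hP⟩ : ∃ Q : E[X], Q.natDegree < p ∧ AdjoinRoot.mk (X ^ p - C a) P = AdjoinRoot.mk (X ^ p - C a) Q := by
    refine ⟨P %ₘ (X ^ p - C a), ?_, ?_⟩
    · have := natDegree_modByMonic_lt P hmon (by intro h; have := congrArg natDegree h; rw [natDegree_X_pow_sub_C] at this; simp at this; exact hp.ne_zero this)
      rwa [natDegree_X_pow_sub_C] at this
    · rw [AdjoinRoot.mk_eq_mk]
      exact ⟨P /ₘ (X ^ p - C a), by linear_combination - modByMonic_add_div P (X ^ p - C a)⟩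
  rw [hP] at hg ⊢
  by_cases hder : derivative P = 0
  · have hPC : P = C (P.coeff 0) := by
      have h1 := expand_contract p hder hp.ne_zero
      have h2 := natDegree_expand p (contract p P)
      rw [h1] at h2
      have h3 : (contract p P).natDegree = 0 := by
        by_contra h3
        have : p ≤ (contract p P).natDegree * p := Nat.le_mul_of_pos_left _ (Nat.pos_of_ne_zero h3)
        omega
      exact eq_C_of_natDegree_eq_zero (by rw [h2, h3]; simp)
    rw [hPC] at hg ⊢
    set g := P.coeff 0
    have hnot : ¬ ∀ D, Cp j D → D a = 0 → D g = 0 := by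
      intro hall
      obtain ⟨c, hc⟩ := const_lemma p hp h a ha g hall
      haveI : CharP (AdjoinRoot (X ^ p - C a)) p := charP_of_injective_algebraMap (algebraMap E _).injective p
      apply hg (AdjoinRoot.mk _ (∑ i ∈ Finset.range p, C (c i) * X ^ i))
      have hr : AdjoinRoot.root (X ^ p - C a) ^ p = AdjoinRoot.of _ a := by
        have := AdjoinRoot.mk_self (f := X ^ p - C a)
        rw [map_sub, sub_eq_zero, map_pow] at this
        exact this
      rw [map_sum, sum_pow_char]
      simp only [map_mul, map_pow, AdjoinRoot.mk_C, AdjoinRoot.mk_X]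
      rw [hc, map_sum]
      refine Finset.sum_congr rfl fun i _ => ?_
      rw [mul_pow, ← pow_mul, mul_comm i p, pow_mul, hr, map_mul, map_pow, map_pow]
    push Not at hnot
    obtain ⟨D, ⟨D', hD⟩, hDa, hDg⟩ := hnot
    obtain ⟨D2, h2, h3⟩ := gen (cd D) (cd D') (cd_map j D D' hD) (by rw [cd_XC, hDa]; simp)
    refine ⟨D2, h2, ?_⟩
    rw [h3, cd_C]
    intro h0
    apply hDg
    apply (AdjoinRoot.of (X ^ p - C a)).injective
    rw [map_zero, ← h0]; rfl
  · obtain ⟨D2, h2, h3⟩ := gen ((Polynomial.derivative' (R := E)).restrictScalars ℤ) ((Polynomial.derivative' (R := S)).restrictScalars ℤ)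
      (fun P => derivative_map P j) (by change derivative (X ^ p - C a) = 0; rw [derivative_sub, derivative_X_pow, hp0]; simp)
    refine ⟨D2, h2, ?_⟩
    rw [h3]
    intro h0
    rw [AdjoinRoot.mk_eq_zero] at h0
    apply hder
    refine eq_zero_of_dvd_of_natDegree_lt h0 ?_
    rw [natDegree_X_pow_sub_C]
    exact (natDegree_derivative_le P).trans_lt (by omega)

theorem insep_reg (p : ℕ) (hp : p.Prime) (n : ℕ) : ∀ (E S L : Type u) [Field E] [Field L] [CommRing S] [Algebra E S]
    [Algebra E L] [CharP E p] [IsRegularRing S] [Module.Finite E L] (_ : PP p (algebraMap E S))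
    (_ : ∀ x : L, ∃ m, ∃ a, algebraMap E L a = x ^ p ^ m) (_ : Module.finrank E L = n), IsRegularRing (L ⊗[E] S) := by
  induction n using Nat.strong_induction_on with
  | _ n ih =>
  intro E S L _ _ _ _ _ _ _ _ hPP hL hn
  by_cases hsurj : Function.Surjective (algebraMap E L)
  · let e : E ≃ₐ[E] L := AlgEquiv.ofBijective (Algebra.ofId E L) ⟨(algebraMap E L).injective, hsurj⟩
    exact IsRegularRing.of_ringEquiv ((Algebra.TensorProduct.lid E S).symm.trans (Algebra.TensorProduct.congr e AlgEquiv.refl)).toRingEquiv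
  · haveI : Fact p.Prime := ⟨hp⟩
    haveI : CharP L p := charP_of_injective_algebraMap (algebraMap E L).injective p
    obtain ⟨x, a, hx, hxa⟩ : ∃ (x : L) (a : E), (∀ b, algebraMap E L b ≠ x) ∧ algebraMap E L a = x ^ p := by
      simp only [Function.Surjective, not_forall, not_exists] at hsurj
      obtain ⟨y, hy⟩ := hsurj
      classical
      have hex := hL y
      let m := Nat.find hex
      have hm := Nat.find_spec hex
      have hm0 : m ≠ 0 := by
        intro h0
        obtain ⟨a, ha⟩ := hm
        change algebraMap E L a = y ^ p ^ m at ha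
        rw [h0] at ha
        exact hy a (by simpa using ha)
      obtain ⟨k, hk⟩ := Nat.exists_eq_succ_of_ne_zero hm0
      have hk' := Nat.find_min hex (m := k) (by omega)
      push Not at hk'
      obtain ⟨a, ha⟩ := hm
      refine ⟨y ^ p ^ k, a, hk', ?_⟩
      rw [ha, ← pow_mul, ← pow_succ]
      congr 2
    have ha : ∀ b, b ^ p ≠ a := by
      rintro b rfl
      apply hx b
      apply frobenius_inj L p
      rw [frobenius_def, frobenius_def, ← hxa, map_pow]
    have hirr : Irreducible (X ^ p - C a : E[X]) := X_pow_sub_C_irreducible_of_prime hp ha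
    haveI : Fact (Irreducible (X ^ p - C a : E[X])) := ⟨hirr⟩
    let E1 := AdjoinRoot (X ^ p - C a : E[X])
    let S1 := AdjoinRoot ((X ^ p - C a : E[X]).map (algebraMap E S))
    letI : Algebra E1 S1 := (AdjoinRoot.map (algebraMap E S) (X ^ p - C a : E[X]) ((X ^ p - C a : E[X]).map (algebraMap E S)) dvd_rfl).toAlgebra
    haveI : IsRegularRing S1 := pp_reg p hPP a ha
    have hPP1 : PP p (algebraMap E1 S1) := pp_step p hp hPP a ha
    let l : E1 →+* L := AdjoinRoot.lift (algebraMap E L) x (by simp [hxa])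
    letI : Algebra E1 L := l.toAlgebra
    haveI : IsScalarTower E E1 L := IsScalarTower.of_algebraMap_eq (fun r => by
      change _ = l (AdjoinRoot.of _ r); exact (AdjoinRoot.lift_of _).symm)
    haveI : Module.Finite E1 L := Module.Finite.of_restrictScalars_finite E E1 L
    haveI : CharP E1 p := charP_of_injective_algebraMap (algebraMap E E1).injective p
    have hfin : Module.finrank E E1 = p := by
      have := (AdjoinRoot.powerBasis (hirr.ne_zero)).finrank
      rw [this, AdjoinRoot.powerBasis_dim, natDegree_X_pow_sub_C]
    haveI : Module.Finite E E1 := Module.Finite.of_basis (AdjoinRoot.powerBasis (hirr.ne_zero)).basis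
    have hlt : Module.finrank E1 L < n := by
      have h1 := Module.finrank_mul_finrank E E1 L
      rw [hfin, hn] at h1
      have h2 : 0 < Module.finrank E1 L := Module.finrank_pos
      have := hp.two_le
      nlinarith
    have hreg := ih _ hlt E1 S1 L hPP1 (fun y => by
      obtain ⟨m, b, hb⟩ := hL y
      exact ⟨m, algebraMap E E1 b, by rw [← IsScalarTower.algebraMap_apply, hb]⟩) rfl
    obtain ⟨e, he, -⟩ := adj_tensor (S := S) (X ^ p - C a : E[X])
    let e' : E1 ⊗[E] S ≃ₐ[E1] S1 := AlgEquiv.ofRingEquiv (f := e) (fun r => he r)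
    exact IsRegularRing.of_ringEquiv ((Algebra.TensorProduct.congr (AlgEquiv.refl : L ≃ₐ[E1] L) e').toRingEquiv.symm.trans
      (Algebra.TensorProduct.cancelBaseChange E E1 L L S).toRingEquiv)


theorem ff_bc (L R M : Type*) [Field L] [CommRing R] [Field M] [Algebra L R] [Algebra L M] : Module.FaithfullyFlat R (R ⊗[L] M) :=
  inferInstance

theorem sep_down (A S L K Ω : Type u) [CommRing A] [CommRing S] [Field L] [Field K] [Field Ω] [Algebra A S] [Algebra A L]
    [Algebra A K] [Algebra A Ω] [Algebra L Ω] [Algebra K Ω] [IsScalarTower A L Ω] [IsScalarTower A K Ω]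
    (hreg : IsRegularRing (K ⊗[A] S)) (hN : IsNoetherianRing (L ⊗[A] S)) (s : Finset Ω) (hs : ∀ x ∈ s, IsSeparable K x)
    (hsL : ∀ x, algebraMap L Ω x ∈ IntermediateField.adjoin K (s : Set Ω)) : IsRegularRing (L ⊗[A] S) := by
  let M := IntermediateField.adjoin K (s : Set Ω)
  letI : Algebra L M := ((algebraMap L Ω).codRestrict M hsL).toAlgebra
  haveI : IsScalarTower L M Ω := IsScalarTower.of_algebraMap_eq (fun r => rfl)
  haveI : IsScalarTower A M Ω := IsScalarTower.of_algebraMap_eq (fun r => by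
    rw [IsScalarTower.algebraMap_apply A K Ω, IsScalarTower.algebraMap_apply A K M, ← IsScalarTower.algebraMap_apply K M Ω])
  haveI : IsScalarTower A L M := IsScalarTower.of_algebraMap_eq (fun r => by
    apply (algebraMap M Ω).injective
    rw [← IsScalarTower.algebraMap_apply A M Ω, ← IsScalarTower.algebraMap_apply L M Ω, ← IsScalarTower.algebraMap_apply A L Ω])
  haveI : FiniteDimensional K M := IntermediateField.finiteDimensional_adjoin (fun x hx => (hs x hx).isIntegral)
  haveI : Algebra.IsSeparable K M := (IntermediateField.isSeparable_adjoin_iff_isSeparable K Ω).2 hs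
  have h1 : IsRegularRing (M ⊗[K] (K ⊗[A] S)) := sep_reg
  have h2 : IsRegularRing (M ⊗[L] (L ⊗[A] S)) := IsRegularRing.of_ringEquiv
    ((Algebra.TensorProduct.cancelBaseChange A K M M S).toRingEquiv.trans (Algebra.TensorProduct.cancelBaseChange A L M M S).toRingEquiv.symm)
  have h3 : IsRegularRing ((L ⊗[A] S) ⊗[L] M) := IsRegularRing.of_ringEquiv (Algebra.TensorProduct.comm L M (L ⊗[A] S)).toRingEquiv
  haveI : Module.FaithfullyFlat (L ⊗[A] S) ((L ⊗[A] S) ⊗[L] M) := ff_bc _ _ _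
  exact reg_ffdesc (A := L ⊗[A] S) (B := (L ⊗[A] S) ⊗[L] M)

theorem claim {K S L : Type u} [Field K] [Field L] [CommRing S] [Algebra K S] [Algebra K L] [IsRegularRing S]
    [Module.Finite K L] (q : ℕ) [hq : ExpChar K q] (h : PP q (algebraMap K S)) : IsRegularRing (L ⊗[K] S) := by
  let Ω := AlgebraicClosure L
  classical
  let b := Module.finBasis K L
  let s : Finset Ω := Finset.univ.image (fun i => algebraMap L Ω (b i))
  obtain ⟨n, c, hc, hsep⟩ := field_lem (F := K) (Ω := Ω) q s (fun x hx => Algebra.IsIntegral.isIntegral x)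
  let K' := IntermediateField.adjoin K (c : Set Ω)
  haveI : FiniteDimensional K K' := IntermediateField.finiteDimensional_adjoin (fun x hx => Algebra.IsIntegral.isIntegral x)
  have hreg : IsRegularRing (K' ⊗[K] S) := by
    rcases hq with _ | hp
    · have : K' = ⊥ := by
        rw [IntermediateField.adjoin_eq_bot_iff]
        intro y hy
        obtain ⟨a, ha⟩ := hc y hy
        exact ⟨a, by simpa using ha⟩
      exact IsRegularRing.of_ringEquiv ((Algebra.TensorProduct.lid K S).symm.trans (Algebra.TensorProduct.congr
        ((IntermediateField.botEquiv K Ω).symm.trans (IntermediateField.equivOfEq this.symm)) AlgEquiv.refl)).toRingEquiv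
    · haveI : ExpChar K q := ExpChar.prime hp
      have h1 : IsPurelyInseparable K K' := (IntermediateField.isPurelyInseparable_adjoin_iff_pow_mem K Ω q).2
        (fun x hx => ⟨n, by obtain ⟨a, ha⟩ := hc x hx; exact ⟨a, ha⟩⟩)
      have h2 := (isPurelyInseparable_iff_pow_mem K q).1 h1
      exact insep_reg q hp _ K S K' h (fun x => by obtain ⟨m, a, ha⟩ := h2 x; exact ⟨m, a, ha⟩) rfl
  have hN : IsNoetherianRing (L ⊗[K] S) := by
    haveI : IsNoetherianRing (S ⊗[K] L) := IsNoetherianRing.of_finite S _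
    exact isNoetherianRing_of_ringEquiv (S ⊗[K] L) (Algebra.TensorProduct.comm K S L).toRingEquiv
  refine sep_down K S L K' Ω hreg hN s (fun x hx => hsep K'.toSubfield (IntermediateField.subset_adjoin _ _) x hx) ?_
  intro x
  rw [← b.sum_repr x, map_sum]
  refine sum_mem fun i _ => ?_
  rw [Algebra.smul_def, map_mul]
  refine mul_mem ?_ (IntermediateField.subset_adjoin _ _ (by simp [s]))
  rw [← IsScalarTower.algebraMap_apply, IsScalarTower.algebraMap_apply K K' Ω]
  exact IntermediateField.algebraMap_mem _ _


theorem IsLoc.bc {A X Y S : Type*} [CommRing A] [CommRing X] [CommRing Y] [CommRing S] [Algebra A X] [Algebra A Y] [Algebra X Y]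
    [IsScalarTower A X Y] [Algebra A S] (h : IsLoc (algebraMap X Y)) : ∃ f : X ⊗[A] S →+* Y ⊗[A] S, IsLoc f := by
  haveI : IsLocalization ((IsUnit.submonoid Y).comap (algebraMap X Y)) Y := by
    have := h.isLocalization
    convert this
    ext x y
    exact Algebra.smul_def x y
  have h1 := IsLoc.of_isLocalization (Y := (X ⊗[A] S) ⊗[X] Y) (Algebra.algebraMapSubmonoid (X ⊗[A] S) ((IsUnit.submonoid Y).comap (algebraMap X Y)))
  have h2 := IsLoc.of_equiv ((Algebra.TensorProduct.comm X (X ⊗[A] S) Y).toRingEquiv.trans (Algebra.TensorProduct.cancelBaseChange A X Y Y S).toRingEquiv)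
  exact ⟨_, h2.comp h1⟩

theorem FinRes.ess {B L : Type*} [CommRing B] [Field L] [Algebra B L] (h : FinRes B L) : Algebra.EssFiniteType B L := by
  letI : Algebra B (Kf B L) := ((algebraMap B L).codRestrict (Kf B L) (fun x => Subfield.subset_closure ⟨x, rfl⟩)).toAlgebra
  haveI : IsScalarTower B (Kf B L) L := IsScalarTower.of_algebraMap_eq (fun r => rfl)
  haveI : Algebra.EssFiniteType B (Kf B L) := by
    rw [Algebra.essFiniteType_iff]
    refine ⟨∅, fun s => ?_⟩
    obtain ⟨a, b, hb, hs⟩ := mem_Kf.1 s.2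
    have hb' : algebraMap B (Kf B L) b ≠ 0 := fun h => hb (congrArg Subtype.val h)
    refine ⟨algebraMap _ _ b, Subalgebra.algebraMap_mem _ _, IsUnit.mk0 _ hb', ?_⟩
    have : s * algebraMap B (Kf B L) b = algebraMap B (Kf B L) a := by
      apply Subtype.ext
      change (s : L) * algebraMap B L b = algebraMap B L a
      rw [hs, div_mul_cancel₀ _ hb]
    rw [this]
    exact Subalgebra.algebraMap_mem _ _
  haveI : Module.Finite (Kf B L) L := h
  exact Algebra.EssFiniteType.comp B (Kf B L) L

theorem ess_noeth (A L S : Type*) [CommRing A] [CommRing L] [CommRing S] [Algebra A L] [Algebra A S] [Algebra.EssFiniteType A L]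
    [IsNoetherianRing S] : IsNoetherianRing (L ⊗[A] S) := by
  haveI : IsNoetherianRing (S ⊗[A] L) := Algebra.EssFiniteType.isNoetherianRing S _
  exact isNoetherianRing_of_ringEquiv (S ⊗[A] L) (Algebra.TensorProduct.comm A S L).toRingEquiv

theorem finRes_sub {A K' Ω : Type*} [CommRing A] [Field K'] [Field Ω] [Algebra A K'] [Algebra A Ω] [Algebra K' Ω] [IsScalarTower A K' Ω]
   (K : Subfield Ω) [Algebra K K'] [IsScalarTower K K' Ω] (hK : K = Kf A Ω) [Module.Finite K K'] : FinRes A K' := by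
  refine fin_of_range_le (F1 := K) (fun x => ?_)
  obtain ⟨a, b, hb, hx⟩ := mem_Kf.1 (show (x : Ω) ∈ Kf A Ω by rw [← hK]; exact x.2)
  refine ⟨⟨algebraMap K K' x, mem_Kf.2 ⟨a, b, ?_, ?_⟩⟩, rfl⟩
  · intro h
    rw [IsScalarTower.algebraMap_apply A K' Ω, h, map_zero] at hb
    exact hb rfl
  · apply (algebraMap K' Ω).injective
    rw [map_div₀, ← IsScalarTower.algebraMap_apply, ← IsScalarTower.algebraMap_apply, ← IsScalarTower.algebraMap_apply]
    exact hx

theorem trans_fib {A S E K : Type u} [CommRing A] [CommRing S] [Algebra A S] [Field E] [Field K] [Algebra A E] [Algebra E K] [Algebra A K]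
    [IsScalarTower A E K] (τ : K) (hτ : Transcendental E τ) (hK : ∀ x : K, ∃ r s : E[X], x = aeval τ r / aeval τ s)
    [IsRegularRing (E ⊗[A] S)] : IsRegularRing (K ⊗[A] S) := by
  have hinj := transcendental_iff_injective.1 hτ
  letI : Algebra E[X] K := (aeval τ : E[X] →ₐ[E] K).toRingHom.toAlgebra
  have hloc : IsLoc (algebraMap E[X] K) := by
    refine ⟨fun y => ?_, fun x hx => ⟨1, by simp, ?_⟩⟩
    · obtain ⟨r, s, rfl⟩ := hK y
      by_cases hs : aeval τ s = 0
      · exact ⟨0, 1, by simp, by simp [hs]⟩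
      · exact ⟨r, s, IsUnit.mk0 _ hs, div_mul_cancel₀ _ hs⟩
    · rw [one_mul]
      exact hinj (hx.trans (map_zero _).symm)
  haveI : IsScalarTower A E[X] K := IsScalarTower.of_algebraMap_eq (fun r => by
    change _ = aeval τ (algebraMap A E[X] r)
    rw [IsScalarTower.algebraMap_apply A E E[X], IsScalarTower.algebraMap_apply A E K]
    exact (aeval_C _ _).symm)
  obtain ⟨f, hf⟩ := hloc.bc (A := A) (S := S)
  have e : (E ⊗[A] S)[X] ≃+* E[X] ⊗[A] S :=
    (polyEquivTensor' E (E ⊗[A] S)).toRingEquiv.trans <|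
     (Algebra.TensorProduct.comm E (E ⊗[A] S) E[X]).toRingEquiv.trans (Algebra.TensorProduct.cancelBaseChange A E E[X] E[X] S).toRingEquiv
  haveI : IsRegularRing (E[X] ⊗[A] S) := IsRegularRing.of_ringEquiv e
  exact hf.regular
theorem Kf_pow {A L Ω : Type*} [CommRing A] [Field L] [Field Ω] [Algebra A[X] L] [Algebra L Ω] (q : ℕ) [ExpChar Ω q] [PerfectRing Ω q] [DecidableEq A] [DecidableEq Ω] (n : ℕ)
    (E : Subfield Ω) (τ : Ω) (hτE : τ ∈ E) (hτ : algebraMap L Ω (algebraMap A[X] L X) = τ ^ q ^ n) (y : Ω) (a b : A[X])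
    (hE : ∀ z, z ^ q ^ n ∈ (a.coeffs ∪ b.coeffs).image (fun c => algebraMap L Ω (algebraMap A[X] L (C c))) → z ∈ E)
    (hy : algebraMap L Ω (algebraMap A[X] L a / algebraMap A[X] L b) = y ^ q ^ n) :
    y ∈ E := by
  have inj : ∀ x y : Ω, x ^ q ^ n = y ^ q ^ n → x = y := fun x y h => iterateFrobenius_inj Ω q n h
  let φ := (iterateFrobeniusEquiv Ω q n).symm
  have hφ : ∀ x, φ x ^ q ^ n = x := fun x => (iterateFrobeniusEquiv Ω q n).apply_symm_apply x
  have key : ∀ P : A[X], P.coeffs ⊆ a.coeffs ∪ b.coeffs → φ (algebraMap L Ω (algebraMap A[X] L P)) ∈ E := by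
    intro P hP
    rw [P.as_sum_support, map_sum, map_sum, map_sum]
    refine sum_mem fun i hi => ?_
    rw [← C_mul_X_pow_eq_monomial, map_mul, map_mul, map_mul, map_pow, map_pow, map_pow]
    refine mul_mem ?_ (pow_mem ?_ _)
    · refine hE _ ?_
      rw [hφ]
      exact Finset.mem_image_of_mem _ (hP (coeff_mem_coeffs (mem_support_iff.1 hi)))
    · have : φ (algebraMap L Ω (algebraMap A[X] L X)) = τ := inj _ _ (by rw [hφ, hτ])
      rw [this]; exact hτE
  have : y = φ (algebraMap L Ω (algebraMap A[X] L a)) / φ (algebraMap L Ω (algebraMap A[X] L b)) :=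
    inj _ _ (by rw [← hy, div_pow, hφ, hφ, map_div₀])
  rw [this]
  exact div_mem (key a Finset.subset_union_left) (key b Finset.subset_union_right)

theorem adj1 {A S : Type u} [CommRing A] [CommRing S] [Algebra A S]
    (hS : ∀ (L : Type u) [Field L] [Algebra A L], FinRes A L → IsRegularRing (L ⊗[A] S)) (E Ω : Type u) [Field E] [Field Ω]
    [Algebra A E] [Algebra E Ω] [Algebra A Ω] [IsScalarTower A E Ω] (K : Subfield Ω) (hK : K = Kf A Ω) [Algebra K E] [IsScalarTower K E Ω]
    [Module.Finite K E] (τ : Ω) : ∃ K' : Subfield Ω, (∀ x, algebraMap E Ω x ∈ K') ∧ τ ∈ K' ∧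
      ∃ (_ : Algebra A K') (_ : IsScalarTower A K' Ω), IsRegularRing (K' ⊗[A] S) := by
  let K' := (IntermediateField.adjoin E {τ}).toSubfield
  have hEK : ∀ x, algebraMap E Ω x ∈ K' := fun x => IntermediateField.algebraMap_mem (IntermediateField.adjoin E {τ}) x
  letI : Algebra E K' := ((algebraMap E Ω).codRestrict K' hEK).toAlgebra
  haveI : IsScalarTower E K' Ω := IsScalarTower.of_algebraMap_eq (fun r => rfl)
  letI : Algebra A K' := ((algebraMap E K').comp (algebraMap A E)).toAlgebra
  haveI : IsScalarTower A E K' := IsScalarTower.of_algebraMap_eq (fun r => rfl)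
  haveI : IsScalarTower A K' Ω := IsScalarTower.of_algebraMap_eq (fun r => IsScalarTower.algebraMap_apply A E Ω r)
  refine ⟨K', hEK, IntermediateField.mem_adjoin_simple_self E τ, inferInstance, inferInstance, ?_⟩
  by_cases hτ : IsIntegral E τ
  · haveI := IntermediateField.adjoin.finiteDimensional hτ
    haveI : Module.Finite E K' := Module.Finite.equiv (M := IntermediateField.adjoin E {τ})
      { toFun := fun x => ⟨x, x.2⟩, invFun := fun x => ⟨x, x.2⟩, map_add' := fun _ _ => rfl, left_inv := fun _ => rfl, right_inv := fun _ => rfl,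
        map_smul' := fun a x => Subtype.ext (Algebra.smul_def a (x : Ω)) }
    letI : Algebra K K' := ((algebraMap E K').comp (algebraMap K E)).toAlgebra
    haveI : IsScalarTower K E K' := IsScalarTower.of_algebraMap_eq (fun r => rfl)
    haveI : IsScalarTower K K' Ω := IsScalarTower.of_algebraMap_eq (fun r => IsScalarTower.algebraMap_apply K E Ω r)
    haveI : Module.Finite K K' := Module.Finite.trans E K'
    exact hS K' (finRes_sub K hK)
  · haveI : IsRegularRing (E ⊗[A] S) := hS E (finRes_sub K hK)
    refine trans_fib (E := E) (⟨τ, IntermediateField.mem_adjoin_simple_self E τ⟩ : K') ?_ ?_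
    · intro h
      exact hτ (IsAlgebraic.isIntegral (h.algHom (IsScalarTower.toAlgHom E K' Ω)))
    · intro x
      obtain ⟨r, s, hx⟩ := (IntermediateField.mem_adjoin_simple_iff E _).1 x.2
      refine ⟨r, s, (algebraMap K' Ω).injective ?_⟩
      rw [map_div₀, ← aeval_algebraMap_apply, ← aeval_algebraMap_apply]
      exact hx

theorem adj_fib {A S Ω : Type u} [CommRing A] [CommRing S] [Algebra A S]
    (hS : ∀ (L : Type u) [Field L] [Algebra A L], FinRes A L → IsRegularRing (L ⊗[A] S)) [Field Ω]
    [Algebra A Ω] (K : Subfield Ω) (hK : K = Kf A Ω) (c : Finset Ω) (hc : ∀ x ∈ c, IsIntegral K x) (τ : Ω) :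
      ∃ (E K' : Subfield Ω), (c : Set Ω) ⊆ E ∧ E ≤ K' ∧ τ ∈ K' ∧ ∃ (_ : Algebra A K') (_ : IsScalarTower A K' Ω), IsRegularRing (K' ⊗[A] S) := by
  let E := IntermediateField.adjoin K (c : Set Ω)
  haveI : FiniteDimensional K E := IntermediateField.finiteDimensional_adjoin hc
  letI : Algebra A E := ((algebraMap A Ω).codRestrict E (fun x => by
    refine IntermediateField.algebraMap_mem E (⟨algebraMap A Ω x, ?_⟩ : K)
    rw [hK]
    exact Subfield.subset_closure ⟨x, rfl⟩)).toAlgebra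
  haveI : IsScalarTower A E Ω := IsScalarTower.of_algebraMap_eq (fun r => rfl)
  obtain ⟨K', h1, h2, h⟩ := adj1 hS E Ω K hK τ
  exact ⟨E.toSubfield, K', IntermediateField.subset_adjoin _ _, fun x hx => h1 ⟨x, hx⟩, h2, h⟩

theorem poly_fib {A S : Type u} [CommRing A] [CommRing S] [Algebra A S] [IsNoetherianRing S]
    (hS : ∀ (L : Type u) [Field L] [Algebra A L], FinRes A L → IsRegularRing (L ⊗[A] S))
    (L : Type u) [Field L] [Algebra A L] [Algebra A[X] L] [IsScalarTower A A[X] L] (h : FinRes A[X] L) :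
    IsRegularRing (L ⊗[A] S) := by
  classical
  let Ω := AlgebraicClosure L
  let F := Kf A[X] L
  haveI hfin : Module.Finite F L := h
  let bs := Module.finBasis F L
  let s : Finset Ω := Finset.univ.image (fun i => algebraMap L Ω (bs i))
  let q := ringExpChar F
  haveI hq : ExpChar F q := inferInstance
  haveI : ExpChar L q := expChar_of_injective_algebraMap (algebraMap F L).injective q
  haveI : ExpChar Ω q := expChar_of_injective_algebraMap (algebraMap L Ω).injective q
  haveI : IsScalarTower F L Ω := inferInstance
  have hint : ∀ x ∈ s, IsIntegral F x := by
    intro x hx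
    simp only [s, Finset.mem_image, Finset.mem_univ, true_and] at hx
    obtain ⟨i, rfl⟩ := hx
    exact (Algebra.IsIntegral.isIntegral (R := F) (bs i)).map (IsScalarTower.toAlgHom F L Ω)
  obtain ⟨n, c, hc, hsep⟩ := field_lem (F := F) (Ω := Ω) q s hint
  have hc' : ∀ y : c, ∃ ab : A[X] × A[X], algebraMap L Ω (algebraMap A[X] L ab.1 / algebraMap A[X] L ab.2) = (y : Ω) ^ q ^ n := by
    intro y
    obtain ⟨a, ha⟩ := hc y y.2
    obtain ⟨u, v, hv, huv⟩ := mem_Kf.1 a.2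
    exact ⟨(u, v), by rw [← huv, ← ha]; rfl⟩
  choose ab hab using hc'
  let φ := (iterateFrobeniusEquiv Ω q n).symm
  have hφ : ∀ x, φ x ^ q ^ n = x := fun x => (iterateFrobeniusEquiv Ω q n).apply_symm_apply x
  let c' : Finset Ω := c.attach.biUnion (fun y => ((ab y).1.coeffs ∪ (ab y).2.coeffs).image (fun c => φ (algebraMap L Ω (algebraMap A[X] L (C c)))))
  let τ : Ω := φ (algebraMap L Ω (algebraMap A[X] L X))
  let K := Kf A Ω
  have hcint : ∀ x ∈ c', IsIntegral K x := by
    intro x hx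
    simp only [c', Finset.mem_biUnion, Finset.mem_image] at hx
    obtain ⟨y, _, c, _, rfl⟩ := hx
    refine IsIntegral.of_pow (n := q ^ n) (pow_pos (expChar_pos Ω q) n) ?_
    rw [hφ]
    have : algebraMap L Ω (algebraMap A[X] L (C c)) = algebraMap A Ω c := by
      rw [IsScalarTower.algebraMap_apply A L Ω, IsScalarTower.algebraMap_apply A A[X] L]; rfl
    rw [this]
    exact isIntegral_algebraMap (R := K) (x := ⟨algebraMap A Ω c, Subfield.subset_closure ⟨c, rfl⟩⟩)
  obtain ⟨E, K', hcE, hEK, hτK, iA, iT, hreg⟩ := adj_fib hS K rfl c' hcint τ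
  haveI : Algebra.EssFiniteType A[X] L := h.ess
  haveI : Algebra.EssFiniteType A L := Algebra.EssFiniteType.comp A A[X] L
  have hN : IsNoetherianRing (L ⊗[A] S) := ess_noeth A L S
  have hcK : (c : Set Ω) ⊆ K' := by
    intro y hy
    refine Kf_pow q n K' τ hτK (hφ _).symm y _ _ (fun z hz => ?_) (hab ⟨y, hy⟩)
    refine hEK (hcE ?_)
    simp only [Finset.mem_image] at hz
    obtain ⟨d, hd, hz⟩ := hz
    simp only [c', Finset.coe_biUnion, Set.mem_iUnion, Finset.coe_image, Set.mem_image]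
    refine ⟨⟨y, hy⟩, by simp, d, hd, ?_⟩
    rw [hz]
    exact (iterateFrobeniusEquiv Ω q n).symm_apply_apply z
  refine sep_down A S L K' Ω hreg hN s (fun x hx => hsep K' hcK x hx) ?_
  have hXK : ∀ P : A[X], algebraMap L Ω (algebraMap A[X] L P) ∈ K' := by
    intro P
    induction P using Polynomial.induction_on' with
    | add P Q hP hQ => rw [map_add, map_add]; exact add_mem hP hQ
    | monomial i c =>
      rw [← C_mul_X_pow_eq_monomial, map_mul, map_mul, map_pow, map_pow]
      refine mul_mem ?_ (pow_mem ?_ _)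
      · have : algebraMap L Ω (algebraMap A[X] L (C c)) = algebraMap A Ω c := by
          rw [IsScalarTower.algebraMap_apply A L Ω, IsScalarTower.algebraMap_apply A A[X] L]; rfl
        rw [this, IsScalarTower.algebraMap_apply A K' Ω]
        exact (algebraMap A K' c).2
      · rw [← hφ (algebraMap L Ω _)]
        exact pow_mem hτK _
  intro x
  rw [← bs.sum_repr x, map_sum]
  refine sum_mem fun i _ => ?_
  rw [Algebra.smul_def, map_mul]
  refine mul_mem ?_ (IntermediateField.subset_adjoin _ _ (by simp [s]))
  obtain ⟨u, v, hv, huv⟩ := mem_Kf.1 (bs.repr x i).2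
  change algebraMap L Ω ((bs.repr x i : F) : L) ∈ _
  rw [huv, map_div₀]
  exact div_mem (IntermediateField.algebraMap_mem (IntermediateField.adjoin K' (s : Set Ω)) (⟨_, hXK u⟩ : K'))
    (IntermediateField.algebraMap_mem (IntermediateField.adjoin K' (s : Set Ω)) (⟨_, hXK v⟩ : K'))


theorem IsDense.poly {A W : Type*} [CommRing A] [CommRing W] {φ : A →+* W} {I : Ideal A} (h : IsDense φ I) :
    IsDense (mapRingHom φ) (I.map C) := by
  have key : ∀ n, ((I.map C).map (mapRingHom φ)) ^ n = ((I.map φ) ^ n).map C := by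
    intro n
    rw [Ideal.map_map, mapRingHom_comp_C, ← Ideal.map_map, Ideal.map_pow]
  refine ⟨fun n w => ?_, fun n a ha => ?_⟩
  · choose g hg using h.surj n
    refine ⟨∑ i ∈ w.support, monomial i (g (w.coeff i)), ?_⟩
    rw [key]
    have : w - mapRingHom φ (∑ i ∈ w.support, monomial i (g (w.coeff i))) = ∑ i ∈ w.support, monomial i (w.coeff i - φ (g (w.coeff i))) := by
      conv_lhs => rw [w.as_sum_support]
      simp [map_sum, Finset.sum_sub_distrib, ← w.as_sum_support]
    rw [this]
    refine sum_mem fun i _ => ?_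
    rw [← C_mul_X_pow_eq_monomial]
    exact Ideal.mul_mem_right _ _ (Ideal.mem_map_of_mem _ (hg _))
  · rw [key, Ideal.mem_map_C_iff] at ha
    rw [← Ideal.map_pow, Ideal.mem_map_C_iff]
    intro i
    exact h.inj n _ (by simpa using ha i)

theorem IsDense.mono {A W : Type*} [CommRing A] [CommRing W] {φ : A →+* W} {I I' : Ideal A} (h : IsDense φ I) (hI : I ≤ I') :
    IsDense φ I' := by
  have hm : ∀ n, (I.map φ) ^ n ≤ (I'.map φ) ^ n := fun n => Ideal.pow_right_mono (Ideal.map_mono hI) n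
  refine ⟨fun n w => ?_, fun n a ha => ?_⟩
  · obtain ⟨a, ha⟩ := h.surj n w
    exact ⟨a, hm n ha⟩
  · have key : ∀ w ∈ (I'.map φ) ^ n, ∃ b ∈ I' ^ n, w - φ b ∈ (I.map φ) ^ n := by
      intro w hw
      rw [← Ideal.map_pow] at hw
      refine Submodule.span_induction ?_ ?_ ?_ ?_ hw
      · rintro _ ⟨b, hb, rfl⟩
        exact ⟨b, hb, by simp⟩
      · exact ⟨0, zero_mem _, by simp⟩
      · rintro x y _ _ ⟨b, hb, hb'⟩ ⟨c, hc, hc'⟩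
        refine ⟨b + c, add_mem hb hc, ?_⟩
        have := add_mem hb' hc'
        rw [map_add]; convert this using 1; ring
      · rintro r x _ ⟨b, hb, hb'⟩
        obtain ⟨c, hc⟩ := h.surj n r
        refine ⟨c * b, Ideal.mul_mem_left _ _ hb, ?_⟩
        have : r • x - φ (c * b) = r * (x - φ b) + (r - φ c) * φ b := by rw [map_mul, smul_eq_mul]; ring
        rw [this]
        exact add_mem (Ideal.mul_mem_left _ _ hb') (Ideal.mul_mem_right _ _ hc)
    obtain ⟨b, hb, hb'⟩ := key _ ha
    rw [← map_sub] at hb'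
    have := Ideal.pow_right_mono hI n (h.inj n _ hb')
    have := add_mem this hb
    rwa [sub_add_cancel] at this

theorem IsLoc.lift {X B C : Type*} [CommRing X] [CommRing B] [CommRing C] {f : X →+* B} (h : IsLoc f) (g : X →+* C)
    (hg : ∀ x, IsUnit (f x) → IsUnit (g x)) : ∃ l : B →+* C, l.comp f = g := by
  letI := f.toAlgebra
  haveI : IsLocalization ((IsUnit.submonoid B).comap f) B := h.isLocalization
  exact ⟨IsLocalization.lift (M := (IsUnit.submonoid B).comap f) (S := B) (g := g) (fun y => hg _ y.2),
    RingHom.ext fun x => IsLocalization.lift_eq _ x⟩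

theorem IsLoc.max_map {X B : Type*} [CommRing X] [CommRing B] {f : X →+* B} (h : IsLoc f) (I : Ideal B) :
    (I.comap f).map f = I := by
  refine le_antisymm Ideal.map_comap_le fun y hy => ?_
  obtain ⟨x, s, hs, e⟩ := h.surj y
  have : f x ∈ (I.comap f).map f := Ideal.mem_map_of_mem _ (by rw [Ideal.mem_comap, ← e]; exact Ideal.mul_mem_right _ _ hy)
  rw [← e] at this
  exact (Ideal.mul_unit_mem_iff_mem _ hs).1 this

theorem IsLoc.mem_map {X B : Type*} [CommRing X] [CommRing B] {f : X →+* B} (h : IsLoc f) (I : Ideal X) (x : X) (hx : f x ∈ I.map f) :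
    ∃ s, IsUnit (f s) ∧ s * x ∈ I := by
  letI := f.toAlgebra
  haveI : IsLocalization ((IsUnit.submonoid B).comap f) B := h.isLocalization
  obtain ⟨s, hs, h⟩ := (IsLocalization.algebraMap_mem_map_algebraMap_iff ((IsUnit.submonoid B).comap f) B I x).1 hx
  exact ⟨s, hs, h⟩

theorem IsDense.loc {X Y B C : Type*} [CommRing X] [CommRing Y] [CommRing B] [CommRing C] [IsLocalRing B] [IsLocalRing C]
    {φ : X →+* Y} {J : Ideal X} (hφ : IsDense φ J) {f : X →+* B} (hf : IsLoc f) {l : Y →+* C} (hl : IsLoc l)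
    (h : B →+* C) (hh : h.comp f = l.comp φ) [IsLocalHom h] (hJ : J ≤ (maximalIdeal B).comap f) : IsDense h (maximalIdeal B) := by
  have hc : ∀ x, h (f x) = l (φ x) := fun x => RingHom.congr_fun hh x
  have hJY : ∀ n, ∀ y ∈ (J.map φ) ^ n, l y ∈ ((maximalIdeal B).map h) ^ n := by
    intro n y hy
    have : ((J.map φ) ^ n).map l ≤ ((maximalIdeal B).map h) ^ n := by
      rw [Ideal.map_pow, Ideal.map_map, ← hh, ← Ideal.map_map]
      exact Ideal.pow_right_mono (Ideal.map_mono (Ideal.map_le_iff_le_comap.2 hJ)) n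
    exact this (Ideal.mem_map_of_mem _ hy)
  have hmC : (maximalIdeal B).map h ≤ maximalIdeal C := ((local_hom_TFAE h).out 0 2 :).1 ‹_›
  have hunit : ∀ n, n ≠ 0 → ∀ s, IsUnit (l s) → ∃ t, s - φ t ∈ (J.map φ) ^ n ∧ IsUnit (f t) := by
    intro n hn s hs
    obtain ⟨t, ht⟩ := hφ.surj n s
    refine ⟨t, ht, ?_⟩
    apply isUnit_of_map_unit h
    rw [hc]
    by_contra hcon
    have h1 : l (φ t) ∈ maximalIdeal C := hcon
    have h2 := hmC (Ideal.pow_le_self hn (hJY n _ ht))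
    rw [map_sub] at h2
    have := add_mem h2 h1
    rw [sub_add_cancel] at this
    exact this hs
  refine ⟨fun n w => ?_, fun n a ha => ?_⟩
  · by_cases hn : n = 0
    · exact ⟨0, by simp [hn]⟩
    obtain ⟨y, s, hs, e⟩ := hl.surj w
    obtain ⟨x, hx⟩ := hφ.surj n y
    obtain ⟨t, ht, htu⟩ := hunit n hn s hs
    have htu' := htu
    obtain ⟨v, hv⟩ := htu'
    refine ⟨f x * (v⁻¹ : Bˣ), ?_⟩
    rw [← Ideal.mul_unit_mem_iff_mem _ hs, ← Ideal.mul_unit_mem_iff_mem _ (htu.map h)]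
    have h1 : h (f x * (v⁻¹ : Bˣ)) * h (f t) = l (φ x) := by
      rw [← map_mul, mul_assoc, ← hv, Units.inv_mul, mul_one, hc]
    have : (w - h (f x * (v⁻¹ : Bˣ))) * l s * h (f t) = l (y - φ x) * l (φ t) - l (φ x) * l (s - φ t) := by
      rw [map_sub, map_sub, ← hc t]
      linear_combination (h (f t)) * e - l s * h1
    rw [this]
    exact sub_mem (Ideal.mul_mem_right _ _ (hJY n _ hx)) (Ideal.mul_mem_left _ _ (hJY n _ ht))
  · by_cases hn : n = 0
    · simp [hn]
    obtain ⟨x, s, hs, e⟩ := hf.surj a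
    rw [← Ideal.mul_unit_mem_iff_mem _ hs, e]
    have hx : l (φ x) ∈ ((((maximalIdeal B).comap f).map φ) ^ n).map l := by
      rw [Ideal.map_pow, Ideal.map_map, ← hh, ← Ideal.map_map, hf.max_map, ← hc, ← e, map_mul]
      exact Ideal.mul_mem_right _ _ ha
    obtain ⟨r, hr, hrx⟩ := hl.mem_map _ _ hx
    obtain ⟨t, ht, htu⟩ := hunit n hn r hr
    have h2 : φ (t * x) ∈ (((maximalIdeal B).comap f).map φ) ^ n := by
      have : φ (t * x) = r * φ x - (r - φ t) * φ x := by rw [map_mul]; ring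
      rw [this]
      exact sub_mem hrx (Ideal.mul_mem_right _ _ (Ideal.pow_right_mono (Ideal.map_mono hJ) n ht))
    have h3 := Ideal.mem_map_of_mem f ((hφ.mono hJ).inj n _ h2)
    rw [Ideal.map_pow, hf.max_map, map_mul] at h3
    exact (Ideal.unit_mul_mem_iff_mem _ htu).1 h3

theorem IsDense.max_eq {B C : Type*} [CommRing B] [CommRing C] [IsLocalRing B] [IsLocalRing C] {h : B →+* C} [IsLocalHom h]
    (hd : IsDense h (maximalIdeal B)) : (maximalIdeal B).map h = maximalIdeal C := by
  have hmC : (maximalIdeal B).map h ≤ maximalIdeal C := ((local_hom_TFAE h).out 0 2 :).1 ‹_›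
  refine le_antisymm hmC fun w hw => ?_
  obtain ⟨a, ha⟩ := hd.surj 1 w
  rw [pow_one] at ha
  have h1 : h a ∈ maximalIdeal C := by
    have := sub_mem hw (hmC ha)
    rwa [sub_sub_cancel] at this
  have h2 : a ∈ maximalIdeal B := fun hu => h1 (hu.map h)
  have := add_mem ha (Ideal.mem_map_of_mem h h2)
  rwa [sub_add_cancel] at this


theorem IsLoc.isLoc' {X Y : Type*} [CommRing X] [CommRing Y] [Algebra X Y] (h : IsLoc (algebraMap X Y)) :
    IsLocalization ((IsUnit.submonoid Y).comap (algebraMap X Y)) Y := by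
  have := h.isLocalization
  convert this
  ext x y
  exact Algebra.smul_def x y

attribute [local instance] Polynomial.algebra in
theorem locX {A S B Cc L : Type u} [CommRing A] [CommRing S] [CommRing B] [CommRing Cc] [CommRing L] [Algebra A S]
    [Algebra A[X] B] [Algebra S[X] Cc] [Algebra B Cc] [Algebra B L] [Algebra A[X] L] [IsScalarTower A[X] B L] [Algebra A L]
    [IsScalarTower A A[X] L]
    (hB : IsLoc (algebraMap A[X] B)) (hC : IsLoc (algebraMap S[X] Cc))
    (hcomm : ∀ x : A[X], algebraMap B Cc (algebraMap A[X] B x) = algebraMap S[X] Cc (x.map (algebraMap A S)))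
    [IsRegularRing (L ⊗[A] S)] : IsRegularRing (Cc ⊗[B] L) := by
  letI : Algebra A[X] Cc := ((algebraMap S[X] Cc).comp (mapRingHom (algebraMap A S))).toAlgebra
  haveI : IsScalarTower A[X] S[X] Cc := IsScalarTower.of_algebraMap_eq (fun r => rfl)
  haveI : IsScalarTower A[X] B Cc := IsScalarTower.of_algebraMap_eq (fun r => (hcomm r).symm)
  have e : S[X] ⊗[A[X]] L ≃+* S ⊗[A] L := (Algebra.IsPushout.cancelBaseChangeAlg A S A[X] S[X] L).toRingEquiv
  haveI : IsRegularRing (S[X] ⊗[A[X]] L) := IsRegularRing.of_ringEquiv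
    ((Algebra.TensorProduct.comm A L S).toRingEquiv.trans e.symm)
  obtain ⟨g, hg⟩ := hC.bc (A := A[X]) (S := L)
  haveI := hg.regular
  haveI := hB.isLoc'
  exact IsRegularRing.of_ringEquiv (IsLocalization.algebraTensorEquiv ((IsUnit.submonoid B).comap (algebraMap A[X] B)) B Cc L).symm.toRingEquiv

theorem finRes_fib {B C' L : Type u} [CommRing B] [CommRing C'] [Field L] [Algebra B C'] [Algebra B L] (h : FinRes B L)
    (p : Ideal (C' ⊗[B] L)) [p.IsPrime] : FinRes C' p.ResidueField := by
  classical
  haveI : Module.Finite (Kf B L) L := h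
  let b := Module.finBasis (Kf B L) L
  let r := algebraMap (C' ⊗[B] L) p.ResidueField
  let i : L →+* p.ResidueField := r.comp (Algebra.TensorProduct.includeRight : L →ₐ[B] C' ⊗[B] L).toRingHom
  have hr : ∀ c : C', r (c ⊗ₜ 1) = algebraMap C' p.ResidueField c := by
    intro c
    rw [IsScalarTower.algebraMap_apply C' (C' ⊗[B] L) p.ResidueField]
    rfl
  have hi : ∀ x : B, i (algebraMap B L x) = algebraMap C' p.ResidueField (algebraMap B C' x) := by
    intro x
    rw [← hr]
    change r (1 ⊗ₜ algebraMap B L x) = _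
    exact congrArg r (Algebra.TensorProduct.tmul_one_eq_one_tmul x).symm
  refine fin_of_gen (F := Kf C' p.ResidueField) r.range (Finset.univ.image (fun j => i (b j))) ?_ ?_
  · rintro _ ⟨z, rfl⟩
    induction z using TensorProduct.induction_on with
    | zero => rw [map_zero]; exact zero_mem _
    | add x y hx hy => rw [map_add]; exact add_mem hx hy
    | tmul c l =>
      have h1 : r (c ⊗ₜ l) = algebraMap C' p.ResidueField c * i l := by
        rw [← hr]
        change _ = _ * r (1 ⊗ₜ l)
        rw [← map_mul, Algebra.TensorProduct.tmul_mul_tmul, mul_one, one_mul]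
      rw [h1, ← b.sum_repr l, map_sum, Finset.mul_sum]
      refine sum_mem fun j _ => ?_
      have h2 : algebraMap C' p.ResidueField c * i (b.repr l j : L) ∈ Kf C' p.ResidueField := by
        refine mul_mem (Subfield.subset_closure ⟨c, rfl⟩) ?_
        obtain ⟨u, v, hv, huv⟩ := mem_Kf.1 (b.repr l j).2
        rw [huv, map_div₀, hi, hi]
        exact div_mem (Subfield.subset_closure ⟨_, rfl⟩) (Subfield.subset_closure ⟨_, rfl⟩)
      have h3 : algebraMap C' p.ResidueField c * i (b.repr l j • b j) = (⟨_, h2⟩ : Kf C' p.ResidueField) • i (b j) := by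
        rw [Algebra.smul_def]
        change _ * i ((b.repr l j : L) * b j) = _ * i (b.repr l j : L) * _
        rw [map_mul, mul_assoc]
      rw [h3]
      exact Submodule.smul_mem _ _ (Submodule.subset_span (by simp))
  · intro l
    obtain ⟨x, y, hy, rfl⟩ := IsFractionRing.div_surjective (A := (C' ⊗[B] L) ⧸ p) l
    obtain ⟨x, rfl⟩ := Ideal.Quotient.mk_surjective x
    obtain ⟨y, rfl⟩ := Ideal.Quotient.mk_surjective y
    exact ⟨_, ⟨x, rfl⟩, _, ⟨y, rfl⟩, rfl⟩

theorem fib_step {B C' W L : Type u} [CommRing B] [CommRing C'] [CommRing W] [Field L] [Algebra B C'] [Algebra C' W] [Algebra B W]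
    [IsScalarTower B C' W] [Algebra B L] (h : FinRes B L) [IsNoetherianRing W] [Module.Flat C' W] [IsRegularRing (C' ⊗[B] L)]
    (hC : ∀ (K : Type u) [Field K] [Algebra C' K], FinRes C' K → IsRegularRing (K ⊗[C'] W)) : IsRegularRing (L ⊗[B] W) := by
  let X := C' ⊗[B] L
  haveI := h.ess
  haveI : IsNoetherianRing (L ⊗[B] W) := ess_noeth B L W
  have e : X ⊗[C'] W ≃+* L ⊗[B] W := (Algebra.TensorProduct.comm C' X W).toRingEquiv.trans
    ((Algebra.TensorProduct.cancelBaseChange B C' W W L).toRingEquiv.trans (Algebra.TensorProduct.comm B W L).toRingEquiv)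
  haveI : IsNoetherianRing (X ⊗[C'] W) := isNoetherianRing_of_ringEquiv _ e.symm
  have : IsRegularRing (X ⊗[C'] W) := by
    refine reg_fib (A := X) (fun p hp => ?_)
    have := hC p.ResidueField (finRes_fib h p)
    exact IsRegularRing.of_ringEquiv (Algebra.TensorProduct.cancelBaseChange C' X p.ResidueField p.ResidueField W).symm.toRingEquiv
  exact IsRegularRing.of_ringEquiv e


theorem FinRes.mono {X Y L : Type u} [CommRing X] [CommRing Y] [Field L] [Algebra X L] [Algebra Y L]
    (h : FinRes X L) (hh : ∀ x : X, algebraMap X L x ∈ Kf Y L) : FinRes Y L := by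
  haveI : Module.Finite (Kf X L) L := h
  refine fin_of_range_le (F1 := Kf X L) (F2 := Kf Y L) (fun x => ?_)
  obtain ⟨a, b, -, h⟩ := mem_Kf.1 x.2
  exact ⟨⟨x.1, h ▸ div_mem (hh a) (hh b)⟩, rfl⟩

theorem FinRes.loc {X Y L : Type u} [CommRing X] [CommRing Y] [Field L] [Algebra X L] [Algebra Y L] [Algebra X Y] [IsScalarTower X Y L]
    (hl : IsLoc (algebraMap X Y)) (h : FinRes Y L) : FinRes X L := by
  refine h.mono fun y => ?_
  obtain ⟨x, s, hs, he⟩ := hl.surj y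
  have h1 := congrArg (algebraMap Y L) he
  rw [map_mul, ← IsScalarTower.algebraMap_apply, ← IsScalarTower.algebraMap_apply] at h1
  have h2 := hs.map (algebraMap Y L)
  rw [← IsScalarTower.algebraMap_apply] at h2
  rw [eq_div_of_mul_eq h2.ne_zero h1]
  exact div_mem (Subfield.subset_closure ⟨_, rfl⟩) (Subfield.subset_closure ⟨_, rfl⟩)

theorem main_of (mainC : ∀ (A C' : Type u) [CommRing A] [IsNoetherianRing A] [IsLocalRing A] [IsAdicComplete (maximalIdeal A) A]
      [CommRing C'] [IsLocalRing C'] (f : A[X] →+* C'), IsLoc f → IsLocalHom (f.comp C) → HG C')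
    (A B : Type u) [CommRing A] [IsNoetherianRing A] [IsLocalRing A] [CommRing B] [IsLocalRing B]
      (f : Polynomial A →+* B) (hf : IsLoc f) (hl : IsLocalHom (f.comp Polynomial.C)) (hA : HG A) : HG B := by
  intro L _ _ hL
  haveI : IsNoetherianRing B := hf.noeth
  let S := AdicCompletion (maximalIdeal A) A
  have hS : IsComp (algebraMap A S) (maximalIdeal A) := IsComp.adic _ (IsNoetherian.noetherian _)
  haveI := hS.isLocal.1
  haveI : IsNoetherianRing S := hS.noeth
  haveI : IsAdicComplete (maximalIdeal S) S := by rw [← hS.max_eq]; exact hS.complete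
  let ρ := (residue B).comp f
  obtain ⟨g0, hg0⟩ := lift_exists hS.toIsDense (⊥ : Ideal (ResidueField B)) (ρ.comp C) (by
    rw [Ideal.map_le_iff_le_comap]
    intro a ha
    rw [Ideal.mem_comap, Ideal.mem_bot]
    change residue B (f (C a)) = 0
    rw [residue_eq_zero_iff]
    exact ((local_hom_TFAE (f.comp C)).out 0 2 :).1 hl (Ideal.mem_map_of_mem _ ha))
  let g : S[X] →+* ResidueField B := eval₂RingHom g0 (ρ X)
  have hg : g.comp (mapRingHom (algebraMap A S)) = ρ := by
    apply Polynomial.ringHom_ext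
    · intro a
      simpa [g] using RingHom.congr_fun hg0 a
    · simp [g]
  let Q := RingHom.ker g
  haveI : Q.IsPrime := RingHom.ker_isPrime g
  let Cc := Localization.AtPrime Q
  let l : S[X] →+* Cc := algebraMap S[X] Cc
  have hll : IsLoc l := IsLoc.of_isLocalization Q.primeCompl
  have hfu : ∀ x, IsUnit (f x) ↔ x.map (algebraMap A S) ∉ Q := by
    intro x
    have h1 : g (x.map (algebraMap A S)) = residue B (f x) := RingHom.congr_fun hg x
    rw [RingHom.mem_ker, h1, residue_eq_zero_iff, mem_maximalIdeal, mem_nonunits_iff, not_not]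
  obtain ⟨h, hh⟩ := hf.lift (l.comp (mapRingHom (algebraMap A S))) (fun x hx =>
    IsLocalization.map_units Cc (⟨_, (hfu x).1 hx⟩ : Q.primeCompl))
  haveI : IsLocalHom h := by
    constructor
    intro b hb
    obtain ⟨x, s, hs, he⟩ := hf.surj b
    have h1 : IsUnit (h (f x)) := by rw [← he, map_mul]; exact hb.mul (hs.map h)
    have h2 : h (f x) = l (x.map (algebraMap A S)) := RingHom.congr_fun hh x
    rw [h2, IsLocalization.AtPrime.isUnit_to_map_iff Cc Q] at h1
    have h3 : IsUnit (f x) := (hfu x).2 h1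
    rw [← he] at h3
    exact isUnit_of_mul_isUnit_left h3
  have hD : IsDense h (maximalIdeal B) := by
    refine IsDense.loc hS.toIsDense.poly hf hll h hh ?_
    rw [Ideal.map_le_iff_le_comap, Ideal.comap_comap]
    intro a ha
    exact ((local_hom_TFAE (f.comp C)).out 0 2 :).1 hl (Ideal.mem_map_of_mem _ ha)
  have hm := hD.max_eq
  haveI : IsNoetherianRing Cc := hll.noeth
  obtain ⟨W, _, _, hW⟩ : ∃ (W : Type u) (_ : CommRing W) (_ : Algebra Cc W), IsComp (algebraMap Cc W) (maximalIdeal Cc) :=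
    ⟨AdicCompletion (maximalIdeal Cc) Cc, inferInstance, inferInstance, IsComp.adic _ (IsNoetherian.noetherian _)⟩
  letI : Algebra A[X] B := f.toAlgebra
  letI : Algebra B Cc := h.toAlgebra
  letI : Algebra B W := ((algebraMap Cc W).comp h).toAlgebra
  haveI : IsScalarTower B Cc W := IsScalarTower.of_algebraMap_eq (fun r => rfl)
  letI : Algebra A[X] L := ((algebraMap B L).comp f).toAlgebra
  letI : Algebra A L := ((algebraMap A[X] L).comp C).toAlgebra
  haveI : IsScalarTower A[X] B L := IsScalarTower.of_algebraMap_eq (fun r => rfl)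
  haveI : IsScalarTower A A[X] L := IsScalarTower.of_algebraMap_eq (fun r => rfl)
  have hBW : IsComp (algebraMap B W) (maximalIdeal B) := IsComp.comp hD (by rw [hm]; exact hW)
  rw [comp_reg (IsComp.adic _ (IsNoetherian.noetherian _)) hBW]
  haveI : IsRegularRing (L ⊗[A] S) := poly_fib hA L (hL.loc hf)
  haveI : IsRegularRing (Cc ⊗[B] L) := locX (A := A) (S := S) hf hll (fun x => RingHom.congr_fun hh x)
  haveI : IsNoetherianRing W := hW.noeth
  haveI : Module.Flat Cc W := hW.flat
  refine fib_step (C' := Cc) hL ?_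
  intro K _ _ hK
  rw [← comp_reg (IsComp.adic _ (IsNoetherian.noetherian _)) hW]
  refine mainC S Cc l hll ?_ K hK
  rw [((local_hom_TFAE (l.comp C)).out 0 2 :), ← hS.max_eq, Ideal.map_map, RingHom.comp_assoc]
  have : (C : S →+* S[X]).comp (algebraMap A S) = (mapRingHom (algebraMap A S)).comp C := by ext; simp
  rw [this, ← RingHom.comp_assoc, ← hh, RingHom.comp_assoc, ← Ideal.map_map, ← hm]
  exact Ideal.map_mono (((local_hom_TFAE (f.comp C)).out 0 2 :).1 hl)


theorem IsLoc.hom_ext {X Y Z : Type*} [CommRing X] [CommRing Y] [CommRing Z] {f : X →+* Y} (h : IsLoc f) {a b : Y →+* Z}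
    (hab : a.comp f = b.comp f) : a = b := by
  ext y
  obtain ⟨x, s, hs, he⟩ := h.surj y
  refine (hs.map a).mul_right_cancel ?_
  have h1 : ∀ z, a (f z) = b (f z) := fun z => RingHom.congr_fun hab z
  rw [← map_mul, he, h1, ← he, map_mul, h1]

theorem IsLoc.deriv {X Y : Type*} [CommRing X] [CommRing Y] {f : X →+* Y} (h : IsLoc f) (D : Derivation ℤ X X) :
    ∃ D' : Derivation ℤ Y Y, ∀ a, D' (f a) = f (D a) := by
  let g : X →+* TrivSqZeroExt Y Y :=
    { toFun := fun x => TrivSqZeroExt.inl (f x) + TrivSqZeroExt.inr (f (D x))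
      map_one' := by simp
      map_zero' := by simp
      map_add' := fun x y => by ext <;> simp
      map_mul' := fun x y => by ext <;> simp [mul_comm] }
  obtain ⟨l, hl⟩ := h.lift g (fun x hx => by
    rw [TrivSqZeroExt.isUnit_iff_isUnit_fst]
    simpa [g] using hx)
  have hl' : ∀ x, l (f x) = g x := fun x => RingHom.congr_fun hl x
  let fs : TrivSqZeroExt Y Y →+* Y := (TrivSqZeroExt.fstHom ℤ Y Y).toRingHom
  have h1 : fs.comp l = RingHom.id Y := h.hom_ext (by
    ext x
    change (l (f x)).fst = f x
    rw [hl']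
    simp [g])
  have h2 : ∀ y, (l y).fst = y := fun y => RingHom.congr_fun h1 y
  let d : Y →+ Y := (TrivSqZeroExt.sndHom Y Y).toAddMonoidHom.comp l.toAddMonoidHom
  have hd : ∀ y, d y = (l y).snd := fun y => rfl
  refine ⟨Derivation.mk' d.toIntLinearMap (fun a b => ?_), fun a => ?_⟩
  · change d (a * b) = a • d b + b • d a
    rw [hd, map_mul, TrivSqZeroExt.snd_mul, h2, h2, hd, hd, op_smul_eq_smul]
  · change d (f a) = _
    rw [hd, hl']
    simp [g]

theorem der_bc {V W L : Type*} [CommRing V] [CommRing W] [CommRing L] [Algebra V W] [Algebra V L] (D : Derivation ℤ W W)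
    (hD : ∀ v, D (algebraMap V W v) = 0) : ∃ D' : Derivation ℤ (L ⊗[V] W) (L ⊗[V] W), ∀ l w, D' (l ⊗ₜ w) = l ⊗ₜ D w := by
  let d : W →ₗ[V] W := LinearMap.mk ⟨D, D.map_add⟩ (fun v w => by
    change D (v • w) = v • D w
    rw [Algebra.smul_def, Derivation.leibniz, hD, smul_zero, add_zero, smul_eq_mul, Algebra.smul_def])
  let e : L ⊗[V] W →ₗ[V] L ⊗[V] W := d.lTensor L
  refine ⟨Derivation.mk' e.toAddMonoidHom.toIntLinearMap (fun a b => ?_), fun l w => ?_⟩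
  · change e (a * b) = a * e b + b * e a
    induction a using TensorProduct.induction_on with
    | zero => simp
    | add x y hx hy => rw [add_mul, map_add, hx, hy, map_add]; ring
    | tmul l w =>
    induction b using TensorProduct.induction_on with
    | zero => simp
    | add x y hx hy => rw [mul_add, map_add, hx, hy, map_add]; ring
    | tmul l' w' =>
      have h : ∀ l w, e (l ⊗ₜ w) = l ⊗ₜ D w := fun l w => rfl
      rw [Algebra.TensorProduct.tmul_mul_tmul, h, h, h, Algebra.TensorProduct.tmul_mul_tmul, Algebra.TensorProduct.tmul_mul_tmul,
        Derivation.leibniz, TensorProduct.tmul_add, mul_comm l' l, smul_eq_mul, smul_eq_mul]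
  · rfl

attribute [local instance] Algebra.TensorProduct.rightAlgebra in
theorem IsLoc.incl {P W K : Type u} [CommRing P] [CommRing W] [CommRing K] [Algebra P W] [Algebra P K]
    (hK : IsLoc (algebraMap P K)) : IsLoc (Algebra.TensorProduct.includeRight : W →ₐ[P] K ⊗[P] W).toRingHom := by
  haveI := hK.isLoc'
  exact IsLoc.of_isLocalization (Y := K ⊗[P] W) (Algebra.algebraMapSubmonoid W ((IsUnit.submonoid K).comap (algebraMap P K)))

theorem pp_frac {P W K : Type u} [CommRing P] [CommRing W] [Field K] [Algebra P W] [Algebra P K]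
    (hK : IsLoc (algebraMap P K)) (hi : Function.Injective (algebraMap P K)) (q : ℕ) [ExpChar K q] (hP : PP q (algebraMap P W)) :
    PP q (algebraMap K (K ⊗[P] W)) := by
  intro a ha
  rcases ‹ExpChar K q› with _ | hq
  · exact absurd (pow_one a) (ha a)
  obtain ⟨b, c, hc, he⟩ := hK.surj a
  have hc0 := hc.ne_zero
  obtain ⟨D, ⟨DW, hDW⟩, hD⟩ := hP (b * c ^ (q - 1)) (fun e he' => ha (algebraMap P K e / algebraMap P K c) (by
    rw [div_pow, ← map_pow, he', map_mul, map_pow, ← he, mul_assoc, ← pow_succ', Nat.sub_add_cancel hq.one_le,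
      mul_div_cancel_right₀ _ (pow_ne_zero _ hc0)]))
  obtain ⟨DK, hDK⟩ := hK.deriv D
  obtain ⟨DS, hDS⟩ := (hK.incl (W := W)).deriv DW
  have hDS' : ∀ x, DS (1 ⊗ₜ x) = 1 ⊗ₜ DW x := hDS
  have hp0 : (q : K) = 0 := CharP.cast_eq_zero K q
  have key : DK (a * algebraMap P K c ^ q) = algebraMap P K (D (b * c ^ (q - 1))) := by
    rw [← hDK, map_mul (algebraMap P K), ← he, map_pow (algebraMap P K), mul_assoc, ← pow_succ', Nat.sub_add_cancel hq.one_le]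
  rw [Derivation.leibniz, Derivation.leibniz_pow, ← Nat.cast_smul_eq_nsmul K, hp0, zero_smul, smul_zero, zero_add] at key
  refine ⟨DK, ⟨DS, fun k => ?_⟩, fun h0 => ?_⟩
  · have hP : ∀ x : P, algebraMap K (K ⊗[P] W) (algebraMap P K x) = 1 ⊗ₜ algebraMap P W x := fun x =>
      Algebra.TensorProduct.tmul_one_eq_one_tmul x
    have h1 : ∀ x : P, DS (algebraMap K (K ⊗[P] W) (algebraMap P K x)) = algebraMap K (K ⊗[P] W) (DK (algebraMap P K x)) := by
      intro x
      rw [hP, hDS', hDW, hDK, hP]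
    obtain ⟨x, s, hs, he⟩ := hK.surj k
    have h2 := h1 x
    rw [← he, map_mul, Derivation.leibniz, Derivation.leibniz, h1, map_add, smul_eq_mul, smul_eq_mul, smul_eq_mul, smul_eq_mul,
      map_mul, map_mul] at h2
    exact (hs.map (algebraMap K (K ⊗[P] W))).mul_left_cancel (add_left_cancel h2)
  · rw [h0, smul_zero] at key
    exact hD (hi (key.symm.trans (map_zero _).symm))

def QQ (p : ℕ) (V : Type*) [CommRing V] : Prop := ∀ a : V, (∀ b, b ^ p ≠ a) → ∃ D : Derivation ℤ V V, D a ≠ 0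

theorem QQ.poly {p : ℕ} {V : Type*} [CommRing V] [IsDomain V] [hp : ExpChar V p] (h : QQ p V) : QQ p V[X] := by
  intro a ha
  rcases hp with _ | hq
  · exact absurd (pow_one a) (ha a)
  by_contra! hD
  have h1 : derivative a = 0 := hD (derivative'.restrictScalars ℤ)
  haveI : ExpChar V p := .prime hq
  have h2 : ∀ i, ∃ b, b ^ p = a.coeff i := by
    intro i
    by_contra! hi
    obtain ⟨D, hDi⟩ := h _ hi
    apply hDi
    have h1 := cd_coeff D a i
    have h2 : cd D a = 0 := hD (cd D)
    rw [← h1, h2, coeff_zero]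
  have h3 := expand_contract p h1 hq.ne_zero
  choose g hg using h2
  let b : V[X] := ∑ i ∈ (contract p a).support, monomial i (g (i * p))
  apply ha b
  have : b.map (frobenius V p) = contract p a := by
    conv_rhs => rw [(contract p a).as_sum_support]
    rw [Polynomial.map_sum]
    refine Finset.sum_congr rfl fun i _ => ?_
    rw [map_monomial, frobenius_def, hg, coeff_contract hq.ne_zero]
  rw [← h3, ← this, ← map_expand, map_frobenius_expand]

theorem QQ.equiv {p : ℕ} {V V' : Type*} [CommRing V] [CommRing V'] (e : V ≃+* V') (h : QQ p V) : QQ p V' := by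
  intro a ha
  obtain ⟨D, hD⟩ := h (e.symm a) (fun b hb => ha (e b) (by rw [← map_pow, hb, e.apply_symm_apply]))
  refine ⟨Derivation.mk' ((e : V →+ V').comp ((D : V →+ V).comp (e.symm : V' →+ V))).toIntLinearMap (fun x y => ?_), fun h0 => ?_⟩
  · change e (D (e.symm (x * y))) = x * e (D (e.symm y)) + y * e (D (e.symm x))
    simp
  · exact hD ((map_eq_zero_iff e e.injective).1 h0)

theorem tlift {A B C Y : Type*} [CommRing A] [CommRing B] [CommRing C] [CommRing Y] [Algebra A B] [Algebra A C] (j1 : B →+* Y) (j2 : C →+* Y)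
    (h : ∀ a, j1 (algebraMap A B a) = j2 (algebraMap A C a)) : ∃ g : B ⊗[A] C →+* Y, ∀ b c, g (b ⊗ₜ c) = j1 b * j2 c := by
  letI : Algebra A Y := (j1.comp (algebraMap A B)).toAlgebra
  let k1 : B →ₐ[A] Y := { j1 with commutes' := fun r => rfl }
  let k2 : C →ₐ[A] Y := { j2 with commutes' := fun r => (h r).symm }
  let g : B ⊗[A] C →ₐ[A] Y := Algebra.TensorProduct.lift k1 k2 (fun _ _ => Commute.all _ _)
  exact ⟨g, fun b c => Algebra.TensorProduct.lift_tmul k1 k2 (fun _ _ => Commute.all _ _) b c⟩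

theorem quot_tensor_aux {V C0 W L : Type u} [CommRing V] [CommRing C0]
    [Algebra V[X] C0] [CommRing W] [Algebra C0 W] (hl : IsLoc (algebraMap V[X] C0))
    [CommRing L] [Algebra V L] [Algebra V[X] L] [IsScalarTower V V[X] L] [Algebra C0 L] [IsScalarTower V[X] C0 L]
    [Algebra V W] [Algebra V[X] W] [IsScalarTower V V[X] W] [IsScalarTower V[X] C0 W] :
    Nonempty (((L ⊗[V] W) ⧸ Ideal.span {algebraMap V[X] L X ⊗ₜ[V] (1 : W) - (1 : L) ⊗ₜ[V] algebraMap V[X] W X}) ≃+* L ⊗[C0] W) := by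
  set J := Ideal.span {algebraMap V[X] L X ⊗ₜ[V] (1 : W) - (1 : L) ⊗ₜ[V] algebraMap V[X] W X} with hJ
  let Y := (L ⊗[V] W) ⧸ J
  let j1 : L →+* Y := (Ideal.Quotient.mk J).comp (Algebra.TensorProduct.includeLeftRingHom)
  let j2 : W →+* Y := (Ideal.Quotient.mk J).comp (Algebra.TensorProduct.includeRight : W →ₐ[V] L ⊗[V] W).toRingHom
  have hj : j1.comp (algebraMap C0 L) = j2.comp (algebraMap C0 W) := by
    apply hl.hom_ext
    rw [RingHom.comp_assoc _ _ j1, RingHom.comp_assoc _ _ j2, ← IsScalarTower.algebraMap_eq, ← IsScalarTower.algebraMap_eq]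
    apply Polynomial.ringHom_ext
    · intro a
      have h1 : algebraMap V[X] L (C a) = algebraMap V L a := (IsScalarTower.algebraMap_apply V V[X] L a).symm
      have h2 : algebraMap V[X] W (C a) = algebraMap V W a := (IsScalarTower.algebraMap_apply V V[X] W a).symm
      change j1 (algebraMap V[X] L (C a)) = j2 (algebraMap V[X] W (C a))
      rw [h1, h2]
      exact congrArg (Ideal.Quotient.mk J) (Algebra.TensorProduct.tmul_one_eq_one_tmul a)
    · exact Ideal.Quotient.eq.2 (Ideal.mem_span_singleton_self _)
  obtain ⟨g, hg⟩ := tlift j1 j2 (fun r => RingHom.congr_fun hj r)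
  letI : Algebra V C0 := ((algebraMap V[X] C0).comp C).toAlgebra
  haveI : IsScalarTower V C0 L := IsScalarTower.of_algebraMap_eq (fun r => by
    rw [IsScalarTower.algebraMap_apply V V[X] L, IsScalarTower.algebraMap_apply V[X] C0 L]; rfl)
  haveI : IsScalarTower V C0 W := IsScalarTower.of_algebraMap_eq (fun r => by
    rw [IsScalarTower.algebraMap_apply V V[X] W, IsScalarTower.algebraMap_apply V[X] C0 W]; rfl)
  let h0 : L ⊗[V] W →ₐ[V] L ⊗[C0] W := Algebra.TensorProduct.lift
    ((Algebra.TensorProduct.includeLeft : L →ₐ[C0] L ⊗[C0] W).restrictScalars V)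
    ((Algebra.TensorProduct.includeRight : W →ₐ[C0] L ⊗[C0] W).restrictScalars V) (fun _ _ => Commute.all _ _)
  have h0t : ∀ l w, h0 (l ⊗ₜ w) = l ⊗ₜ w := fun l w => by simp [h0]
  let h : Y →+* L ⊗[C0] W := Ideal.Quotient.lift J h0.toRingHom (by
    intro a ha
    refine (Ideal.span_le (I := RingHom.ker h0.toRingHom)).2 ?_ ha
    rw [Set.singleton_subset_iff]
    change h0 _ = 0
    rw [map_sub, h0t, h0t, IsScalarTower.algebraMap_apply V[X] C0 L, IsScalarTower.algebraMap_apply V[X] C0 W, sub_eq_zero]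
    exact Algebra.TensorProduct.tmul_one_eq_one_tmul _)
  have hm : ∀ x, h (Ideal.Quotient.mk J x) = h0 x := fun x => rfl
  have hgt : ∀ l w, g (l ⊗ₜ w) = Ideal.Quotient.mk J (l ⊗ₜ w) := fun l w => by
    rw [hg]
    change Ideal.Quotient.mk J (l ⊗ₜ 1) * Ideal.Quotient.mk J (1 ⊗ₜ w) = _
    rw [← map_mul, Algebra.TensorProduct.tmul_mul_tmul, mul_one, one_mul]
  refine ⟨RingEquiv.ofRingHom h g ?_ ?_⟩
  · refine RingHom.ext fun x => ?_
    change h (g x) = x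
    induction x using TensorProduct.induction_on with
    | zero => rw [map_zero, map_zero]
    | add x y hx hy => rw [map_add, map_add, hx, hy]
    | tmul l w => rw [hgt, hm, h0t]
  · apply Ideal.Quotient.ringHom_ext
    refine RingHom.ext fun x => ?_
    change g (h (Ideal.Quotient.mk J x)) = Ideal.Quotient.mk J x
    rw [hm]
    induction x using TensorProduct.induction_on with
    | zero => rw [map_zero, map_zero, map_zero]
    | add x y hx hy => rw [map_add, map_add, hx, hy, map_add]
    | tmul l w => rw [h0t, hgt]

theorem core2 {V C0 W L : Type u} [CommRing V] [hV : IsRegularLocalRing V] (q : ℕ) [ExpChar V q] (hQ : QQ q V) [CommRing C0] [IsLocalRing C0]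
    [Algebra V[X] C0] [CommRing W] [Algebra C0 W] (hl : IsLoc (algebraMap V[X] C0)) (hW : IsComp (algebraMap C0 W) (maximalIdeal C0))
    [Field L] [Algebra V L] [Algebra V[X] L] [IsScalarTower V V[X] L] [Algebra C0 L] [IsScalarTower V[X] C0 L]
    (hi : Function.Injective (algebraMap V L)) (hL : FinRes C0 L) : IsRegularRing (L ⊗[C0] W) := by
  haveI : IsRegularRing V := serre V
  haveI : IsDomain V := reg_domain V
  haveI : IsRegularRing C0 := hl.regular
  haveI : IsNoetherianRing C0 := hl.noeth
  haveI := IsRegularLocalRing.of_isRegularRing_of_isLocalRing C0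
  haveI := hW.regular
  haveI : IsRegularRing W := serre W
  haveI : ExpChar L q := expChar_of_injective_ringHom hi q
  have hder : ∀ D : Derivation ℤ V[X] V[X], ∃ D' : Derivation ℤ W W, ∀ x, D' (algebraMap C0 W (algebraMap V[X] C0 x)) =
      algebraMap C0 W (algebraMap V[X] C0 (D x)) := by
    intro D
    obtain ⟨D1, h1⟩ := hl.deriv D
    obtain ⟨D2, h2⟩ := hW.deriv D1
    exact ⟨D2, fun x => (h2 _).trans (congrArg _ (h1 x))⟩
  letI : Algebra V[X] W := ((algebraMap C0 W).comp (algebraMap V[X] C0)).toAlgebra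
  haveI : IsScalarTower V[X] C0 W := IsScalarTower.of_algebraMap_eq (fun r => rfl)
  letI : Algebra V W := ((algebraMap V[X] W).comp C).toAlgebra
  haveI : IsScalarTower V V[X] W := IsScalarTower.of_algebraMap_eq (fun r => rfl)
  have step : ∀ (P : Type u) [CommRing P] [IsDomain P] [Algebra P W] [Algebra P L] (_ : Function.Injective (algebraMap P L))
    (_ : FinRes P L) (_ : PP q (algebraMap P W)), IsRegularRing (L ⊗[P] W) := by
    intro P _ _ _ _ hPi hPL hPP
    let K : Subfield L := Kf P L
    have hmem : ∀ x : P, algebraMap P L x ∈ K := fun x => Subfield.subset_closure ⟨x, rfl⟩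
    letI : Algebra P K := ((algebraMap P L).codRestrict K hmem).toAlgebra
    haveI : IsScalarTower P K L := IsScalarTower.of_algebraMap_eq (fun r => rfl)
    haveI : Module.Finite K L := hPL
    have hPK : Function.Injective (algebraMap P K) := fun x y hxy => hPi (congrArg Subtype.val hxy)
    have hK : IsLoc (algebraMap P K) := by
      refine ⟨fun y => ?_, fun x hx => ⟨1, by simp, ?_⟩⟩
      · obtain ⟨a, b, hb, he⟩ := mem_Kf.1 y.2
        refine ⟨a, b, IsUnit.mk0 _ (fun h => hb (congrArg Subtype.val h)), Subtype.ext ?_⟩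
        change y.1 * algebraMap P L b = algebraMap P L a
        rw [he, div_mul_cancel₀ _ hb]
      · rw [one_mul]; exact hPK (hx.trans (map_zero _).symm)
    haveI : ExpChar K q := RingHom.expChar (algebraMap K L) (algebraMap K L).injective q
    have hpp := pp_frac hK hPK q hPP (W := W)
    haveI := (hK.incl (W := W)).regular
    haveI := claim (L := L) q hpp
    exact IsRegularRing.of_ringEquiv (Algebra.TensorProduct.cancelBaseChange P K L L W).toRingEquiv
  have hLX := hL.loc hl
  by_cases hinj : Function.Injective (algebraMap V[X] L)
  · haveI : ExpChar V[X] q := inferInstance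
    have h1 := step V[X] hinj hLX (fun a ha => by
      obtain ⟨D, hD⟩ := hQ.poly a ha
      exact ⟨D, hder D, hD⟩)
    haveI := hl.isLoc'
    exact IsRegularRing.of_ringEquiv (IsLocalization.algebraTensorEquiv ((IsUnit.submonoid C0).comap (algebraMap V[X] C0)) C0 L W).symm.toRingEquiv
  · have hVL : FinRes V L := by
      obtain ⟨P, hP0, hP⟩ : ∃ P : V[X], P ≠ 0 ∧ algebraMap V[X] L P = 0 := by
        rw [injective_iff_map_eq_zero] at hinj
        push Not at hinj
        obtain ⟨P, h1, h2⟩ := hinj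
        exact ⟨P, h2, h1⟩
      let t := algebraMap V[X] L X
      let K : Subfield L := Kf V L
      have hmem : ∀ x : V, algebraMap V L x ∈ K := fun x => Subfield.subset_closure ⟨x, rfl⟩
      let i : V →+* K := (algebraMap V L).codRestrict K hmem
      have hev : ∀ R : V[X], aeval t (R.map i) = algebraMap V[X] L R := by
        intro R
        have : (aeval t : K[X] →ₐ[K] L).toRingHom.comp (mapRingHom i) = algebraMap V[X] L := by
          apply Polynomial.ringHom_ext
          · intro a
            have h1 : algebraMap V[X] L (C a) = algebraMap V L a := (IsScalarTower.algebraMap_apply V V[X] L a).symm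
            rw [h1]
            simp
            rfl
          · simp [t]
        exact RingHom.congr_fun this R
      have halg : IsAlgebraic K t := ⟨P.map i, (Polynomial.map_ne_zero_iff (fun x y hxy => hi (congrArg Subtype.val hxy))).2 hP0, by
        rw [hev, hP]⟩
      haveI : FiniteDimensional K (IntermediateField.adjoin K {t}) := IntermediateField.adjoin.finiteDimensional halg.isIntegral
      haveI : Module.Finite (Kf V[X] L) L := hLX
      haveI : Module.Finite (IntermediateField.adjoin K {t}) L := by
        refine fin_of_range_le (F1 := Kf V[X] L) (fun x => ?_)
        have hm : ∀ R : V[X], algebraMap V[X] L R ∈ IntermediateField.adjoin K {t} := fun R => by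
          rw [← hev]
          exact (IntermediateField.algebra_adjoin_le_adjoin K {t}) (aeval_mem_adjoin_singleton K t)
        obtain ⟨a, b, -, h⟩ := mem_Kf.1 x.2
        exact ⟨⟨x.1, h ▸ div_mem (hm a) (hm b)⟩, rfl⟩
      exact Module.Finite.trans (R := K) (IntermediateField.adjoin K {t}) L
    haveI := step V hi hVL (fun a ha => by
      obtain ⟨D, hD⟩ := hQ a ha
      obtain ⟨D', hD'⟩ := hder (cd D)
      exact ⟨D, ⟨D', fun e => (hD' _).trans (by rw [cd_C]; rfl)⟩, hD⟩)
    let t := algebraMap V[X] L X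
    let τ := algebraMap V[X] W X
    let F : L ⊗[V] W := t ⊗ₜ 1 - 1 ⊗ₜ τ
    haveI : IsRegularRing ((L ⊗[V] W) ⧸ Ideal.span {F}) := by
      refine regular_hyp F fun q hq _ => ?_
      obtain ⟨D, hD⟩ := hder (derivative'.restrictScalars ℤ)
      obtain ⟨D', hD'⟩ := der_bc (L := L) (V := V) D (fun v => (hD (C v)).trans (by simp))
      refine ⟨D', ?_⟩
      have h1 : D τ = 1 := (hD X).trans (by simp)
      change D' (t ⊗ₜ 1 - 1 ⊗ₜ τ) ∉ q
      rw [Derivation.map_sub, hD', hD', h1, Derivation.map_one_eq_zero, tmul_zero, zero_sub, neg_mem_iff]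
      exact fun h => hq.ne_top ((Ideal.eq_top_iff_one q).2 h)
    obtain ⟨e⟩ := quot_tensor_aux (W := W) (L := L) hl
    exact IsRegularRing.of_ringEquiv e


def Coh (D : Type u) [CommRing D] [IsLocalRing D] : Prop := ∃ (V : Type u) (_ : CommRing V) (_ : Algebra V D), IsRegularLocalRing V ∧
  Module.Finite V D ∧ Function.Injective (algebraMap V D) ∧ (∀ d : D, ∃ v, d - algebraMap V D v ∈ maximalIdeal D) ∧
  ∃ q, ExpChar V q ∧ QQ q V

theorem fin_loc {V D C0 C : Type u} [CommRing V] [IsLocalRing V] [CommRing D] [IsLocalRing D] [CommRing C0] [IsLocalRing C0] [CommRing C]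
    [IsLocalRing C] [Algebra V D] [Algebra V C0] [Module.Finite V D] [Algebra C0 C] (hVC : IsLocalHom (algebraMap V C0))
    [hCC : IsLocalHom (algebraMap C0 C)] (j : D →+* C) [hj : IsLocalHom j] (hc : ∀ v, algebraMap C0 C (algebraMap V C0 v) = j (algebraMap V D v))
    (hr : ∀ d : D, ∃ v, d - algebraMap V D v ∈ maximalIdeal D)
    (N : Subring C) (hN0 : ∀ x : C0, algebraMap C0 C x ∈ N) (hNj : ∀ d, j d ∈ N)
    (hN : ∀ N' : Subring C, (∀ x : C0, algebraMap C0 C x ∈ N') → (∀ d, j d ∈ N') → N ≤ N')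
    (hs : ∀ c : C, ∃ x ∈ N, ∃ s ∈ N, IsUnit s ∧ c * s = x) : Module.Finite C0 C := by
  let P := C0 ⊗[V] D
  obtain ⟨π, hπ⟩ := tlift (algebraMap C0 C) j hc
  let I : Ideal P := (maximalIdeal D).map (Algebra.TensorProduct.includeRight : D →ₐ[V] P).toRingHom
  have hdec : ∀ x : P, ∃ x0 : C0, x - x0 ⊗ₜ 1 ∈ I := by
    intro x
    induction x using TensorProduct.induction_on with
    | zero => exact ⟨0, by simp⟩
    | add x y hx hy =>
      obtain ⟨a, ha⟩ := hx
      obtain ⟨b, hb⟩ := hy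
      refine ⟨a + b, ?_⟩
      rw [TensorProduct.add_tmul, add_sub_add_comm]
      exact add_mem ha hb
    | tmul c d =>
      obtain ⟨v, hv⟩ := hr d
      refine ⟨c * algebraMap V C0 v, ?_⟩
      have : c ⊗ₜ[V] d - (c * algebraMap V C0 v) ⊗ₜ 1 = (c ⊗ₜ 1) * (1 ⊗ₜ (d - algebraMap V D v) : P) := by
        rw [Algebra.TensorProduct.tmul_mul_tmul, one_mul, mul_one, TensorProduct.tmul_sub, mul_comm c, ← Algebra.smul_def,
          TensorProduct.smul_tmul, Algebra.algebraMap_eq_smul_one]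
      rw [this]
      exact Ideal.mul_mem_left _ _ (Ideal.mem_map_of_mem (Algebra.TensorProduct.includeRight : D →ₐ[V] P).toRingHom hv)
  have hI : I ≤ (maximalIdeal C).comap π := by
    rw [Ideal.map_le_iff_le_comap]
    intro d hd
    change π (1 ⊗ₜ d) ∈ maximalIdeal C
    rw [hπ, map_one, one_mul]
    exact ((local_hom_TFAE j).out 0 2 :).1 hj (Ideal.mem_map_of_mem _ hd)
  have hmax : ∀ (𝔪 : Ideal P) [𝔪.IsMaximal], I ≤ 𝔪 ∧ 𝔪.comap (algebraMap C0 P) = maximalIdeal C0 := by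
    intro 𝔪 _
    have h1 : 𝔪.comap (algebraMap C0 P) = maximalIdeal C0 :=
      IsLocalRing.eq_maximalIdeal (Ideal.isMaximal_comap_of_isIntegral_of_isMaximal 𝔪)
    refine ⟨?_, h1⟩
    let i : D →+* P := (Algebra.TensorProduct.includeRight : D →ₐ[V] P).toRingHom
    have h2 : (𝔪.comap i).comap (algebraMap V D) = maximalIdeal V := by
      have : i.comp (algebraMap V D) = (algebraMap C0 P).comp (algebraMap V C0) := by
        ext v
        exact (Algebra.TensorProduct.tmul_one_eq_one_tmul v).symm
      rw [Ideal.comap_comap, this, ← Ideal.comap_comap, h1]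
      exact ((local_hom_TFAE (algebraMap V C0)).out 0 4 :).1 hVC
    haveI : ((𝔪.comap i).comap (algebraMap V D)).IsMaximal := by rw [h2]; infer_instance
    have h3 := Ideal.isMaximal_of_isIntegral_of_isMaximal_comap (R := V) (𝔪.comap i) this
    rw [Ideal.map_le_iff_le_comap]
    exact (IsLocalRing.eq_maximalIdeal h3).ge
  have hu : ∀ x : P, IsUnit (π x) → IsUnit x := by
    intro x hx
    by_contra hnu
    obtain ⟨𝔪, _, hm⟩ := exists_max_ideal_of_mem_nonunits hnu
    obtain ⟨h1, h2⟩ := hmax 𝔪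
    obtain ⟨x0, hx0⟩ := hdec x
    have h3 : x0 ∈ maximalIdeal C0 := by
      rw [← h2]
      have := sub_mem hm (h1 hx0)
      rwa [sub_sub_cancel] at this
    have h4 : π (x0 ⊗ₜ 1) ∈ maximalIdeal C := by
      rw [hπ, map_one, mul_one]
      exact ((local_hom_TFAE (algebraMap C0 C)).out 0 2 :).1 hCC (Ideal.mem_map_of_mem _ h3)
    have h5 : π x ∈ maximalIdeal C := by
      have := add_mem (show π (x - x0 ⊗ₜ 1) ∈ maximalIdeal C from hI hx0) h4
      rwa [← map_add, sub_add_cancel] at this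
    exact h5 hx
  have hNr : N ≤ π.range := hN _ (fun x => ⟨x ⊗ₜ 1, by rw [hπ, map_one, mul_one]⟩) (fun d => ⟨1 ⊗ₜ d, by rw [hπ, map_one, one_mul]⟩)
  have hsurj : Function.Surjective π := by
    intro c
    obtain ⟨x, hx, s, hs, hsu, he⟩ := hs c
    obtain ⟨x, rfl⟩ := hNr hx
    obtain ⟨s, rfl⟩ := hNr hs
    obtain ⟨t, ht⟩ := (hu s hsu).exists_right_inv
    refine ⟨x * t, ?_⟩
    rw [map_mul, ← he, mul_assoc, ← map_mul, ht, map_one, mul_one]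
  let πl : P →ₗ[C0] C := LinearMap.mk ⟨π, π.map_add⟩ (fun c x => by
    change π (c • x) = c • π x
    rw [Algebra.smul_def, Algebra.smul_def, map_mul]
    congr 1
    change π (c ⊗ₜ 1) = _
    rw [hπ, map_one, mul_one])
  exact Module.Finite.of_surjective πl hsurj

theorem core (coh : ∀ (D : Type u) [CommRing D] [IsDomain D] [IsNoetherianRing D] [IsLocalRing D] [IsAdicComplete (maximalIdeal D) D], Coh D)
    {D C W L : Type u} [CommRing D] [IsDomain D] [IsNoetherianRing D] [IsLocalRing D] [IsAdicComplete (maximalIdeal D) D]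
    [CommRing C] [IsLocalRing C] [IsNoetherianRing C] [CommRing W] [Algebra C W] (hW : IsComp (algebraMap C W) (maximalIdeal C)) (f : D[X] →+* C)
    (hs : ∀ c, ∃ x s, IsUnit (f s) ∧ c * f s = f x) (hl : IsLocalHom (f.comp Polynomial.C)) [Field L] [Algebra C L]
    (hL : FinRes C L) (hi : Function.Injective ((algebraMap C L).comp (f.comp Polynomial.C))) : IsRegularRing (L ⊗[C] W) := by
  obtain ⟨V, _, _, hV, hfin, hinj, hres, q, hq, hQ⟩ := coh D
  let g : V[X] →+* C := f.comp (mapRingHom (algebraMap V D))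
  let Q := (maximalIdeal C).comap g
  let C0 := Localization.AtPrime Q
  have hl0 : IsLoc (algebraMap V[X] C0) := IsLoc.of_isLocalization Q.primeCompl
  have hgu : ∀ x, IsUnit (g x) ↔ x ∈ Q.primeCompl := by
    intro x
    change _ ↔ ¬ (g x ∈ maximalIdeal C)
    rw [mem_maximalIdeal, mem_nonunits_iff, not_not]
  let h : C0 →+* C := IsLocalization.lift (M := Q.primeCompl) (g := g) (fun y => (hgu _).2 y.2)
  have hh : ∀ x, h (algebraMap V[X] C0 x) = g x := fun x => IsLocalization.lift_eq _ x
  letI : Algebra C0 C := h.toAlgebra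
  have hCC : IsLocalHom (algebraMap C0 C) := by
    constructor
    intro b hb
    obtain ⟨x, s, hs, he⟩ := hl0.surj b
    have h1 : IsUnit (h (algebraMap V[X] C0 x)) := by rw [← he, map_mul]; exact hb.mul (hs.map h)
    rw [hh, hgu] at h1
    have h3 : IsUnit (algebraMap V[X] C0 x) := IsLocalization.map_units C0 (⟨x, h1⟩ : Q.primeCompl)
    rw [← he] at h3
    exact isUnit_of_mul_isUnit_left h3
  letI : Algebra V C0 := ((algebraMap V[X] C0).comp Polynomial.C).toAlgebra
  have hloc : IsLocalHom (algebraMap V D) := by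
    rw [((local_hom_TFAE (algebraMap V D)).out 0 4 :)]
    exact IsLocalRing.eq_maximalIdeal (Ideal.isMaximal_comap_of_isIntegral_of_isMaximal _)
  have hc : ∀ v, h (algebraMap V C0 v) = f.comp Polynomial.C (algebraMap V D v) := by
    intro v
    refine (hh _).trans ?_
    change f ((Polynomial.C v).map _) = _
    rw [Polynomial.map_C]; rfl
  have hVC : IsLocalHom (algebraMap V C0) := by
    constructor
    intro v hv
    have h1 := hv.map h
    rw [hc] at h1
    exact hloc.map_nonunit _ (hl.map_nonunit _ h1)
  haveI : Module.Finite C0 C := by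
    refine fin_loc hVC (f.comp Polynomial.C) hc hres (h.range ⊔ (f.comp Polynomial.C).range)
      (fun x => (le_sup_left : h.range ≤ _) ⟨x, rfl⟩) (fun x => (le_sup_right : (f.comp Polynomial.C).range ≤ _) ⟨x, rfl⟩)
      (fun N' h1 h2 => sup_le ?_ ?_) (fun c => ?_)
    · rintro _ ⟨x, rfl⟩; exact h1 x
    · rintro _ ⟨x, rfl⟩; exact h2 x
    · have hm : ∀ x : D[X], f x ∈ h.range ⊔ (f.comp Polynomial.C).range := by
        intro x
        rw [x.as_sum_support_C_mul_X_pow, map_sum]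
        refine sum_mem fun i _ => ?_
        rw [map_mul, map_pow]
        refine mul_mem ((le_sup_right : (f.comp Polynomial.C).range ≤ _) ⟨_, rfl⟩) (pow_mem ((le_sup_left : h.range ≤ _) ⟨algebraMap V[X] C0 X, ?_⟩) _)
        rw [hh]
        change f (X.map _) = _
        rw [map_X]
      obtain ⟨x, s, h1, h2⟩ := hs c
      exact ⟨_, hm x, _, hm s, h1, h2⟩
  haveI : IsRegularRing V := serre V
  haveI : IsNoetherianRing C0 := hl0.noeth
  obtain ⟨W0, _, _, hW0⟩ : ∃ (W : Type u) (_ : CommRing W) (_ : Algebra C0 W), IsComp (algebraMap C0 W) (maximalIdeal C0) :=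
    ⟨AdicCompletion (maximalIdeal C0) C0, inferInstance, inferInstance, IsComp.adic _ (IsNoetherian.noetherian _)⟩
  letI : Algebra C0 L := ((algebraMap C L).comp h).toAlgebra
  haveI : IsScalarTower C0 C L := IsScalarTower.of_algebraMap_eq (fun r => rfl)
  rw [← fin_reg hW0 hW L]
  letI : Algebra V[X] L := ((algebraMap C0 L).comp (algebraMap V[X] C0)).toAlgebra
  haveI : IsScalarTower V[X] C0 L := IsScalarTower.of_algebraMap_eq (fun r => rfl)
  letI : Algebra V L := ((algebraMap V[X] L).comp Polynomial.C).toAlgebra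
  haveI : IsScalarTower V V[X] L := IsScalarTower.of_algebraMap_eq (fun r => rfl)
  refine core2 q hQ hl0 hW0 ?_ (hL.of_finite (C0 := C0))
  have : (algebraMap V L : V → L) = ((algebraMap C L).comp (f.comp Polynomial.C)) ∘ algebraMap V D := by
    ext v
    exact congrArg (algebraMap C L) (hc v)
  rw [this]
  exact hi.comp hinj

theorem mainC (coh : ∀ (D : Type u) [CommRing D] [IsDomain D] [IsNoetherianRing D] [IsLocalRing D] [IsAdicComplete (maximalIdeal D) D], Coh D)
    (A C' : Type u) [CommRing A] [IsNoetherianRing A] [IsLocalRing A] [IsAdicComplete (maximalIdeal A) A]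
      [CommRing C'] [IsLocalRing C'] (f : A[X] →+* C') (hf : IsLoc f) (hl : IsLocalHom (f.comp C)) : HG C' := by
  intro L _ _ hL
  haveI : IsNoetherianRing C' := hf.noeth
  let i := (algebraMap C' L).comp (f.comp C)
  let p := RingHom.ker i
  haveI : p.IsPrime := RingHom.ker_isPrime i
  let D := A ⧸ p
  haveI : IsLocalRing D := IsLocalRing.of_surjective' (Ideal.Quotient.mk p) Ideal.Quotient.mk_surjective
  have hmD : (maximalIdeal A).map (algebraMap A D) = maximalIdeal D :=
    (max_quot p).symm
  haveI : IsAdicComplete (maximalIdeal D) D := by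
    rw [← hmD]
    exact (IsAdicComplete.map_algebraMap_iff (S := D) _ _).2 (complete_finite _ inferInstance _)
  let J := p.map (f.comp C)
  have hJL : ∀ a ∈ J, algebraMap C' L a = 0 := by
    have : J ≤ RingHom.ker (algebraMap C' L) := Ideal.map_le_iff_le_comap.2 (fun a ha => ha)
    exact this
  let C1 := C' ⧸ J
  haveI : Nontrivial C1 := Ideal.Quotient.nontrivial_iff.2 (fun h => one_ne_zero ((map_one _).symm.trans (hJL 1 (h ▸ trivial))))
  haveI : IsLocalRing C1 := IsLocalRing.of_surjective' (Ideal.Quotient.mk J) Ideal.Quotient.mk_surjective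
  obtain ⟨W, _, _, hW⟩ : ∃ (W : Type u) (_ : CommRing W) (_ : Algebra C1 W), IsComp (algebraMap C1 W) (maximalIdeal C1) :=
    ⟨AdicCompletion (maximalIdeal C1) C1, inferInstance, inferInstance, IsComp.adic _ (IsNoetherian.noetherian _)⟩
  letI : Algebra C1 L := (Ideal.Quotient.lift J (algebraMap C' L) hJL).toAlgebra
  haveI : IsScalarTower C' C1 L := IsScalarTower.of_algebraMap_eq (fun r => rfl)
  have hiC := IsComp.adic (maximalIdeal C') (IsNoetherian.noetherian _)
  rw [fin_reg hiC hW L]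
  let j : D →+* C1 := Ideal.Quotient.lift p ((Ideal.Quotient.mk J).comp (f.comp C)) (fun a ha =>
    Ideal.Quotient.eq_zero_iff_mem.2 (Ideal.mem_map_of_mem _ ha))
  let g : D[X] →+* C1 := eval₂RingHom j (Ideal.Quotient.mk J (f X))
  have hg : ∀ x, g (x.map (Ideal.Quotient.mk p)) = Ideal.Quotient.mk J (f x) := by
    intro x
    have : g.comp (mapRingHom (Ideal.Quotient.mk p)) = (Ideal.Quotient.mk J).comp f := by
      apply Polynomial.ringHom_ext
      · intro a
        simp [g]
        rfl
      · simp [g]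
    exact RingHom.congr_fun this x
  have hgC : g.comp C = j := by ext; simp [g]
  refine core coh hW g (fun c => ?_) ?_ (FinRes.mono hL fun x => Subfield.subset_closure ⟨Ideal.Quotient.mk J x, rfl⟩) ?_
  · obtain ⟨c, rfl⟩ := Ideal.Quotient.mk_surjective c
    obtain ⟨x, s, h1, h2⟩ := hf.surj c
    refine ⟨x.map (Ideal.Quotient.mk p), s.map (Ideal.Quotient.mk p), ?_, ?_⟩
    · rw [hg]; exact h1.map _
    · rw [hg, hg, ← h2, map_mul]
  · rw [hgC, ((local_hom_TFAE j).out 0 2 :), ← hmD, Ideal.map_map]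
    have : j.comp (algebraMap A D) = (Ideal.Quotient.mk J).comp (f.comp C) := by ext; rfl
    rw [this, ← Ideal.map_map, max_quot J]
    exact Ideal.map_mono (((local_hom_TFAE (f.comp C)).out 0 2 :).1 hl)
  · rw [hgC, injective_iff_map_eq_zero]
    intro a ha
    obtain ⟨a, rfl⟩ := Ideal.Quotient.mk_surjective a
    exact Ideal.Quotient.eq_zero_iff_mem.2 ha


theorem irr_of_not {p : ℕ} (hp : p.Prime) {K : Type*} [Field K] [CharP K p] (M : Subfield K) (h : ∀ x : K, x ^ p ∈ M) {y : K}
    (hy : y ∉ M) : minpoly M y = X ^ p - C ⟨y ^ p, h y⟩ := by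
  haveI := Fact.mk hp
  refine (minpoly.eq_of_irreducible_of_monic (X_pow_sub_C_irreducible_of_prime hp ?_) ?_ (monic_X_pow_sub_C _ hp.ne_zero)).symm
  · intro b hb
    have := congrArg Subtype.val hb
    have h1 : (b : K) = y := frobenius_inj K p this
    exact hy (h1 ▸ b.2)
  · simp [Subfield.algebraMap_ofSubfield]

theorem field_der {p : ℕ} (hp : p.Prime) {K : Type*} [Field K] [CharP K p] : QQ p K := by
  haveI := Fact.mk hp
  intro x hx
  obtain ⟨M, hM0, hM⟩ := zorn_le_nonempty₀ {M : Subfield K | (∀ y : K, y ^ p ∈ M) ∧ x ∉ M} (by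
    intro c hc hch N hN
    refine ⟨sSup c, ⟨fun y => ?_, ?_⟩, fun z hz => le_sSup hz⟩
    · exact (le_sSup hN : N ≤ sSup c) ((hc hN).1 y)
    · rw [Subfield.mem_sSup_of_directedOn ⟨N, hN⟩ hch.directedOn]
      rintro ⟨s, hs, hxs⟩
      exact (hc hs).2 hxs) (frobenius K p).fieldRange
        ⟨fun y => ⟨y, rfl⟩, fun ⟨y, hy⟩ => hx y hy⟩
  obtain ⟨hMp, hxM⟩ := hM.prop
  have hint : ∀ y : K, IsIntegral M y := fun y =>
    IsIntegral.of_pow hp.pos (isIntegral_algebraMap (x := (⟨y ^ p, hMp y⟩ : M)))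
  have hdeg : ∀ y, y ∉ M → Module.finrank M (IntermediateField.adjoin M {y}) = p := fun y hy => by
    rw [IntermediateField.adjoin.finrank (hint y), irr_of_not hp M hMp hy, natDegree_X_pow_sub_C]
  have htop : ∀ y, y ∈ IntermediateField.adjoin M {x} := by
    intro y
    by_cases hy : y ∈ M
    · exact (IntermediateField.adjoin M {x}).algebraMap_mem ⟨y, hy⟩
    have hle : M ≤ (IntermediateField.adjoin M {y}).toSubfield := fun z hz => (IntermediateField.adjoin M {y}).algebraMap_mem ⟨z, hz⟩
    have hxy : x ∈ IntermediateField.adjoin M {y} := by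
      by_contra hxy
      exact hy (hM.le_of_ge (y := (IntermediateField.adjoin M {y}).toSubfield) ⟨fun z => hle (hMp z), hxy⟩ hle
        (IntermediateField.mem_adjoin_simple_self M y))
    haveI := IntermediateField.adjoin.finiteDimensional (hint y)
    have := IntermediateField.eq_of_le_of_finrank_eq (F := IntermediateField.adjoin M {x}) (E := IntermediateField.adjoin M {y})
      (IntermediateField.adjoin_simple_le_iff.2 hxy) (by rw [hdeg x hxM, hdeg y hy])
    rw [this]; exact IntermediateField.mem_adjoin_simple_self M y
  let f : M[X] →ₐ[ℤ] K := (aeval (R := M) x).toRingHom.toIntAlgHom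
  have hf : ∀ P, f P = aeval x P := fun P => rfl
  have hs : Function.Surjective f := by
    intro y
    have h1 := htop y
    rw [← IntermediateField.mem_toSubalgebra, IntermediateField.adjoin_simple_toSubalgebra_of_isAlgebraic (hint x).isAlgebraic, Algebra.adjoin_singleton_eq_range_aeval] at h1
    exact h1
  let d : Derivation ℤ M[X] M[X] := Derivation.restrictScalars ℤ (Polynomial.derivative' (R := M))
  have hd : ∀ P, d P = derivative P := fun P => rfl
  have hk : ∀ P, f P = 0 → f (d P) = 0 := by
    intro P hP
    rw [hf] at hP ⊢
    obtain ⟨Q, rfl⟩ := minpoly.dvd M x hP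
    haveI : CharP M p := ⟨fun n => by rw [← CharP.cast_eq_zero_iff K p n, ← map_natCast (algebraMap M K), map_eq_zero]⟩
    rw [hd, derivative_mul, map_add, map_mul _ (minpoly M x), minpoly.aeval, irr_of_not hp M hMp hxM]
    simp [derivative_X_pow]
  refine ⟨Derivation.liftOfSurjective hs hk, ?_⟩
  have h2 : _ := Derivation.liftOfSurjective_apply hs hk X
  have h3 : f X = x := aeval_X x
  have h4 : f (d X) = 1 := by rw [hd, derivative_X, map_one]
  rw [h3, h4] at h2
  rw [h2]; exact one_ne_zero

theorem der_mk {V : Type*} [CommRing V] (L : V →+ V) (h : ∀ a b, L (a * b) = a * L b + b * L a) (a : V)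
    (hD : ∀ D : Derivation ℤ V V, D a = 0) : L a = 0 := hD (Derivation.mk' L.toIntLinearMap h)

theorem mv_der {K σ : Type*} [CommRing K] (d : (σ →₀ ℕ) → K →+ K)
    (h : ∀ m n a b, d (m + n) (a * b) = a * d n b + b * d m a) :
    ∃ L : MvPowerSeries σ K →+ MvPowerSeries σ K, (∀ a b, L (a * b) = a * L b + b * L a) ∧
      ∀ f m, MvPowerSeries.coeff m (L f) = d m (MvPowerSeries.coeff m f) := by
  classical
  let L : MvPowerSeries σ K →+ MvPowerSeries σ K := AddMonoidHom.mk' (fun f m => d m (MvPowerSeries.coeff m f)) (fun f g => by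
    funext m; exact (congrArg (d m) (map_add _ f g)).trans (map_add _ _ _))
  have hL : ∀ f m, MvPowerSeries.coeff m (L f) = d m (MvPowerSeries.coeff m f) := fun f m => rfl
  refine ⟨L, ?_, hL⟩
  intro a b
  apply MvPowerSeries.ext
  intro m
  rw [hL, mul_comm b, map_add, MvPowerSeries.coeff_mul, MvPowerSeries.coeff_mul, MvPowerSeries.coeff_mul, map_sum, ← Finset.sum_add_distrib]
  refine Finset.sum_congr rfl fun x hx => ?_
  rw [Finset.HasAntidiagonal.mem_antidiagonal] at hx
  rw [← hx, h, hL, hL, mul_comm (MvPowerSeries.coeff x.2 b)]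

theorem QQ.mvps {p : ℕ} (hp : p.Prime) (K : Type*) [Field K] [CharP K p] (σ : Type*) [Finite σ] : QQ p (MvPowerSeries σ K) := by
  haveI := Fact.mk hp
  intro a ha
  by_contra! hD
  have h1 : ∀ m i, MvPowerSeries.coeff m a ≠ 0 → p ∣ m i := by
    intro m i hm
    obtain ⟨D, hl, hD'⟩ := mv_der (K := K) (σ := σ) (fun m => AddMonoidHom.mulLeft ((m i : ℕ) : K)) (fun m n a b => by
      simp; ring)
    have := hD' a m
    rw [der_mk D hl a hD, map_zero] at this
    have h0 := (mul_eq_zero.1 this.symm).resolve_right hm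
    exact (CharP.cast_eq_zero_iff K p _).1 h0
  have h2 : ∀ m, ∃ b : K, b ^ p = MvPowerSeries.coeff m a := by
    intro m
    by_contra! hb
    obtain ⟨δ, hδ⟩ := field_der hp _ hb
    obtain ⟨D, hl, hD'⟩ := mv_der (K := K) (σ := σ) (fun m => (δ : K →+ K)) (fun m n a b => by
      simp)
    apply hδ
    have := hD' a m
    rw [der_mk D hl a hD, map_zero] at this
    exact this.symm
  choose b hb using h2
  let g : MvPowerSeries σ K := fun m => b (p • m)
  have hg : ∀ m, MvPowerSeries.coeff m g = b (p • m) := fun m => rfl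
  refine ha g ?_
  rw [← MvPowerSeries.map_frobenius_expand p hp.ne_zero]
  apply MvPowerSeries.ext
  intro m
  rw [MvPowerSeries.coeff_map]
  by_cases hm : ∀ i, p ∣ m i
  · choose n hn using hm
    obtain rfl : m = p • (Finsupp.equivFunOnFinite.symm n) := by
      ext i; simp [hn]
    rw [MvPowerSeries.coeff_expand_smul, hg, frobenius_def, hb]
  · push Not at hm
    obtain ⟨i, hi⟩ := hm
    rw [MvPowerSeries.coeff_expand_of_not_dvd _ _ _ hi, map_zero]
    by_contra h0
    exact hi (h1 m i (Ne.symm h0))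


theorem sub_field {E k : Type*} [CommRing E] [Field k] (π : E →+* k) (S : Subring E) (hS : ∀ s ∈ S, π s = 0 → s = 0)
    (hi : ∀ s ∈ S, π s ≠ 0 → ∃ t ∈ S, s * t = 1) :
    ∃ (M : Subfield k) (j : M →+* E), (∀ m, π (j m) = m) ∧ (∀ m, j m ∈ S) ∧ ∀ s ∈ S, ∃ m, j m = s := by
  let M : Subfield k := { S.map π with
    inv_mem' := by
      rintro _ ⟨s, hs, rfl⟩
      by_cases h : π s = 0
      · rw [h, inv_zero]; exact (S.map π).zero_mem
      · obtain ⟨t, ht, h1⟩ := hi s hs h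
        refine ⟨t, ht, eq_inv_of_mul_eq_one_right ?_⟩
        rw [← map_mul, h1, map_one] }
  let f : S →+* M := (π.comp S.subtype).codRestrict M (fun s => ⟨s, s.2, rfl⟩)
  have hf : Function.Bijective f := by
    constructor
    · rw [injective_iff_map_eq_zero]
      intro s hs
      exact Subtype.ext (hS s s.2 (congrArg Subtype.val hs))
    · rintro ⟨_, s, hs, rfl⟩
      exact ⟨⟨s, hs⟩, rfl⟩
  let e := RingEquiv.ofBijective f hf
  refine ⟨M, S.subtype.comp e.symm.toRingHom, fun m => ?_, fun m => (e.symm m).2, fun s hs => ⟨e ⟨s, hs⟩, ?_⟩⟩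
  · exact congrArg Subtype.val (e.apply_symm_apply m)
  · exact congrArg Subtype.val (e.symm_apply_apply ⟨s, hs⟩)

theorem sec_core {E k : Type*} [CommRing E] [Field k] (π : E →+* k) (S0 : Subring E) (h0 : ∀ s ∈ S0, π s = 0 → s = 0)
    (hu : ∀ e, π e ≠ 0 → IsUnit e)
    (hlift : ∀ (M : Subfield k) (j : M →+* E), (∀ m, π (j m) = m) → (∀ s ∈ S0, ∃ m, j m = s) →
      ∀ x : k, ∃ y, π y = x ∧ eval₂ j y (minpoly M x) = 0) :
    ∃ S : Subring E, (∀ x, ∃ s ∈ S, π s = x) ∧ ∀ s ∈ S, π s = 0 → s = 0 := by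
  obtain ⟨S, hS0, hS⟩ := zorn_le_nonempty₀ {S : Subring E | S0 ≤ S ∧ ∀ s ∈ S, π s = 0 → s = 0} (by
    intro c hc hch N hN
    refine ⟨sSup c, ⟨(hc hN).1.trans (le_sSup hN), fun s hs => ?_⟩, fun z hz => le_sSup hz⟩
    rw [Subring.mem_sSup_of_directedOn ⟨N, hN⟩ hch.directedOn] at hs
    obtain ⟨T, hT, hs⟩ := hs
    exact (hc hT).2 s hs) S0 ⟨le_rfl, h0⟩
  have hSi := hS.prop.2
  let T : Subring E :=
    { carrier := {d | ∃ t ∈ S, π t ≠ 0 ∧ t * d ∈ S}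
      mul_mem' := by
        rintro a b ⟨t, ht, h1, h2⟩ ⟨t', ht', h1', h2'⟩
        refine ⟨t * t', S.mul_mem ht ht', by rw [map_mul]; exact mul_ne_zero h1 h1', ?_⟩
        have := S.mul_mem h2 h2'
        rwa [mul_mul_mul_comm] at this
      one_mem' := ⟨1, S.one_mem, by simp, by simpa using S.one_mem⟩
      zero_mem' := ⟨1, S.one_mem, by simp, by simpa using S.zero_mem⟩
      add_mem' := by
        rintro a b ⟨t, ht, h1, h2⟩ ⟨t', ht', h1', h2'⟩
        refine ⟨t * t', S.mul_mem ht ht', by rw [map_mul]; exact mul_ne_zero h1 h1', ?_⟩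
        have := S.add_mem (S.mul_mem ht' h2) (S.mul_mem ht h2')
        convert this using 1; ring
      neg_mem' := by
        rintro a ⟨t, ht, h1, h2⟩
        exact ⟨t, ht, h1, by rw [mul_neg]; exact S.neg_mem h2⟩ }
  have hT : T ≤ S := by
    refine hS.le_of_ge (y := T) ⟨?_, ?_⟩ ?_
    · exact fun s hs => ⟨1, S.one_mem, by simp, by simpa using hS0 hs⟩
    · rintro d ⟨t, ht, h1, h2⟩ hd
      have := hSi _ h2 (by rw [map_mul, hd, mul_zero])
      exact ((hu t h1).mul_right_eq_zero).1 this
    · exact fun s hs => ⟨1, S.one_mem, by simp, by simpa using hs⟩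
  obtain ⟨M, j, hj, hjS, hSj⟩ := sub_field π S hSi (fun s hs h => by
    obtain ⟨t, ht⟩ := (hu s h).exists_right_inv
    exact ⟨t, hT ⟨s, hs, h, by rw [ht]; exact S.one_mem⟩, ht⟩)
  refine ⟨S, fun x => ?_, hSi⟩
  obtain ⟨y, rfl, hy⟩ := hlift M j hj (fun s hs => hSj s (hS0 hs)) x
  have hle : S ≤ (eval₂RingHom j y).range := fun s hs => by
    obtain ⟨m, rfl⟩ := hSj s hs
    exact ⟨C m, by simp⟩
  refine ⟨y, hS.le_of_ge (y := (eval₂RingHom j y).range) ⟨hS0.trans hle, ?_⟩ hle ⟨X, by simp⟩, rfl⟩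
  rintro _ ⟨F, rfl⟩ hF
  rw [coe_eval₂RingHom, hom_eval₂] at hF
  have hc : π.comp j = algebraMap M k := by ext m; exact hj m
  rw [hc] at hF
  obtain ⟨G, rfl⟩ := minpoly.dvd M _ hF
  rw [coe_eval₂RingHom, eval₂_mul, hy, zero_mul]

theorem sec_p {p : ℕ} (hp : p.Prime) {E k : Type*} [CommRing E] [Field k] (π : E →+* k) (hπ : Function.Surjective π) (h0 : (p : E) = 0)
    (hk : ∀ x, π x = 0 → x ^ 2 = 0) :
    ∃ S : Subring E, (∀ x, ∃ s ∈ S, π s = x) ∧ ∀ s ∈ S, π s = 0 → s = 0 := by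
  haveI := Fact.mk hp
  haveI : CharP k p := (CharP.charP_iff_prime_eq_zero hp).2 (by rw [← map_natCast π, h0, map_zero])
  haveI : Nontrivial E := π.domain_nontrivial
  haveI : CharP E p := (CharP.charP_iff_prime_eq_zero hp).2 h0
  refine sec_core π (frobenius E p).range ?_ ?_ ?_
  · rintro _ ⟨x, rfl⟩ hx
    rw [frobenius_def] at hx ⊢
    rw [map_pow] at hx
    have := hk x (eq_zero_of_pow_eq_zero hx)
    exact pow_eq_zero_of_le hp.two_le this
  · intro e he
    obtain ⟨e', he'⟩ := hπ (π e)⁻¹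
    have h1 : π (1 - e * e') = 0 := by rw [map_sub, map_mul, he', map_one, mul_inv_cancel₀ he, sub_self]
    have h2 : IsUnit (e * e') := by
      have : IsNilpotent (1 - e * e') := ⟨2, hk _ h1⟩
      simpa using this.isUnit_one_sub
    exact isUnit_of_mul_isUnit_left h2
  · intro M j hj hS x
    by_cases hx : x ∈ M
    · refine ⟨j ⟨x, hx⟩, hj _, ?_⟩
      have := minpoly.eq_X_sub_C k (A := M) ⟨x, hx⟩
      rw [show algebraMap M k ⟨x, hx⟩ = x from rfl] at this
      rw [this]; simp
    · have hM : ∀ x : k, x ^ p ∈ M := by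
        intro x
        obtain ⟨y, rfl⟩ := hπ x
        obtain ⟨m, hm⟩ := hS _ ⟨y, rfl⟩
        rw [frobenius_def] at hm
        rw [← map_pow, ← hm, hj]; exact m.2
      obtain ⟨y, rfl⟩ := hπ x
      obtain ⟨m, hm⟩ := hS _ ⟨y, rfl⟩
      rw [frobenius_def] at hm
      refine ⟨y, rfl, ?_⟩
      have : m = ⟨π y ^ p, hM _⟩ := Subtype.ext (by rw [← hj, hm, map_pow])
      rw [irr_of_not hp M hM hx, ← this]
      simp [hm]

theorem sec_zero {E : Type*} [CommRing E] [HenselianLocalRing E] [CharZero (ResidueField E)] :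
    ∃ S : Subring E, (∀ x, ∃ s ∈ S, residue E s = x) ∧ ∀ s ∈ S, residue E s = 0 → s = 0 := by
  refine sec_core (residue E) (Int.castRingHom E).range ?_ ?_ ?_
  · rintro _ ⟨x, rfl⟩ hx
    simp at hx
    simp [hx]
  · intro e he
    simpa using he
  · intro M j hj hS x
    obtain ⟨y, rfl⟩ := IsLocalRing.residue_surjective x
    by_cases hint : IsIntegral M (residue E y)
    · have hc : (residue E).comp j = algebraMap M _ := by ext m; exact hj m
      haveI : CharZero M := ⟨fun a b h => by
        have := congrArg (Subtype.val) h
        simpa using this⟩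
      have hsep := (minpoly.irreducible hint).separable
      obtain ⟨a, ha, h1⟩ := HenselianLocalRing.is_henselian ((minpoly M (residue E y)).map j) ((minpoly.monic hint).map j) y
        (by
          rw [← residue_eq_zero_iff, eval_map, hom_eval₂, hc]
          exact minpoly.aeval _ _)
        (by
          rw [← residue_ne_zero_iff_isUnit, derivative_map, eval_map, hom_eval₂, hc]
          exact hsep.aeval_derivative_ne_zero (minpoly.aeval _ _))
      refine ⟨a, ?_, by rw [← eval_map]; exact ha⟩
      rw [← sub_eq_zero, ← map_sub]
      exact (residue_eq_zero_iff _).2 h1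
    · exact ⟨y, rfl, by rw [minpoly.eq_zero hint, eval₂_zero]⟩


theorem adic_lim {D : Type*} [CommRing D] (I : Ideal D) [IsAdicComplete I D] (f : ℕ → D) (h : ∀ n, f (n + 1) - f n ∈ I ^ n) :
    ∃ L, ∀ n, L - f n ∈ I ^ n := by
  obtain ⟨L, hL⟩ := IsPrecomplete.prec (inferInstance : IsPrecomplete I D) (f := f) (by
    intro m n hmn
    rw [SModEq.sub_mem, smul_eq_mul, Ideal.mul_top]
    induction n, hmn using Nat.le_induction with
    | base => simp
    | succ n hn ih =>
      have := (I ^ m).sub_mem ih (Ideal.pow_le_pow_right hn (h n))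
      convert this using 1; ring)
  refine ⟨L, fun n => ?_⟩
  have := hL n
  rw [SModEq.sub_mem, smul_eq_mul, Ideal.mul_top] at this
  rw [← neg_sub]; exact (I ^ n).neg_mem this

theorem adic_zero {D : Type*} [CommRing D] (I : Ideal D) [IsHausdorff I D] (x : D) (h : ∀ n, x ∈ I ^ n) : x = 0 := by
  refine IsHausdorff.haus (I := I) inferInstance x fun n => ?_
  rw [SModEq.sub_mem, smul_eq_mul, Ideal.mul_top, sub_zero]; exact h n

def LQ (p : ℕ) {D : Type*} [CommRing D] [IsLocalRing D] (n : ℕ) (E : Subring D) : Prop :=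
  (∀ x ∈ maximalIdeal D ^ n, x ∈ E) ∧ (∀ x, ∃ e ∈ E, x - e ∈ maximalIdeal D) ∧
    ∀ e ∈ E, e ∈ maximalIdeal D → ∃ a ∈ E, e - p * a ∈ maximalIdeal D ^ n

theorem LQ.inv {p : ℕ} {D : Type*} [CommRing D] [IsLocalRing D] {n : ℕ} {E : Subring D} (hE : LQ p n E) {x y : D} (hx : x ∈ E)
    (hxy : x * y = 1) : y ∈ E := by
  obtain ⟨h1, h2, -⟩ := hE
  obtain ⟨z, hz, h⟩ := h2 y
  have hν : x * (y - z) ∈ maximalIdeal D := Ideal.mul_mem_left _ _ h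
  have hE' : x * (y - z) ∈ E := by rw [mul_sub, hxy]; exact E.sub_mem E.one_mem (E.mul_mem hx hz)
  have hg := mul_neg_geom_sum (x * (y - z)) n
  have e1 : y = z * (∑ i ∈ Finset.range n, (x * (y - z)) ^ i) + (x * (y - z)) ^ n * y := by
    have e2 : 1 - x * (y - z) = x * z := by rw [mul_sub, hxy]; ring
    rw [e2] at hg
    generalize (∑ i ∈ Finset.range n, (x * (y - z)) ^ i) = G at *
    have : (x * y) * z * G + (x * (y - z)) ^ n * y = y := by linear_combination y * hg
    rw [hxy, one_mul] at this
    exact this.symm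
  rw [e1]
  exact E.add_mem (E.mul_mem hz (E.sum_mem fun i _ => E.pow_mem hE' i)) (h1 _ (Ideal.mul_mem_right _ _ (Ideal.pow_mem_pow hν n)))

theorem LQ.step {p : ℕ} (hp : p.Prime) {D : Type*} [CommRing D] [IsLocalRing D] (hpm : (p : D) ∈ maximalIdeal D) {n : ℕ} (hn : 1 ≤ n)
    (E : Subring D) (hE : LQ p n E) : ∃ E', LQ p (n + 1) E' ∧ E' ≤ E ∧ ∀ e ∈ E, ∃ a ∈ E', e - a ∈ maximalIdeal D ^ n := by
  obtain ⟨h1, h2, h3⟩ := hE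
  let I : Ideal E := Ideal.span {(p : E)} ⊔ (maximalIdeal D ^ (n + 1)).comap E.subtype
  have hI : ∀ e : E, e ∈ I ↔ ∃ a : E, (e : D) - p * a ∈ maximalIdeal D ^ (n + 1) := by
    intro e
    rw [Submodule.mem_sup]
    constructor
    · rintro ⟨y, hy, z, hz, rfl⟩
      obtain ⟨a, rfl⟩ := Ideal.mem_span_singleton.1 hy
      refine ⟨a, ?_⟩
      have : ((z : E) : D) ∈ maximalIdeal D ^ (n + 1) := hz
      simpa using this
    · rintro ⟨a, ha⟩
      refine ⟨p * a, Ideal.mem_span_singleton.2 ⟨a, rfl⟩, e - p * a, ?_, by ring⟩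
      simpa [Ideal.mem_comap] using ha
  have hres : ∀ a ∈ I, ((residue D).comp E.subtype) a = 0 := by
    intro a ha
    obtain ⟨b, hb⟩ := (hI a).1 ha
    refine (residue_eq_zero_iff _).2 ?_
    have := (maximalIdeal D).add_mem (Ideal.pow_le_self (by omega) hb) ((maximalIdeal D).mul_mem_right (b : D) hpm)
    simpa using this
  let π : E ⧸ I →+* ResidueField D := Ideal.Quotient.lift I ((residue D).comp E.subtype) hres
  have hπ : ∀ e : E, π (Ideal.Quotient.mk I e) = residue D e := fun e => rfl
  obtain ⟨S, hS1, hS2⟩ := sec_p hp π (by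
      intro x
      obtain ⟨x, rfl⟩ := residue_surjective x
      obtain ⟨e, he, hx⟩ := h2 x
      refine ⟨Ideal.Quotient.mk I ⟨e, he⟩, ?_⟩
      rw [hπ, eq_comm, ← sub_eq_zero, ← map_sub]
      exact (residue_eq_zero_iff _).2 hx)
    (by
      rw [← map_natCast (Ideal.Quotient.mk I), Ideal.Quotient.eq_zero_iff_mem, hI]
      exact ⟨1, by simp⟩)
    (by
      intro x hx
      obtain ⟨e, rfl⟩ := Ideal.Quotient.mk_surjective x
      rw [hπ, residue_eq_zero_iff] at hx
      obtain ⟨a, ha, h4⟩ := h3 e e.2 hx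
      rw [← map_pow, Ideal.Quotient.eq_zero_iff_mem, hI]
      refine ⟨⟨2 * e * a - p * a * a, E.sub_mem (E.mul_mem (E.mul_mem (ofNat_mem E 2) e.2) ha) (E.mul_mem (E.mul_mem (natCast_mem E p) ha) ha)⟩, ?_⟩
      have : ((e : D) - p * a) ^ 2 ∈ maximalIdeal D ^ (n + 1) :=
        Ideal.pow_le_pow_right (by omega) (by rw [pow_mul]; exact Ideal.pow_mem_pow h4 2 : _ ∈ maximalIdeal D ^ (n * 2))
      convert this using 1
      simp; ring)
  let E' : Subring D := (S.comap (Ideal.Quotient.mk I)).map E.subtype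
  have hE' : ∀ e : E, Ideal.Quotient.mk I e ∈ S → (e : D) ∈ E' := fun e he => ⟨e, he, rfl⟩
  have hEI : ∀ e : E, e ∈ I → (e : D) ∈ E' := fun e he => hE' e (by rw [Ideal.Quotient.eq_zero_iff_mem.2 he]; exact S.zero_mem)
  have hpE : ∀ e ∈ E, (p : D) * e ∈ E' := fun e he => hEI (p * ⟨e, he⟩) ((hI _).2 ⟨⟨e, he⟩, by simp⟩)
  have hsurj : ∀ x, ∃ e ∈ E', x - e ∈ maximalIdeal D := by
    intro x
    obtain ⟨s, hs, h⟩ := hS1 (residue D x)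
    obtain ⟨e, rfl⟩ := Ideal.Quotient.mk_surjective s
    refine ⟨e, hE' e hs, ?_⟩
    rw [← residue_eq_zero_iff, map_sub, ← h, hπ, sub_self]
  have hle : E' ≤ E := by
    rintro _ ⟨e, -, rfl⟩; exact e.2
  have hlast : ∀ e ∈ E, ∃ a ∈ E', e - a ∈ maximalIdeal D ^ n := by
    intro e he
    obtain ⟨e0, he0, h⟩ := hsurj e
    obtain ⟨b, hb, h'⟩ := h3 _ (E.sub_mem he (hle he0)) h
    exact ⟨e0 + p * b, E'.add_mem he0 (hpE b hb), by rw [← sub_sub]; exact h'⟩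
  refine ⟨E', ⟨?_, hsurj, ?_⟩, hle, hlast⟩
  · intro x hx
    exact hEI ⟨x, h1 x (Ideal.pow_le_pow_right (by omega) hx)⟩ ((hI _).2 ⟨0, by simpa using hx⟩)
  · rintro _ ⟨e, he, rfl⟩ hm
    have h5 := hS2 _ he ((residue_eq_zero_iff _).2 hm)
    rw [Ideal.Quotient.eq_zero_iff_mem, hI] at h5
    obtain ⟨a, ha⟩ := h5
    obtain ⟨b, hb, h6⟩ := hlast a a.2
    refine ⟨b, hb, ?_⟩
    have := Ideal.add_mem _ ha (by rw [pow_succ']; exact Ideal.mul_mem_mul hpm h6 : (p : D) * (a - b) ∈ maximalIdeal D ^ (n + 1))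
    convert this using 1
    simp; ring

theorem coeff_p {p : ℕ} (hp : p.Prime) {D : Type*} [CommRing D] [IsDomain D] [IsNoetherianRing D] [IsLocalRing D]
    [IsAdicComplete (maximalIdeal D) D] (hpm : (p : D) ∈ maximalIdeal D) : ∃ Λ : Subring D, (∀ x, ∃ l ∈ Λ, x - l ∈ maximalIdeal D) ∧
      (∀ l ∈ Λ, l ∈ maximalIdeal D → ∃ a ∈ Λ, l = p * a) ∧ ∀ x ∈ Λ, ∀ y, x * y = 1 → y ∈ Λ := by
  choose F hF1 hF2 hF3 using fun (n : ℕ) (E : {E : Subring D // LQ p (n + 1) E}) => LQ.step hp hpm (Nat.le_add_left 1 n) E.1 E.2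
  let L : ∀ n, {E : Subring D // LQ p (n + 1) E} := fun n => Nat.rec ⟨⊤, fun _ _ => trivial, fun x => ⟨x, trivial, by simp⟩,
    fun e _ he => ⟨0, trivial, by simpa using he⟩⟩ (fun n E => ⟨F n E, hF1 n E⟩) n
  have hL2 : ∀ n, (L (n + 1)).1 ≤ (L n).1 := fun n => hF2 n (L n)
  have hL3 : ∀ n, ∀ e ∈ (L n).1, ∃ a ∈ (L (n + 1)).1, e - a ∈ maximalIdeal D ^ (n + 1) := fun n => hF3 n (L n)
  have hanti : Antitone fun n => (L n).1 := antitone_nat_of_succ_le hL2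
  let Λ : Subring D := ⨅ n, (L n).1
  have hΛ : ∀ x, (∀ n, ∃ y ∈ (L n).1, x - y ∈ maximalIdeal D ^ (n + 1)) → x ∈ Λ := by
    intro x hx
    refine Subring.mem_iInf.2 fun n => ?_
    obtain ⟨y, hy, h⟩ := hx n
    have := (L n).1.add_mem ((L n).2.1 _ h) hy
    simpa using this
  have key : ∀ n, ∀ x ∈ (L n).1, ∃ l ∈ Λ, x - l ∈ maximalIdeal D ^ (n + 1) := by
    intro n x hx
    choose G hG1 hG2 using fun (k : ℕ) (y : (L k).1) => hL3 k y y.2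
    obtain ⟨s, hs0, hs⟩ : ∃ s : ∀ k, (L (n + k)).1, (s 0).1 = x ∧ ∀ k, (s (k + 1)).1 - (s k).1 ∈ maximalIdeal D ^ (n + k + 1) := by
      refine ⟨fun k => Nat.rec ⟨x, hx⟩ (fun k y => ⟨G (n + k) y, hG1 (n + k) y⟩) k, rfl, fun k => ?_⟩
      have := (Ideal.neg_mem_iff _).2 (hG2 (n + k) (Nat.rec ⟨x, hx⟩ (fun k y => ⟨G (n + k) y, hG1 (n + k) y⟩) k))
      rw [neg_sub] at this
      exact this
    obtain ⟨l, hl⟩ := adic_lim (maximalIdeal D) (fun k => (s (k - (n + 1))).1) (by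
      intro k
      by_cases h : k ≤ n
      · rw [show k + 1 - (n + 1) = 0 by omega, show k - (n + 1) = 0 by omega, sub_self]; exact Ideal.zero_mem _
      · obtain ⟨i, rfl⟩ : ∃ i, k = n + i + 1 := ⟨k - (n + 1), by omega⟩
        rw [show n + i + 1 + 1 - (n + 1) = i + 1 by omega, show n + i + 1 - (n + 1) = i by omega]
        exact hs i)
    refine ⟨l, hΛ l fun k => ?_, ?_⟩
    · by_cases h : k ≤ n
      · have := hl (k + 1)
        rw [show k + 1 - (n + 1) = 0 by omega, hs0] at this
        exact ⟨x, hanti h hx, this⟩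
      · obtain ⟨i, rfl⟩ : ∃ i, k = n + i := ⟨k - n, by omega⟩
        refine ⟨(s i).1, (s i).2, ?_⟩
        have := hl (n + i + 1)
        rwa [show n + i + 1 - (n + 1) = i by omega] at this
    · have := (Ideal.neg_mem_iff _).2 (hl (n + 1))
      rwa [neg_sub, show n + 1 - (n + 1) = 0 by omega, hs0] at this
  refine ⟨Λ, fun x => ?_, fun x hx hxm => ?_, fun x hx y hxy => Subring.mem_iInf.2 fun n => (L n).2.inv (Subring.mem_iInf.1 hx n) hxy⟩
  · obtain ⟨l, hl, h⟩ := key 0 x trivial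
    exact ⟨l, hl, by simpa using h⟩
  · have hx' : ∀ n, ∃ a ∈ Λ, x - p * a ∈ maximalIdeal D ^ n := by
      intro n
      obtain ⟨b, hb, h⟩ := (L n).2.2.2 x (Subring.mem_iInf.1 hx n) hxm
      obtain ⟨a, ha, h'⟩ := key n b hb
      refine ⟨a, ha, Ideal.pow_le_pow_right (Nat.le_succ n) ?_⟩
      have := Ideal.add_mem _ h (Ideal.mul_mem_left _ (p : D) h')
      convert this using 1; ring
    by_cases hp0 : (p : D) = 0
    · refine ⟨0, Λ.zero_mem, ?_⟩
      rw [mul_zero]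
      refine adic_zero (maximalIdeal D) x fun n => ?_
      obtain ⟨a, -, ha⟩ := hx' n
      simpa [hp0] using ha
    obtain ⟨c, hc⟩ := Ideal.exists_pow_inf_eq_pow_smul (maximalIdeal D) (Ideal.span {(p : D)})
    have hAR : ∀ n a, (p : D) * a ∈ maximalIdeal D ^ (n + c) → a ∈ maximalIdeal D ^ n := by
      intro n a ha
      have h1 : (p : D) * a ∈ maximalIdeal D ^ (n + c) • ⊤ ⊓ Ideal.span {(p : D)} :=
        ⟨by rw [smul_eq_mul, Ideal.mul_top]; exact ha, Ideal.mem_span_singleton.2 ⟨a, rfl⟩⟩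
      rw [hc _ (by omega), show n + c - c = n by omega] at h1
      have h2 := Ideal.mul_mono_right (I := maximalIdeal D ^ n) inf_le_right h1
      obtain ⟨z, hz, h3⟩ := Ideal.mem_mul_span_singleton.1 h2
      rw [mul_comm] at h3
      rwa [← mul_left_cancel₀ hp0 h3]
    choose a haΛ ha using fun n => hx' (n + c)
    obtain ⟨l, hl⟩ := adic_lim (maximalIdeal D) a (by
      intro n
      apply hAR
      have := Ideal.sub_mem _ (ha n) (Ideal.pow_le_pow_right (by omega) (ha (n + 1)))
      convert this using 1; ring)
    refine ⟨l, hΛ l fun n => ⟨a (n + 1), Subring.mem_iInf.1 (haΛ _) n, hl (n + 1)⟩, ?_⟩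
    rw [← sub_eq_zero]
    refine adic_zero (maximalIdeal D) _ fun n => ?_
    have := Ideal.sub_mem _ (Ideal.pow_le_pow_right (by omega) (ha n)) (Ideal.mul_mem_left _ (p : D) (hl n))
    convert this using 1; ring

def IsCoeff {D : Type*} [CommRing D] [IsLocalRing D] (Λ : Subring D) (w : D) : Prop :=
  w ∈ maximalIdeal D ∧ w ∈ Λ ∧ (∀ x, ∃ l ∈ Λ, x - l ∈ maximalIdeal D) ∧ (∀ l ∈ Λ, l ∈ maximalIdeal D → ∃ a ∈ Λ, l = w * a) ∧
    (∀ x ∈ Λ, ∀ y, x * y = 1 → y ∈ Λ) ∧ (w = 0 ∨ CharZero D)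

theorem coeff_exists (D : Type*) [CommRing D] [IsDomain D] [IsNoetherianRing D] [IsLocalRing D]
    [IsAdicComplete (maximalIdeal D) D] : ∃ (Λ : Subring D) (w : D), IsCoeff Λ w := by
  rcases CharP.exists (ResidueField D) with ⟨p, hp⟩
  rcases CharP.char_is_prime_or_zero (ResidueField D) p with h | rfl
  · have hpm : (p : D) ∈ maximalIdeal D := by
      rw [← residue_eq_zero_iff, map_natCast, CharP.cast_eq_zero]
    obtain ⟨Λ, h1, h2, h3⟩ := coeff_p h hpm
    refine ⟨Λ, p, hpm, natCast_mem Λ p, h1, h2, h3, ?_⟩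
    by_cases hp0 : (p : D) = 0
    · exact Or.inl hp0
    right
    rcases CharP.exists D with ⟨q, hq⟩
    rcases CharP.char_is_prime_or_zero D q with h' | rfl
    · exfalso
      have : p ∣ q := by
        rw [← CharP.cast_eq_zero_iff (ResidueField D), ← map_natCast (residue D), CharP.cast_eq_zero, map_zero]
      rw [(Nat.prime_dvd_prime_iff_eq h h').1 this] at hp0
      exact hp0 (CharP.cast_eq_zero D q)
    · exact CharP.charP_to_charZero D
  · haveI := CharP.charP_to_charZero (ResidueField D)
    haveI : HenselianLocalRing D := ⟨fun f hf a h1 h2 =>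
      HenselianRing.is_henselian (I := maximalIdeal D) f hf a h1 (h2.map _)⟩
    obtain ⟨S, h1, h2⟩ := sec_zero (E := D)
    have h3 : ∀ x, ∃ l ∈ S, x - l ∈ maximalIdeal D := fun x => by
      obtain ⟨l, hl, h⟩ := h1 (residue D x)
      exact ⟨l, hl, by rw [← residue_eq_zero_iff, map_sub, h, sub_self]⟩
    refine ⟨S, 0, zero_mem _, S.zero_mem, h3, fun l hl hm => ⟨0, S.zero_mem, ?_⟩, fun x hx y hxy => ?_, Or.inl rfl⟩
    · rw [mul_zero]; exact h2 l hl ((residue_eq_zero_iff _).2 hm)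
    · obtain ⟨l, hl, h⟩ := h3 y
      have h4 := h2 (1 - x * l) (S.sub_mem S.one_mem (S.mul_mem hx hl))
        ((residue_eq_zero_iff _).2 (by rw [← hxy, ← mul_sub]; exact Ideal.mul_mem_left _ _ h))
      have : y = l := by linear_combination y * h4 + l * hxy
      rwa [this]


theorem IsCoeff.noeth {D : Type*} [CommRing D] [IsLocalRing D] [IsHausdorff (maximalIdeal D) D] {Λ : Subring D} {w : D}
    (h : IsCoeff Λ w) : IsNoetherianRing Λ := by
  obtain ⟨hm, hw, -, h2, h3, -⟩ := h
  have key : ∀ (P : Ideal Λ), P ≠ ⊤ → ∀ x ∈ P, ∃ a : Λ, x = ⟨w, hw⟩ * a := by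
    intro P hP x hx
    have hxm : (x : D) ∈ maximalIdeal D := by
      by_contra hu
      obtain ⟨y, hy⟩ := (not_not.1 ((mem_maximalIdeal _).not.1 hu)).exists_right_inv
      refine hP (Ideal.eq_top_of_isUnit_mem _ hx ?_)
      exact IsUnit.of_mul_eq_one ⟨y, h3 x x.2 y hy⟩ (Subtype.ext hy)
    obtain ⟨a, ha, e⟩ := h2 x x.2 hxm
    exact ⟨⟨a, ha⟩, Subtype.ext e⟩
  refine IsNoetherianRing.of_prime fun P hP => ?_
  by_cases hwP : (⟨w, hw⟩ : Λ) ∈ P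
  · refine ⟨{⟨w, hw⟩}, le_antisymm (Submodule.span_le.2 (by simpa using hwP)) fun x hx => ?_⟩
    obtain ⟨a, rfl⟩ := key P hP.ne_top x hx
    exact Ideal.mul_mem_right _ _ (Ideal.subset_span (by simp))
  · have hn : ∀ n : ℕ, ∀ x ∈ P, (x : D) ∈ maximalIdeal D ^ n := by
      intro n
      induction n with
      | zero => simp
      | succ n ih =>
        intro x hx
        obtain ⟨a, rfl⟩ := key P hP.ne_top x hx
        rw [pow_succ']
        exact Ideal.mul_mem_mul hm (ih a ((hP.mem_or_mem hx).resolve_left hwP))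
    have : P = ⊥ := by
      rw [eq_bot_iff]
      intro x hx
      exact Subtype.ext (adic_zero (maximalIdeal D) _ fun n => hn n x hx)
    rw [this]; exact Submodule.fg_bot

theorem dim_le_of_integral {W D : Type*} [CommRing W] [CommRing D] [Algebra W D] [Algebra.IsIntegral W D] :
    ringKrullDim D ≤ ringKrullDim W :=
  Order.krullDim_le_of_strictMono (PrimeSpectrum.comap (algebraMap W D)) fun I J h =>
    Ideal.IsIntegral.comap_lt_comap (I := I.asIdeal) (J := J.asIdeal) h

theorem fin_of {W D : Type u} [CommRing W] [CommRing D] [IsNoetherianRing D] [IsLocalRing D] [Algebra W D] [IsNoetherianRing W] (J : Ideal W)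
    [IsAdicComplete J W] [IsHausdorff (maximalIdeal D) D] (hJ : J.map (algebraMap W D) ≤ maximalIdeal D)
    (r : ℕ) (hr : maximalIdeal D ^ r ≤ J.map (algebraMap W D)) (hs : ∀ x : D, ∃ w : W, x - algebraMap W D w ∈ maximalIdeal D) :
    Module.Finite W D := by
  have h1 : ∀ I : Ideal D, ∃ F : Submodule W D, F.FG ∧ I.restrictScalars W ≤ F ⊔ (maximalIdeal D * I).restrictScalars W := by
    intro I
    obtain ⟨s, hs'⟩ := IsNoetherian.noetherian I
    refine ⟨Submodule.span W s, ⟨s, rfl⟩, ?_⟩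
    intro x hx
    rw [Submodule.restrictScalars_mem, ← hs'] at hx
    induction hx using Submodule.span_induction with
    | mem x hx => exact Submodule.mem_sup_left (Submodule.subset_span hx)
    | zero => exact zero_mem _
    | add x y _ _ h h' => exact add_mem h h'
    | smul a x hx h =>
      obtain ⟨w, hw⟩ := hs a
      have e : a • x = w • x + (a - algebraMap W D w) * x := by rw [smul_eq_mul, Algebra.smul_def]; ring
      rw [e]
      refine add_mem (Submodule.smul_mem _ w h) (Submodule.mem_sup_right ?_)
      rw [Submodule.restrictScalars_mem]
      exact Ideal.mul_mem_mul hw (hs' ▸ hx)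
  have h2 : ∀ n : ℕ, ∃ F : Submodule W D, F.FG ∧ F ⊔ (maximalIdeal D ^ n).restrictScalars W = ⊤ := by
    intro n
    induction n with
    | zero => exact ⟨⊥, Submodule.fg_bot, by simp⟩
    | succ n ih =>
      obtain ⟨F, hF, h⟩ := ih
      obtain ⟨F', hF', h'⟩ := h1 (maximalIdeal D ^ n)
      refine ⟨F ⊔ F', hF.sup hF', ?_⟩
      rw [eq_top_iff, ← h, sup_assoc, pow_succ']
      exact sup_le_sup_left h' _
  obtain ⟨F, hF, h⟩ := h2 r
  haveI : Module.Finite W F := Module.Finite.iff_fg.2 hF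
  haveI : IsAdicComplete J F := complete_finite J inferInstance F
  have hJ' : ∀ n : ℕ, (J ^ n • ⊤ : Submodule W D) = ((J.map (algebraMap W D)) ^ n).restrictScalars W := fun n => by
    rw [Ideal.smul_top_eq_map, Ideal.map_pow]
  haveI : IsHausdorff J D := ⟨fun x hx => adic_zero (maximalIdeal D) x fun n => by
    have := hx n
    rw [SModEq.sub_mem, sub_zero, hJ'] at this
    exact Ideal.pow_right_mono hJ n this⟩
  have hsur : Function.Surjective F.subtype := by
    refine surjective_of_mkQ_comp_surjective (I := J) fun x => ?_
    obtain ⟨x, rfl⟩ := Submodule.mkQ_surjective _ x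
    have hx : x ∈ F ⊔ (maximalIdeal D ^ r).restrictScalars W := h ▸ trivial
    obtain ⟨y, hy, z, hz, rfl⟩ := Submodule.mem_sup.1 hx
    refine ⟨⟨y, hy⟩, ?_⟩
    have h0 := hJ' 1
    rw [pow_one, pow_one] at h0
    rw [LinearMap.comp_apply, Submodule.mkQ_apply, Submodule.mkQ_apply, eq_comm, Submodule.Quotient.eq, h0]
    simpa using hr hz
  exact Module.Finite.of_surjective _ hsur

theorem IsComp.isLocal' {P W : Type*} [CommRing P] [CommRing W] {I : Ideal P} [I.IsMaximal] {φ : P →+* W}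
    (h : IsComp φ I) : IsLocalRing W ∧ (I.map φ).IsMaximal := by
  have hm : (I.map φ).IsMaximal := by
    obtain ⟨π, h1, h2, h3⟩ := h.proj 1
    rw [← pow_one (I.map φ), ← h3]
    have hs : Function.Surjective π := fun y => by
      obtain ⟨a, rfl⟩ := Ideal.Quotient.mk_surjective y
      exact ⟨_, h2 a⟩
    have : (I ^ 1).IsMaximal := by rw [pow_one]; infer_instance
    letI := Ideal.Quotient.field (I ^ 1)
    exact RingHom.ker_isMaximal_of_surjective π hs
  have := h.complete
  exact ⟨isLocalRing_of_isAdicComplete_maximal (I.map φ), hm⟩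

open Classical in
theorem sop (D : Type u) [CommRing D] [IsDomain D] [IsNoetherianRing D] [IsLocalRing D] (w : D) (hw : w ∈ maximalIdeal D) :
    ∃ (σ : Type u) (_ : Fintype σ) (y : σ → D) (r : ℕ), (∀ i, y i ∈ maximalIdeal D) ∧
      maximalIdeal D ^ r ≤ Ideal.span (insert w (Set.range y)) ∧
      ((Fintype.card σ + (if w = 0 then 0 else 1) : ℕ) : WithBot ℕ∞) ≤ ringKrullDim D := by
  haveI : Nontrivial (D ⧸ Ideal.span {w}) := Ideal.Quotient.nontrivial_iff.2
    (((Ideal.span_singleton_le_iff_mem _).2 hw).trans_lt (IsLocalRing.maximalIdeal.isMaximal D).ne_top.lt_top).ne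
  haveI : IsLocalRing (D ⧸ Ideal.span {w}) := IsLocalRing.of_surjective' _ Ideal.Quotient.mk_surjective
  obtain ⟨s, hs, hc⟩ := Ideal.exists_finset_card_eq_height_of_isNoetherianRing (maximalIdeal (D ⧸ Ideal.span {w}))
  choose g hg using Ideal.Quotient.mk_surjective (I := Ideal.span {w})
  have hsm : Ideal.span (s : Set (D ⧸ Ideal.span {w})) ≤ maximalIdeal _ := hs.1.2
  have hrad : maximalIdeal (D ⧸ Ideal.span {w}) ≤ (Ideal.span (s : Set (D ⧸ Ideal.span {w}))).radical := by
    rw [Ideal.radical_eq_sInf]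
    refine le_sInf fun P hP => hs.2 ⟨hP.2, hP.1⟩ (IsLocalRing.le_maximalIdeal hP.2.ne_top)
  obtain ⟨r, hr⟩ := Ideal.exists_pow_le_of_le_radical_of_fg hrad (IsNoetherian.noetherian _)
  refine ⟨s, inferInstance, fun i => g i, r, fun i => ?_, ?_, ?_⟩
  · have h1 := hsm (Ideal.subset_span i.2)
    rw [← hg i.1, max_quot] at h1
    rw [Ideal.mem_map_iff_of_surjective _ Ideal.Quotient.mk_surjective] at h1
    obtain ⟨z, hz, h2⟩ := h1
    rw [← sub_eq_zero, ← map_sub, Ideal.Quotient.eq_zero_iff_mem] at h2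
    have := Ideal.sub_mem _ hz ((Ideal.span_singleton_le_iff_mem _).2 hw h2)
    simpa using this
  · intro x hx
    have h1 : Ideal.Quotient.mk (Ideal.span {w}) x ∈ Ideal.span (s : Set (D ⧸ Ideal.span {w})) := by
      apply hr
      rw [max_quot, ← Ideal.map_pow]
      exact Ideal.mem_map_of_mem _ hx
    have h2 : Ideal.span (s : Set (D ⧸ Ideal.span {w})) = (Ideal.span (Set.range fun i : s => g i)).map (Ideal.Quotient.mk (Ideal.span {w})) := by
      rw [Ideal.map_span, ← Set.range_comp]
      congr 1
      ext z
      simp [hg]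
    rw [h2, Ideal.mem_map_iff_of_surjective _ Ideal.Quotient.mk_surjective] at h1
    obtain ⟨z, hz, h3⟩ := h1
    rw [← sub_eq_zero, ← map_sub, Ideal.Quotient.eq_zero_iff_mem] at h3
    rw [Ideal.span_insert]
    have := Ideal.sub_mem _ (Ideal.mem_sup_right hz) (Ideal.mem_sup_left (T := Ideal.span (Set.range fun i : s => g i)) h3)
    simpa using this
  · have h1 : ((s.card : ℕ) : WithBot ℕ∞) = ringKrullDim (D ⧸ Ideal.span {w}) := by
      rw [← IsLocalRing.maximalIdeal_height_eq_ringKrullDim, ← hc]; rfl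
    rw [Fintype.card_coe]
    split_ifs with h0
    · rw [add_zero, h1]
      exact ringKrullDim_le_of_surjective _ Ideal.Quotient.mk_surjective
    · rw [Nat.cast_add, h1, Nat.cast_one]
      exact ringKrullDim_quotient_succ_le_of_nonZeroDivisor (mem_nonZeroDivisors_of_ne_zero h0)


lemma vars_aux {σ : Type*} {Λ : Type*} [CommRing Λ] (f : MvPolynomial σ Λ) :
    f - MvPolynomial.C (MvPolynomial.constantCoeff f) ∈ MvPolynomial.idealOfVars σ Λ := by
  induction f using MvPolynomial.induction_on with
  | C a => simp
  | add p q hp hq =>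
    have := Ideal.add_mem _ hp hq
    rw [map_add, map_add]
    convert this using 1; ring
  | mul_X p i hp =>
    rw [map_mul, MvPolynomial.constantCoeff_X, mul_zero, map_zero, sub_zero]
    exact Ideal.mul_mem_left _ _ (Ideal.subset_span ⟨i, rfl⟩)


open Classical in
theorem coh (D : Type u) [CommRing D] [IsDomain D] [IsNoetherianRing D] [IsLocalRing D] [IsAdicComplete (maximalIdeal D) D] : Coh D := by
  obtain ⟨Λ, w, hΛ⟩ := coeff_exists D
  haveI := hΛ.noeth
  obtain ⟨hm, hw, hsurj, hdiv, hinv, hchar⟩ := hΛ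
  obtain ⟨σ, _, y, r, hy, hr, hdim⟩ := sop D w hm
  let ψ : MvPolynomial σ Λ →+* D := MvPolynomial.eval₂Hom Λ.subtype y
  have hψC : ∀ a, ψ (MvPolynomial.C a) = a := fun a => MvPolynomial.eval₂Hom_C _ _ _
  have hψX : ∀ i, ψ (MvPolynomial.X i) = y i := fun i => MvPolynomial.eval₂Hom_X' _ _ _
  let J : Ideal (MvPolynomial σ Λ) := Ideal.span (insert (MvPolynomial.C ⟨w, hw⟩) (Set.range MvPolynomial.X))
  have hJψ : J.map ψ = Ideal.span (insert w (Set.range y)) := by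
    rw [Ideal.map_span, Set.image_insert_eq, ← Set.range_comp, hψC]
    congr 3; ext i; rw [Function.comp_apply, hψX]
  have hJm : J.map ψ ≤ maximalIdeal D := by
    rw [hJψ, Ideal.span_le]
    rintro x (rfl | ⟨i, rfl⟩)
    · exact hm
    · exact hy i
  have hJker : J = RingHom.ker ((residue D).comp ψ) := by
    apply le_antisymm
    · intro x hx
      exact (residue_eq_zero_iff _).2 (hJm (Ideal.mem_map_of_mem _ hx))
    · intro f hf
      have hf : ψ f ∈ maximalIdeal D := (residue_eq_zero_iff _).1 hf
      have hvars : f - MvPolynomial.C (MvPolynomial.constantCoeff f) ∈ J := by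
        have : f - MvPolynomial.C (MvPolynomial.constantCoeff f) ∈ MvPolynomial.idealOfVars σ Λ := vars_aux f
        exact Ideal.span_mono (Set.subset_insert _ _) this
      have h1 := Ideal.sub_mem _ hf (hJm (Ideal.mem_map_of_mem ψ hvars))
      rw [← map_sub, sub_sub_cancel, hψC] at h1
      obtain ⟨a, ha, e⟩ := hdiv _ (Subtype.prop _) h1
      have e' : MvPolynomial.constantCoeff f = ⟨w, hw⟩ * ⟨a, ha⟩ := Subtype.ext e
      rw [e', map_mul] at hvars
      have := Ideal.add_mem _ hvars (Ideal.mul_mem_right (MvPolynomial.C ⟨a, ha⟩) J (Ideal.subset_span (Set.mem_insert _ _)))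
      simpa using this
  haveI : J.IsMaximal := by
    rw [hJker]
    refine RingHom.ker_isMaximal_of_surjective _ fun x => ?_
    obtain ⟨x, rfl⟩ := residue_surjective x
    obtain ⟨l, hl, h⟩ := hsurj x
    refine ⟨MvPolynomial.C ⟨l, hl⟩, ?_⟩
    rw [RingHom.comp_apply, hψC, eq_comm, ← sub_eq_zero, ← map_sub]
    exact (residue_eq_zero_iff _).2 h
  obtain ⟨W, _, φ, hφ⟩ : ∃ (W : Type u) (_ : CommRing W) (φ : MvPolynomial σ Λ →+* W), IsComp φ J :=
    ⟨AdicCompletion J (MvPolynomial σ Λ), inferInstance, algebraMap _ _, IsComp.adic _ (IsNoetherian.noetherian _)⟩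
  haveI := hφ.noeth
  haveI := hφ.complete
  obtain ⟨hloc, hmax⟩ := hφ.isLocal'
  have hmW : J.map φ = maximalIdeal W := IsLocalRing.eq_maximalIdeal hmax
  obtain ⟨Ψ, hΨ⟩ := lift_exists hφ.toIsDense (maximalIdeal D) ψ hJm
  letI : Algebra W D := Ψ.toAlgebra
  have hJW : (J.map φ).map (algebraMap W D) = J.map ψ := by
    rw [Ideal.map_map]; congr 1
  have hres : ∀ d : D, ∃ v, d - algebraMap W D v ∈ maximalIdeal D := by
    intro d
    obtain ⟨l, hl, h⟩ := hsurj d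
    refine ⟨φ (MvPolynomial.C ⟨l, hl⟩), ?_⟩
    have : Ψ (φ (MvPolynomial.C ⟨l, hl⟩)) = l := by
      rw [← RingHom.comp_apply, hΨ, hψC]
    rw [show algebraMap W D = Ψ from rfl, this]; exact h
  haveI hfin : Module.Finite W D := fin_of (J.map φ) (hJW ▸ hJm) r (by rw [hJW, hJψ]; exact hr) hres
  have hDW : ringKrullDim D ≤ ringKrullDim W := dim_le_of_integral
  obtain ⟨s, hs, hcard⟩ : ∃ s : Finset W, Ideal.span (s : Set W) = maximalIdeal W ∧ s.card ≤ Fintype.card σ + (if w = 0 then 0 else 1) := by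
    have h1 : maximalIdeal W = Ideal.span (insert (φ (MvPolynomial.C ⟨w, hw⟩)) (Set.range fun i => φ (MvPolynomial.X i))) := by
      rw [← hmW, Ideal.map_span, Set.image_insert_eq, ← Set.range_comp]; rfl
    have h2 : (Finset.univ.image (fun i => φ (MvPolynomial.X i))).card ≤ Fintype.card σ := Finset.card_image_le
    split_ifs with h0
    · refine ⟨Finset.univ.image (fun i => φ (MvPolynomial.X i)), ?_, h2⟩
      have h3 : (⟨w, hw⟩ : Λ) = 0 := Subtype.ext h0
      rw [h1, h3]; simp
    · refine ⟨insert (φ (MvPolynomial.C ⟨w, hw⟩)) (Finset.univ.image (fun i => φ (MvPolynomial.X i))), ?_, (Finset.card_insert_le _ _).trans (Nat.succ_le_succ h2)⟩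
      rw [h1]; simp
  have hcard' : ((s.card : ℕ) : WithBot ℕ∞) ≤ ringKrullDim D := le_trans (by exact_mod_cast hcard) hdim
  haveI hreg : IsRegularLocalRing W := reg_of_span s hs (hcard'.trans hDW)
  haveI : IsDomain W := reg_domain W
  have hWs : ringKrullDim W ≤ (s.card : ℕ) := by
    refine (ringKrullDim_le_spanFinrank_maximalIdeal W).trans ?_
    rw [← hs]
    have := Submodule.spanFinrank_span_le_ncard_of_finite (R := W) s.finite_toSet
    rw [Set.ncard_coe_finset] at this
    exact_mod_cast this
  have hinj : Function.Injective (algebraMap W D) := by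
    rw [injective_iff_map_eq_zero]
    intro a ha
    by_contra h0
    have h1 := ringKrullDim_quotient_succ_le_of_nonZeroDivisor (mem_nonZeroDivisors_of_ne_zero h0)
    let f : W ⧸ Ideal.span {a} →+* D := Ideal.Quotient.lift _ (algebraMap W D) (fun x hx => by
      obtain ⟨c, rfl⟩ := Ideal.mem_span_singleton.1 hx
      rw [map_mul, ha, zero_mul])
    letI : Algebra (W ⧸ Ideal.span {a}) D := f.toAlgebra
    haveI : IsScalarTower W (W ⧸ Ideal.span {a}) D := IsScalarTower.of_algebraMap_eq fun x => rfl
    haveI : Module.Finite (W ⧸ Ideal.span {a}) D := Module.Finite.of_restrictScalars_finite W _ _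
    have h2 : ringKrullDim D ≤ ringKrullDim (W ⧸ Ideal.span {a}) := dim_le_of_integral
    have h3 : ((s.card : ℕ) : WithBot ℕ∞) + 1 ≤ (s.card : ℕ) :=
      (add_le_add_left (hcard'.trans h2) 1).trans (h1.trans hWs)
    have h4 : s.card + 1 ≤ s.card := by exact_mod_cast h3
    omega
  refine ⟨W, inferInstance, inferInstance, hreg, hfin, hinj, hres, ?_⟩
  rcases hchar with rfl | hc
  · have hfield : IsField Λ :=
      { exists_pair_ne := exists_pair_ne Λ
        mul_comm := mul_comm
        mul_inv_cancel := by
          intro a ha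
          have hu : IsUnit (a : D) := by
            by_contra hu
            obtain ⟨b, -, e⟩ := hdiv a a.2 hu
            exact ha (Subtype.ext (by rw [e, zero_mul]; rfl))
          obtain ⟨b, hb⟩ := hu.exists_right_inv
          exact ⟨⟨b, hinv a a.2 b hb⟩, Subtype.ext hb⟩ }
    letI := hfield.toField
    have hJv : J = MvPolynomial.idealOfVars σ Λ := by
      have h3 : (⟨0, hw⟩ : Λ) = 0 := rfl
      simp only [J, h3, map_zero, Ideal.span_insert_zero]
    rw [hJv] at hφ
    obtain ⟨e, -⟩ := hφ.equiv (IsComp.mvps σ Λ)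
    obtain ⟨q, hq⟩ := ExpChar.exists Λ
    refine ⟨q, expChar_of_injective_ringHom (f := φ.comp MvPolynomial.C) (RingHom.injective _) q, ?_⟩
    refine QQ.equiv e.symm ?_
    rcases hq with _ | hp
    · exact fun a ha => absurd (pow_one a) (ha a)
    · exact QQ.mvps hp Λ σ
  · haveI : CharZero W := ⟨fun a b h => by
      have := congrArg (algebraMap W D) h
      simpa using this⟩
    exact ⟨1, ExpChar.zero, fun a ha => absurd (pow_one a) (ha a)⟩

end GR

namespace CharPolyhedra

/-- **Lemma II.1 (b).** If `R` is a regular local G-ring, then every quotient of `R`,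
every localization of `R` at a prime, and every localization of `R[T]` at a maximal
ideal is again a G-ring. -/
theorem GRing_stability
    (R : Type u) [CommRing R] [IsLocalRing R]
    (hreg : IsRegularLocalRing R) (hG : IsGRing R) :
    (∀ I : Ideal R, IsGRing (R ⧸ I)) ∧
    (∀ (P : Ideal R) [P.IsPrime], IsGRing (Localization.AtPrime P)) ∧
    (∀ (Q : Ideal (Polynomial R)) [Q.IsMaximal], IsGRing (Localization.AtPrime Q)) := by
  exact GR.reduction (GR.main_of (GR.mainC (fun D => GR.coh D))) R hG

end CharPolyhedra
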